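/- arXiv:2205.07296 — 2 statements merged into one kernel-verified Lean document; each statement's English description precedes it below -/
import Mathlib

section
/- For every ε ∈ (0, 1/2) there exist an integer h₀ = h₀(ε) and, for every integer h ≥ h₀, constants c = c(h, ε) > 0 and c' = c'(h, ε) > 0 with the following property. Let A ⊂ ℤ be a finite set with |A| ≥ 2, let B be a B_h^+[1] subset of A of maximal size, and let C be a B_h^×[1] subset of A of maximal size. Then max{|B|, |C|} ≥ c'·|A|^{(log h)^{1/2 − ε}/h}. In particular, |hA| + |A^h| ≥ c·|A|^{(log h)^{1/2 − ε}}, where hA is the h-fold sumset of A and A^h is the h-fold product set of A. -/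
open Finset Pointwise

universe u

/-- A finset `Λ` in an abelian group is `k`-dissociated if every integer relation
`∑ ε_λ • λ = 0` with `|ε_λ| ≤ k` forces all `ε_λ = 0`. -/
def IsKDissociated {G : Type*} [AddCommGroup G] (k : ℕ) (Λ : Finset G) : Prop :=
  ∀ ε : G → ℤ, (∀ x ∈ Λ, |ε x| ≤ (k : ℤ)) → (∑ x ∈ Λ, ε x • x) = 0 → ∀ x ∈ Λ, ε x = 0

/-- `addDim k A` is the maximal size of a `k`-dissociated subset of `A`. -/
noncomputable def addDim {G : Type*} [AddCommGroup G] (k : ℕ) (A : Finset G) : ℕ :=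
  sSup {n : ℕ | ∃ Λ : Finset G, Λ ⊆ A ∧ Λ.card = n ∧ IsKDissociated k Λ}

/-- `nFold A n` is the `n`-fold sumset `A + A + ⋯ + A` (`n` summands). -/
def nFold {G : Type*} [AddCommGroup G] [DecidableEq G] (A : Finset G) : ℕ → Finset G
  | 0 => {0}
  | n + 1 => nFold A n + A

/-- `nFoldMul A n` is the `n`-fold product set `A · A ⋯ A` (`n` factors). -/
def nFoldMul (A : Finset ℤ) : ℕ → Finset ℤ
  | 0 => {1}
  | n + 1 => nFoldMul A n * A

/-- `B` is a `B_h^+[1]` set: every integer has at most one representation, up to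
reordering, as a sum of `h` elements of `B`. -/
def IsBhPlus (h : ℕ) (B : Finset ℤ) : Prop :=
  ∀ s t : Multiset ℤ, Multiset.card s = h → Multiset.card t = h →
    (∀ x ∈ s, x ∈ B) → (∀ x ∈ t, x ∈ B) → s.sum = t.sum → s = t

/-- `C` is a `B_h^×[1]` set: every integer has at most one representation, up to
reordering, as a product of `h` elements of `C`. -/
def IsBhMul (h : ℕ) (C : Finset ℤ) : Prop :=
  ∀ s t : Multiset ℤ, Multiset.card s = h → Multiset.card t = h →
    (∀ x ∈ s, x ∈ C) → (∀ x ∈ t, x ∈ C) → s.prod = t.prod → s = t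


section Fourier

open MeasureTheory AddCircle

/-- The trigonometric polynomial `∑ x ∈ s, f x e(φ x t)` on the unit circle. -/
noncomputable def expSum {α : Type*} (s : Finset α) (f : α → ℝ) (φ : α → ℤ)
    (t : UnitAddCircle) : ℂ :=
  ∑ x ∈ s, (f x : ℂ) * fourier (φ x) t

/-- The mean of a function over the unit circle. -/
noncomputable def circleMean (g : UnitAddCircle → ℝ) : ℝ :=
  ∫ t, g t ∂haarAddCircle

/-- The `m`-th moment norm of the exponential sum `expSum s f φ`. -/
noncomputable def expNorm (m : ℕ) {α : Type*} (s : Finset α) (f : α → ℝ) (φ : α → ℤ) : ℝ :=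
  (circleMean fun t => ‖expSum s f φ t‖ ^ m) ^ ((m : ℝ)⁻¹)

theorem continuous_expSum {α : Type*} (s : Finset α) (f : α → ℝ) (φ : α → ℤ) :
    Continuous (expSum s f φ) := by
  unfold expSum
  fun_prop

theorem integrable_circle {E : Type*} [NormedAddCommGroup E] {g : UnitAddCircle → E}
    (hg : Continuous g) : Integrable g (haarAddCircle (T := 1)) :=
  hg.integrable_of_hasCompactSupport (HasCompactSupport.of_compactSpace g)

theorem integral_fourier_eq (n : ℤ) :
    ∫ t, fourier n t ∂(haarAddCircle (T := 1)) = if n = 0 then (1 : ℂ) else 0 := by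
  have h := congrFun (fourierCoeff_fourier (T := 1) n) 0
  simp only [fourierCoeff, neg_zero, fourier_zero, one_smul] at h
  rw [h]
  by_cases hn : n = 0
  · subst hn; simp
  · rw [if_neg hn, Pi.single_eq_of_ne (Ne.symm hn)]

theorem circleMean_mono {g g' : UnitAddCircle → ℝ} (hg : Continuous g) (hg' : Continuous g')
    (h : ∀ t, g t ≤ g' t) : circleMean g ≤ circleMean g' :=
  integral_mono (integrable_circle hg) (integrable_circle hg') h

theorem circleMean_nonneg {g : UnitAddCircle → ℝ} (h : ∀ t, 0 ≤ g t) : 0 ≤ circleMean g :=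
  integral_nonneg h

theorem circleMean_const (c : ℝ) : circleMean (fun _ => c) = c := by
  simp [circleMean]

theorem expNorm_nonneg (m : ℕ) {α : Type*} (s : Finset α) (f : α → ℝ) (φ : α → ℤ) :
    0 ≤ expNorm m s f φ :=
  Real.rpow_nonneg (circleMean_nonneg fun _ => by positivity) _

theorem expNorm_pow {m : ℕ} (hm : m ≠ 0) {α : Type*} (s : Finset α) (f : α → ℝ) (φ : α → ℤ) :
    expNorm m s f φ ^ m = circleMean fun t => ‖expSum s f φ t‖ ^ m :=
  Real.rpow_inv_natCast_pow (circleMean_nonneg fun _ => by positivity) hm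

/-- Hölder's inequality for at most `m` factors on the circle. -/
theorem circleMean_prod_le {ι : Type*} (s : Finset ι) {m : ℕ} (hm : m ≠ 0) (hs : s.card ≤ m)
    (g : ι → UnitAddCircle → ℝ) (hc : ∀ i, Continuous (g i)) (h0 : ∀ i t, 0 ≤ g i t) :
    circleMean (fun t => ∏ i ∈ s, g i t) ≤
      ∏ i ∈ s, (circleMean fun t => g i t ^ m) ^ ((m : ℝ)⁻¹) := by
  have hm' : (0 : ℝ) < m := by positivity
  set N : ι → ℝ := fun i => (circleMean fun t => g i t ^ m) ^ ((m : ℝ)⁻¹) with hN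
  have hmean0 : ∀ i, 0 ≤ circleMean fun t => g i t ^ m := fun i =>
    circleMean_nonneg fun t => pow_nonneg (h0 i t) m
  have hN0 : ∀ i, 0 ≤ N i := fun i => Real.rpow_nonneg (hmean0 i) _
  have hNpow : ∀ i, N i ^ m = circleMean fun t => g i t ^ m := fun i =>
    Real.rpow_inv_natCast_pow (hmean0 i) hm
  by_cases hz : ∃ i ∈ s, N i = 0
  · obtain ⟨i, hi, hi0⟩ := hz
    have h1 : circleMean (fun t => g i t ^ m) = 0 := by rw [← hNpow, hi0, zero_pow hm]
    have h2 := (integral_eq_zero_iff_of_nonneg (fun t => pow_nonneg (h0 i t) m)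
      (integrable_circle ((hc i).pow m))).1 h1
    have h3 : circleMean (fun t => ∏ i ∈ s, g i t) = 0 := by
      apply integral_eq_zero_of_ae
      filter_upwards [h2] with t ht
      have : g i t = 0 := by simpa [hm] using ht
      exact prod_eq_zero hi this
    rw [h3]
    exact prod_nonneg fun i _ => hN0 i
  · push Not at hz
    have hpos : ∀ i ∈ s, 0 < N i := fun i hi => lt_of_le_of_ne (hN0 i) (Ne.symm (hz i hi))
    have hpt : ∀ t, ∏ i ∈ s, g i t ≤
        (∏ i ∈ s, N i) * (∑ i ∈ s, (m : ℝ)⁻¹ * ((N i ^ m)⁻¹ * g i t ^ m)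
          + (1 - s.card * (m : ℝ)⁻¹)) := by
      intro t
      have hcard : (s.card : ℝ) * (m : ℝ)⁻¹ ≤ 1 := by
        rw [← div_eq_mul_inv, div_le_one hm']; exact_mod_cast hs
      have key := Real.geom_mean_le_arith_mean_weighted (insertNone s)
        (fun o => o.elim (1 - s.card * (m : ℝ)⁻¹) fun _ => (m : ℝ)⁻¹)
        (fun o => o.elim 1 fun i => (g i t / N i) ^ m)
        (by
          rintro (_ | i) _
          · simpa using hcard
          · simp)
        (by simp [sum_insertNone])
        (by
          rintro (_ | i) _
          · simp
          · exact pow_nonneg (div_nonneg (h0 i t) (hN0 i)) m)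
      rw [prod_insertNone, sum_insertNone] at key
      simp only [Option.elim, Real.one_rpow, one_mul, mul_one] at key
      have e1 : ∏ i ∈ s, ((g i t / N i) ^ m) ^ ((m : ℝ)⁻¹) = (∏ i ∈ s, g i t) / ∏ i ∈ s, N i := by
        rw [← prod_div_distrib]
        exact prod_congr rfl fun i _ =>
          Real.pow_rpow_inv_natCast (div_nonneg (h0 i t) (hN0 i)) hm
      rw [e1, div_le_iff₀ (prod_pos hpos)] at key
      refine key.trans (le_of_eq ?_)
      rw [mul_comm, add_comm]
      congr 2
      refine sum_congr rfl fun i _ => ?_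
      rw [div_pow, div_eq_inv_mul]
    have hcr : Continuous fun t => (∏ i ∈ s, N i) *
        (∑ i ∈ s, (m : ℝ)⁻¹ * ((N i ^ m)⁻¹ * g i t ^ m) + (1 - s.card * (m : ℝ)⁻¹)) := by
      fun_prop
    refine (circleMean_mono (by fun_prop) hcr hpt).trans (le_of_eq ?_)
    unfold circleMean
    rw [integral_const_mul, integral_add (integrable_circle (by fun_prop))
      (integrable_circle (by fun_prop)),
      integral_finsetSum _ fun i _ => integrable_circle (by fun_prop)]
    have e2 : ∀ i ∈ s, ∫ t, (m : ℝ)⁻¹ * ((N i ^ m)⁻¹ * g i t ^ m) ∂(haarAddCircle (T := 1))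
        = (m : ℝ)⁻¹ := by
      intro i hi
      rw [integral_const_mul, integral_const_mul]
      have := hNpow i
      unfold circleMean at this
      rw [← this, inv_mul_cancel₀ (pow_pos (hpos i hi) m).ne', mul_one]
    rw [sum_congr rfl e2]
    simp

/-- Orthogonality: the mean of a product of exponential sums is a weighted count of solutions. -/
theorem integral_prod_expSum {ι α : Type*} [Fintype ι] [DecidableEq ι] (s : ι → Finset α)
    (f : ι → α → ℝ) (φ : ι → α → ℤ) :
    ∫ t, ∏ i, expSum (s i) (f i) (φ i) t ∂(haarAddCircle (T := 1)) =
      ((∑ z ∈ Fintype.piFinset s, if ∑ i, φ i (z i) = 0 then ∏ i, f i (z i) else 0 : ℝ) : ℂ) := by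
  unfold expSum
  simp only [prod_univ_sum, prod_mul_distrib]
  have h : ∀ (z : ι → α) (t : UnitAddCircle),
      ∏ i, fourier (φ i (z i)) t = fourier (∑ i, φ i (z i)) t := by
    intro z t
    have : ∀ u : Finset ι, ∏ i ∈ u, fourier (φ i (z i)) t = fourier (∑ i ∈ u, φ i (z i)) t := by
      intro u
      induction u using Finset.induction_on with
      | empty => simp
      | insert a u ha ih => rw [prod_insert ha, sum_insert ha, ih, fourier_add]
    exact this univ
  simp only [h]
  rw [integral_finsetSum _ fun z _ => integrable_circle (by fun_prop)]
  push_cast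
  refine sum_congr rfl fun z _ => ?_
  rw [integral_const_mul, integral_fourier_eq]
  split_ifs <;> simp

/-- The number of solutions of a linear equation is bounded by a product of moment norms. -/
theorem weighted_count_le {ι α : Type*} [Fintype ι] [DecidableEq ι] {m : ℕ} (hm : m ≠ 0)
    (hι : Fintype.card ι ≤ m) (s : ι → Finset α) (f : ι → α → ℝ) (φ : ι → α → ℤ) :
    (∑ z ∈ Fintype.piFinset s, if ∑ i, φ i (z i) = 0 then ∏ i, f i (z i) else 0 : ℝ) ≤
      ∏ i, expNorm m (s i) (f i) (φ i) := by
  have h1 := integral_prod_expSum s f φ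
  have h2 := norm_integral_le_integral_norm (μ := haarAddCircle (T := 1))
    (fun t => ∏ i, expSum (s i) (f i) (φ i) t)
  rw [h1] at h2
  refine (le_abs_self _).trans ?_
  rw [Complex.norm_real, Real.norm_eq_abs] at h2
  refine h2.trans ?_
  simp only [norm_prod]
  exact circleMean_prod_le univ hm hι (fun i t => ‖expSum (s i) (f i) (φ i) t‖)
    (fun i => (continuous_expSum _ _ _).norm) fun i t => norm_nonneg _

/-- The sign attached to a side of the equation `x₁ + ⋯ + x_k = y₁ + ⋯ + y_k`. -/
def sideSign (b : Bool) : ℤ := if b then 1 else -1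

theorem expSum_neg {α : Type*} (s : Finset α) (f : α → ℝ) (φ : α → ℤ) (t : UnitAddCircle) :
    expSum s f (fun x => -φ x) t = (starRingEnd ℂ) (expSum s f φ t) := by
  simp only [expSum, map_sum, map_mul, Complex.conj_ofReal, fourier_neg]

theorem norm_expSum_sideSign {α : Type*} (s : Finset α) (f : α → ℝ) (φ : α → ℤ) (b : Bool)
    (t : UnitAddCircle) : ‖expSum s f (fun x => sideSign b * φ x) t‖ = ‖expSum s f φ t‖ := by
  cases b
  · simp only [sideSign, Bool.false_eq_true, if_false, neg_one_mul, expSum_neg, RCLike.norm_conj]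
  · simp [sideSign]

theorem expNorm_sideSign (m : ℕ) {α : Type*} (s : Finset α) (f : α → ℝ) (φ : α → ℤ) (b : Bool) :
    expNorm m s f (fun x => sideSign b * φ x) = expNorm m s f φ := by
  simp only [expNorm, norm_expSum_sideSign]

/-- Even moments of exponential sums count solutions of `x₁ + ⋯ + x_k = y₁ + ⋯ + y_k`. -/
theorem circleMean_pow_eq_count {α : Type*} (k : ℕ) (s : Finset α) (f : α → ℝ) (φ : α → ℤ) :
    circleMean (fun t => ‖expSum s f φ t‖ ^ (2 * k)) =
      ∑ z ∈ Fintype.piFinset (fun _ : Fin k × Bool => s),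
        if ∑ i, sideSign i.2 * φ (z i) = 0 then ∏ i, f (z i) else 0 := by
  have h := integral_prod_expSum (fun _ : Fin k × Bool => s) (fun _ => f)
    (fun i x => sideSign i.2 * φ x)
  have h2 : ∀ t, ∏ i : Fin k × Bool, expSum s f (fun x => sideSign i.2 * φ x) t =
      ((‖expSum s f φ t‖ ^ (2 * k) : ℝ) : ℂ) := by
    intro t
    rw [Fintype.prod_prod_type]
    simp only [Fintype.prod_bool, sideSign, if_true, Bool.false_eq_true, if_false, one_mul,
      neg_one_mul, expSum_neg, prod_const, card_univ, Fintype.card_fin]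
    rw [Complex.mul_conj, Complex.normSq_eq_norm_sq, pow_mul]
    push_cast
    rfl
  simp only [h2] at h
  rw [integral_complex_ofReal] at h
  exact_mod_cast h

theorem expNorm_mul_const {α : Type*} {k : ℕ} (s : Finset α) (f : α → ℝ) (φ : α → ℤ)
    {c : ℤ} (hc : c ≠ 0) :
    expNorm (2 * k) s f (fun x => c * φ x) = expNorm (2 * k) s f φ := by
  unfold expNorm
  rw [circleMean_pow_eq_count, circleMean_pow_eq_count]
  congr 1
  refine sum_congr rfl fun z _ => ?_
  have : ∑ i : Fin k × Bool, sideSign i.2 * (c * φ (z i)) =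
      c * ∑ i : Fin k × Bool, sideSign i.2 * φ (z i) := by
    rw [mul_sum]; exact sum_congr rfl fun i _ => by ring
  simp only [this, mul_eq_zero, hc, false_or]

theorem norm_expSum_le {α : Type*} (s : Finset α) (f : α → ℝ) (hf : ∀ x ∈ s, 0 ≤ f x)
    (φ : α → ℤ) (t : UnitAddCircle) : ‖expSum s f φ t‖ ≤ ∑ x ∈ s, f x := by
  refine (norm_sum_le _ _).trans (sum_le_sum fun x hx => ?_)
  rw [norm_mul, Complex.norm_real, Real.norm_of_nonneg (hf x hx), fourier_apply, Circle.norm_coe,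
    mul_one]

end Fourier

section Extraction

theorem IsBhPlus.of_no_relation {h M : ℕ} (hh : h ≠ 0) (a : Fin M → ℤ)
    (ha : ∀ c : Fin M → ℤ, c ≠ 0 → (∀ i, |c i| ≤ (h : ℤ)) →
      (univ.filter fun i => c i ≠ 0).card ≤ 2 * h → ∑ i, c i * a i ≠ 0) :
    IsBhPlus h (univ.image a) ∧ (univ.image a).card = M := by
  have hinj : Function.Injective a := by
    intro i j hij
    by_contra hne
    refine ha (Pi.single i 1 - Pi.single j 1) ?_ ?_ ?_ ?_
    · intro h0
      have := congrFun h0 i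
      simp [hne] at this
    · intro l
      have hh' : (1 : ℤ) ≤ h := by exact_mod_cast Nat.one_le_iff_ne_zero.2 hh
      rcases eq_or_ne l i with rfl | h1
      · simpa [Pi.single_apply, hne] using hh'
      · rcases eq_or_ne l j with rfl | h2
        · simpa [Pi.single_apply, h1] using hh'
        · simp [h1, h2]
    · refine (card_le_card (t := {i, j}) ?_).trans ((card_le_two).trans (by omega))
      intro l hl
      simp only [mem_filter, mem_univ, true_and, Pi.sub_apply, Pi.single_apply] at hl
      simp only [mem_insert, mem_singleton]
      by_contra hcon
      push Not at hcon
      simp [hcon.1, hcon.2] at hl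
    · simp [sub_mul, Pi.single_apply, sum_sub_distrib, hij]
  refine ⟨?_, by rw [card_image_of_injective _ hinj, card_univ, Fintype.card_fin]⟩
  intro s t hs ht hsB htB hsum
  have key : ∀ i, ((s.count (a i) : ℤ) - t.count (a i)) = 0 := by
    by_contra hcon
    push Not at hcon
    obtain ⟨i₀, hi₀⟩ := hcon
    refine ha (fun i => (s.count (a i) : ℤ) - t.count (a i)) ?_ ?_ ?_ ?_
    · exact fun h0 => hi₀ (congrFun h0 i₀)
    · intro i
      have h1 := Multiset.count_le_card (a i) s
      have h2 := Multiset.count_le_card (a i) t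
      rw [abs_le]
      omega
    · have hsub : (univ.filter fun i => ((s.count (a i) : ℤ) - t.count (a i)) ≠ 0).image a ⊆
          s.toFinset ∪ t.toFinset := by
        intro x hx
        simp only [mem_image, mem_filter, mem_univ, true_and] at hx
        obtain ⟨i, hi, rfl⟩ := hx
        by_contra hcon
        simp only [mem_union, Multiset.mem_toFinset, not_or] at hcon
        rw [Multiset.count_eq_zero_of_notMem hcon.1, Multiset.count_eq_zero_of_notMem hcon.2] at hi
        simp at hi
      rw [← card_image_of_injective _ hinj]
      refine (card_le_card hsub).trans ((card_union_le _ _).trans ?_)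
      have h1 := Multiset.toFinset_card_le s
      have h2 := Multiset.toFinset_card_le t
      omega
    · have e : ∀ u : Multiset ℤ, (∀ x ∈ u, x ∈ univ.image a) →
          u.sum = ∑ i, (u.count (a i) : ℤ) * a i := by
        intro u hu
        rw [Finset.sum_multiset_count_of_subset u (univ.image a)
          (fun x hx => hu x (Multiset.mem_toFinset.1 hx)), sum_image fun _ _ _ _ h => hinj h]
        simp
      simp only [sub_mul, sum_sub_distrib]
      rw [← e s hsB, ← e t htB, hsum, sub_self]
  ext x
  by_cases hx : x ∈ univ.image a
  · obtain ⟨i, -, rfl⟩ := mem_image.1 hx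
    have := key i
    omega
  · rw [Multiset.count_eq_zero_of_notMem fun h => hx (hsB x h),
      Multiset.count_eq_zero_of_notMem fun h => hx (htB x h)]

open MeasureTheory AddCircle in
theorem card_relation_le {h M : ℕ} (hh : h ≠ 0) (A : Finset ℤ) (c : Fin M → ℤ)
    (hc : (univ.filter fun i => c i ≠ 0).card ≤ 2 * h) :
    (((Fintype.piFinset fun _ : Fin M => A).filter fun a => ∑ i, c i * a i = 0).card : ℝ) ≤
      ∏ i, if c i = 0 then (A.card : ℝ) else expNorm (2 * h) A (fun _ => 1) id := by
  have h1 := integral_prod_expSum (fun _ : Fin M => A) (fun _ _ => 1) (fun i x => c i * x)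
  have h2 := norm_integral_le_integral_norm (μ := haarAddCircle (T := 1))
    (fun t => ∏ i : Fin M, expSum A (fun _ => 1) (fun x => c i * x) t)
  rw [h1, Complex.norm_real, Real.norm_eq_abs] at h2
  have h3 : (((Fintype.piFinset fun _ : Fin M => A).filter fun a => ∑ i, c i * a i = 0).card : ℝ) =
      ∑ z ∈ Fintype.piFinset fun _ : Fin M => A,
        if ∑ i, c i * z i = 0 then ∏ _i : Fin M, (1 : ℝ) else 0 := by
    simp
  rw [h3]
  refine (le_abs_self _).trans (h2.trans ?_)
  set S := univ.filter fun i => c i ≠ 0 with hS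
  have h4 : ∀ t, ‖∏ i : Fin M, expSum A (fun _ => 1) (fun x => c i * x) t‖ =
      (∏ i ∈ univ.filter (fun i => ¬ c i ≠ 0), (A.card : ℝ)) *
        ∏ i ∈ S, ‖expSum A (fun _ => 1) (fun x => c i * x) t‖ := by
    intro t
    rw [norm_prod, ← prod_filter_mul_prod_filter_not univ (fun i => c i ≠ 0), mul_comm]
    congr 1
    refine prod_congr rfl fun i hi => ?_
    have : c i = 0 := by simpa using hi
    simp [expSum, this]
  simp only [h4]
  rw [integral_const_mul]
  have h5 := circleMean_prod_le S (m := 2 * h) (by omega) hc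
    (fun i t => ‖expSum A (fun _ => 1) (fun x => c i * x) t‖)
    (fun i => (continuous_expSum _ _ _).norm) fun i t => norm_nonneg _
  refine (mul_le_mul_of_nonneg_left h5 (by positivity)).trans (le_of_eq ?_)
  rw [← prod_filter_mul_prod_filter_not univ (fun i => c i ≠ 0), mul_comm]
  congr 1
  · refine prod_congr rfl fun i hi => ?_
    have : c i ≠ 0 := by simpa [hS] using hi
    rw [if_neg this]
    exact expNorm_mul_const A (fun _ => 1) id this
  · refine prod_congr rfl fun i hi => ?_
    have : c i = 0 := by simpa using hi
    rw [if_pos this]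

/-- A set of small additive energy contains a large `B_h` set. -/
theorem exists_isBhPlus {h M : ℕ} (hh : h ≠ 0) {A : Finset ℤ} (hA : A.Nonempty) {Y : ℝ}
    (hY : 0 < Y) (hE : expNorm (2 * h) A (fun _ => 1) id * Y ≤ A.card)
    (hM : 4 * h * M ≤ Y) : ∃ B ⊆ A, IsBhPlus h B ∧ B.card = M := by
  classical
  set n : ℝ := (A.card : ℝ) with hn
  have hn0 : 0 < n := by rw [hn]; exact_mod_cast hA.card_pos
  set Pat := ((Fintype.piFinset fun _ : Fin M => Icc (-(h : ℤ)) h).filter fun c => c ≠ 0).filter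
    fun c => (univ.filter fun i => c i ≠ 0).card ≤ 2 * h with hPat
  set Bad : (Fin M → ℤ) → Finset (Fin M → ℤ) := fun c =>
    (Fintype.piFinset fun _ : Fin M => A).filter fun a => ∑ i, c i * a i = 0 with hBad
  have hbad : ∀ c ∈ Pat, ((Bad c).card : ℝ) ≤ n ^ M * ∏ i, if c i = 0 then 1 else Y⁻¹ := by
    intro c hc
    refine (card_relation_le hh A c (mem_filter.1 hc).2).trans ?_
    have : n ^ M = ∏ _i : Fin M, n := by simp
    rw [this, ← prod_mul_distrib]
    refine prod_le_prod (fun i _ => ?_) fun i _ => ?_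
    · split_ifs
      · exact hn0.le
      · exact expNorm_nonneg _ _ _ _
    · split_ifs
      · simp [hn]
      · rwa [← div_eq_mul_inv, le_div_iff₀ hY]
  have hsum : ∑ c ∈ Pat, ((Bad c).card : ℝ) < n ^ M := by
    calc ∑ c ∈ Pat, ((Bad c).card : ℝ)
        ≤ ∑ c ∈ Pat, n ^ M * ∏ i, (if c i = 0 then 1 else Y⁻¹) := sum_le_sum hbad
      _ ≤ ∑ c ∈ (Fintype.piFinset fun _ : Fin M => Icc (-(h : ℤ)) h).filter fun c => c ≠ 0,
            n ^ M * ∏ i, (if c i = 0 then 1 else Y⁻¹) := by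
          refine sum_le_sum_of_subset_of_nonneg (filter_subset _ _) fun c _ _ => ?_
          refine mul_nonneg (by positivity) (prod_nonneg fun i _ => ?_)
          split_ifs <;> positivity
      _ = n ^ M * ((∑ c ∈ Fintype.piFinset fun _ : Fin M => Icc (-(h : ℤ)) h,
            ∏ i, (if c i = 0 then 1 else Y⁻¹)) - 1) := by
          rw [← mul_sum]
          congr 1
          have hz : (0 : Fin M → ℤ) ∈ Fintype.piFinset fun _ : Fin M => Icc (-(h : ℤ)) h := by
            simp
          rw [filter_ne', ← add_sum_erase _ _ hz]
          simp
      _ = n ^ M * ((1 + 2 * h * Y⁻¹) ^ M - 1) := by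
          rw [← prod_univ_sum (fun _ : Fin M => Icc (-(h : ℤ)) h)
            (fun _ j => if j = 0 then (1 : ℝ) else Y⁻¹)]
          have hz : (0 : ℤ) ∈ Icc (-(h : ℤ)) h := by simp
          have e : ∑ j ∈ Icc (-(h : ℤ)) h, (if j = 0 then (1 : ℝ) else Y⁻¹) = 1 + 2 * h * Y⁻¹ := by
            rw [← add_sum_erase _ _ hz, if_pos rfl]
            congr 1
            rw [sum_congr rfl fun j hj => if_neg (ne_of_mem_erase hj), sum_const,
              card_erase_of_mem hz, Int.card_Icc, nsmul_eq_mul]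
            congr 1
            have : ((h : ℤ) + 1 - -(h : ℤ)).toNat - 1 = 2 * h := by omega
            rw [this]; push_cast; ring
          rw [e]
          simp
      _ < n ^ M := by
          have hx : (1 + 2 * h * Y⁻¹) ^ M ≤ Real.exp (1 / 2) := by
            calc (1 + 2 * h * Y⁻¹) ^ M ≤ Real.exp (2 * h * Y⁻¹) ^ M := by
                  gcongr
                  rw [add_comm]; exact Real.add_one_le_exp _
              _ = Real.exp (M * (2 * h * Y⁻¹)) := by rw [← Real.exp_nat_mul]
              _ ≤ Real.exp (1 / 2) := by
                  apply Real.exp_le_exp.2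
                  have : (M : ℝ) * (2 * h * Y⁻¹) = (4 * h * M) / Y / 2 := by field_simp; ring
                  rw [this]
                  have : (4 * h * M : ℝ) / Y ≤ 1 := (div_le_one hY).2 hM
                  linarith
          have he : Real.exp (1 / 2) < 2 := by
            have h1 : Real.exp (1 / 2) ^ 2 < 2 ^ 2 := by
              rw [← Real.exp_nat_mul]
              norm_num
              exact Real.exp_one_lt_d9.trans (by norm_num)
            exact lt_of_pow_lt_pow_left₀ 2 (by norm_num) h1
          have : 0 < n ^ M := by positivity
          nlinarith
  have hex : ∃ a ∈ Fintype.piFinset fun _ : Fin M => A, a ∉ Pat.biUnion Bad := by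
    by_contra hcon
    push Not at hcon
    have h1 : (Fintype.piFinset fun _ : Fin M => A).card ≤ (Pat.biUnion Bad).card :=
      card_le_card hcon
    have h2 := h1.trans card_biUnion_le
    rw [Fintype.card_piFinset, prod_const, card_univ, Fintype.card_fin] at h2
    have h3 : n ^ M ≤ ∑ c ∈ Pat, ((Bad c).card : ℝ) := by rw [hn]; exact_mod_cast h2
    linarith
  obtain ⟨a, haA, ha⟩ := hex
  have hgood := IsBhPlus.of_no_relation hh a (by
    intro c hc0 hcb hcs hrel
    apply ha
    rw [mem_biUnion]
    refine ⟨c, ?_, ?_⟩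
    · simp only [hPat, mem_filter, Fintype.mem_piFinset, mem_Icc]
      exact ⟨⟨fun i => abs_le.1 (hcb i), hc0⟩, hcs⟩
    · exact mem_filter.2 ⟨haA, hrel⟩)
  refine ⟨univ.image a, ?_, hgood.1, hgood.2⟩
  intro x hx
  obtain ⟨i, -, rfl⟩ := mem_image.1 hx
  exact Fintype.mem_piFinset.1 haA i

end Extraction

section Query

/-- `Query v q S`: the elements of `S` can be identified by adaptively asking for the values of at
most `q` of the coordinates `v i`. -/
def Query {ι α : Type*} (v : ι → α → ℤ) : ℕ → Finset α → Prop
  | 0, S => S.card ≤ 1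
  | q + 1, S => ∃ i, ∀ c, Query v q (S.filter fun x => v i x = c)

theorem Query.mono {ι α : Type*} {v : ι → α → ℤ} {q : ℕ} {S S' : Finset α} (hS : Query v q S)
    (h : S' ⊆ S) : Query v q S' := by
  induction q generalizing S S' with
  | zero => exact (card_le_card h).trans hS
  | succ q ih =>
    obtain ⟨i, hi⟩ := hS
    exact ⟨i, fun c => ih (hi c) (filter_subset_filter _ h)⟩

theorem Query.of_card_le_one {ι α : Type*} [Nonempty ι] (v : ι → α → ℤ) {q : ℕ} {S : Finset α}
    (hS : S.card ≤ 1) : Query v q S := by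
  induction q generalizing S with
  | zero => exact hS
  | succ q ih =>
    exact ⟨Classical.arbitrary ι, fun c => ih ((card_le_card (filter_subset _ _)).trans hS)⟩

/-- The `p`-adic valuations, as integer valued coordinates on the natural numbers. -/
def primeVal (p : Nat.Primes) (x : ℕ) : ℤ := padicValNat p x

theorem primeVal_mul (p : Nat.Primes) {x y : ℕ} (hx : x ≠ 0) (hy : y ≠ 0) :
    primeVal p (x * y) = primeVal p x + primeVal p y := by
  have : Fact (p : ℕ).Prime := ⟨p.2⟩
  simp [primeVal, padicValNat.mul hx hy]

theorem Query.of_mul {q : ℕ} {S A : Finset ℕ} {t : ℕ} (ht : t ≠ 0) (hA : ∀ a ∈ A, a ≠ 0)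
    (hS : Query primeVal q S) (h : ∀ a ∈ A, t * a ∈ S) : Query primeVal q A := by
  induction q generalizing S A with
  | zero =>
    refine (card_le_card_of_injOn (fun a => t * a) h ?_).trans hS
    exact fun a _ b _ hab => Nat.eq_of_mul_eq_mul_left (Nat.pos_of_ne_zero ht) hab
  | succ q ih =>
    obtain ⟨p, hp⟩ := hS
    refine ⟨p, fun c => ih (S := S.filter fun x => primeVal p x = primeVal p t + c)
      (fun a ha => hA a (mem_filter.1 ha).1) (hp _) ?_⟩
    intro a ha
    obtain ⟨ha, hac⟩ := mem_filter.1 ha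
    exact mem_filter.2 ⟨h a ha, by rw [primeVal_mul p ht (hA a ha), hac]⟩

/-- In a vanishing signed sum, two terms have the same `p`-adic valuation. -/
theorem exists_ne_primeVal_eq {I : Type*} [Fintype I] [DecidableEq I] [Nonempty I] (σ : I → ℤ)
    (hσ : ∀ i, IsUnit (σ i)) (z : I → ℕ) (hz : ∀ i, z i ≠ 0) (hsum : ∑ i, σ i * (z i : ℤ) = 0)
    (p : Nat.Primes) : ∃ i j, i ≠ j ∧ primeVal p (z i) = primeVal p (z j) := by
  have : Fact (p : ℕ).Prime := ⟨p.2⟩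
  by_contra hcon
  push Not at hcon
  obtain ⟨i, -, hi⟩ := exists_min_image univ (fun i => primeVal p (z i)) univ_nonempty
  have hdvd : ∀ j, j ≠ i → (((p : ℕ) ^ (padicValNat p (z i) + 1) : ℕ) : ℤ) ∣ z j := by
    intro j hj
    rw [Int.natCast_dvd_natCast, padicValNat_dvd_iff_le (hz j)]
    have h1 := hi j (mem_univ j)
    have h2 := hcon j i hj
    simp only [primeVal] at h1 h2
    omega
  have h3 : (((p : ℕ) ^ (padicValNat p (z i) + 1) : ℕ) : ℤ) ∣ σ i * z i := by
    rw [← add_sum_erase _ _ (mem_univ i)] at hsum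
    rw [eq_neg_of_add_eq_zero_left hsum]
    refine (dvd_neg).2 (dvd_sum fun j hj => ?_)
    exact (hdvd j (ne_of_mem_erase hj)).mul_left _
  rw [(hσ i).dvd_mul_left, Int.natCast_dvd_natCast, padicValNat_dvd_iff_le (hz i)] at h3
  omega

theorem isUnit_sideSign (b : Bool) : IsUnit (sideSign b) := by
  cases b <;> simp [sideSign]

theorem expNorm_fiber_le {k : ℕ} (hk : k ≠ 0) (S : Finset ℕ) (hS : ∀ x ∈ S, x ≠ 0)
    (p : Nat.Primes) :
    expNorm (2 * k) S (fun _ => 1) (fun x => (x : ℤ)) ^ 2 ≤ 4 * k ^ 2 *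
      ∑ c ∈ S.image (primeVal p), expNorm (2 * k) (S.filter fun x => primeVal p x = c)
        (fun _ => 1) (fun x => (x : ℤ)) ^ 2 := by
  classical
  have : Nonempty (Fin k × Bool) := ⟨(⟨0, Nat.pos_of_ne_zero hk⟩, true)⟩
  set φ : ℕ → ℤ := fun x => (x : ℤ) with hφ
  set U := expNorm (2 * k) S (fun _ => 1) φ with hU
  set V : ℤ → ℝ := fun c => expNorm (2 * k) (S.filter fun x => primeVal p x = c)
    (fun _ => 1) φ with hV
  have hU0 : 0 ≤ U := expNorm_nonneg _ _ _ _
  have hV0 : ∀ c, 0 ≤ V c := fun c => expNorm_nonneg _ _ _ _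
  have hV1 : ∀ c, expNorm (2 * k) (S.filter fun x => primeVal p x = c) (fun _ => 1) φ = V c :=
    fun c => rfl
  simp only [hV1]
  set I := Fin k × Bool
  let fam : I → I → ℤ → I → Finset ℕ := fun i j c l =>
    if l = i ∨ l = j then S.filter fun x => primeVal p x = c else S
  let sol : (I → Finset ℕ) → ℝ := fun s =>
    ∑ z ∈ Fintype.piFinset s, if ∑ i : I, sideSign i.2 * φ (z i) = 0 then (∏ _i : I, (1 : ℝ)) else 0
  have hUsol : U ^ (2 * k) = sol fun _ => S := by
    rw [hU, expNorm_pow (by omega), circleMean_pow_eq_count]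
  have hcover : sol (fun _ => S) ≤
      ∑ ij ∈ (univ : Finset (I × I)).filter (fun ij => ij.1 ≠ ij.2),
        ∑ c ∈ S.image (primeVal p), sol (fam ij.1 ij.2 c) := by
    have hsolcard : ∀ s, sol s = (((Fintype.piFinset s).filter fun z =>
        ∑ i : I, sideSign i.2 * φ (z i) = 0).card : ℝ) := by
      intro s; simp [sol]
    simp only [hsolcard]
    have : ((Fintype.piFinset fun _ : I => S).filter fun z =>
        ∑ i : I, sideSign i.2 * φ (z i) = 0) ⊆
        ((univ : Finset (I × I)).filter (fun ij => ij.1 ≠ ij.2)).biUnion fun ij =>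
          (S.image (primeVal p)).biUnion fun c => (Fintype.piFinset (fam ij.1 ij.2 c)).filter
            fun z => ∑ i : I, sideSign i.2 * φ (z i) = 0 := by
      intro z hz
      obtain ⟨hzS, hz0⟩ := mem_filter.1 hz
      rw [Fintype.mem_piFinset] at hzS
      obtain ⟨i, j, hij, hv⟩ := exists_ne_primeVal_eq (fun i : I => sideSign i.2)
        (fun i => isUnit_sideSign _) z (fun i => hS _ (hzS i)) hz0 p
      simp only [mem_biUnion, mem_filter, mem_univ, true_and, Fintype.mem_piFinset]
      refine ⟨(i, j), hij, primeVal p (z i), mem_image_of_mem _ (hzS i), ?_, hz0⟩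
      intro l
      simp only [fam]
      split_ifs with hl
      · rcases hl with rfl | rfl
        · exact mem_filter.2 ⟨hzS _, rfl⟩
        · exact mem_filter.2 ⟨hzS _, hv.symm⟩
      · exact hzS l
    have h1 := (card_le_card this).trans card_biUnion_le
    have h2 := h1.trans (sum_le_sum fun ij _ => card_biUnion_le)
    exact_mod_cast h2
  have hbound : ∀ ij ∈ (univ : Finset (I × I)).filter (fun ij => ij.1 ≠ ij.2),
      ∀ c, sol (fam ij.1 ij.2 c) ≤ V c ^ 2 * U ^ (2 * k - 2) := by
    rintro ⟨i, j⟩ hij c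
    have hne : i ≠ j := by simpa using hij
    refine (weighted_count_le (m := 2 * k) (by omega) (by simp [I]; omega) (fam i j c)
      (fun _ _ => 1) (fun l x => sideSign l.2 * φ x)).trans (le_of_eq ?_)
    have e1 : ∀ l : I, expNorm (2 * k) (fam i j c l) (fun _ => 1)
        (fun x => sideSign l.2 * φ x) = if l ∈ ({i, j} : Finset I) then V c else U := by
      intro l
      rw [expNorm_sideSign]
      simp only [fam, mem_insert, mem_singleton]
      split_ifs <;> rfl
    rw [prod_congr rfl fun l _ => e1 l, prod_ite, prod_const, prod_const]
    have e2 : (univ.filter fun l : I => l ∈ ({i, j} : Finset I)).card = 2 := by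
      rw [filter_mem_eq_inter, univ_inter, card_pair hne]
    have e3 : (univ.filter fun l : I => ¬ l ∈ ({i, j} : Finset I)).card = 2 * k - 2 := by
      rw [filter_notMem_eq_sdiff, card_sdiff_of_subset (subset_univ _), card_pair hne, card_univ]
      simp only [I, Fintype.card_prod, Fintype.card_fin, Fintype.card_bool]
      omega
    rw [e2, e3]
  have hmain : U ^ (2 * k) ≤ (4 * k ^ 2 * ∑ c ∈ S.image (primeVal p), V c ^ 2) *
      U ^ (2 * k - 2) := by
    rw [hUsol]
    refine hcover.trans ((sum_le_sum fun ij hij => sum_le_sum fun c _ => hbound ij hij c).trans ?_)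
    rw [sum_const, nsmul_eq_mul, ← sum_mul, mul_assoc (4 * (k : ℝ) ^ 2)]
    refine mul_le_mul_of_nonneg_right ?_
      (mul_nonneg (sum_nonneg fun c _ => by positivity) (by positivity))
    have h4 := card_filter_le (univ : Finset (I × I)) (fun ij => ij.1 ≠ ij.2)
    rw [card_univ] at h4
    simp only [I, Fintype.card_prod, Fintype.card_fin, Fintype.card_bool] at h4
    have h5 : (((univ : Finset (I × I)).filter fun ij => ij.1 ≠ ij.2).card : ℝ) ≤
        ((k * 2 * (k * 2) : ℕ) : ℝ) := by exact_mod_cast h4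
    refine h5.trans (le_of_eq ?_)
    push_cast; ring
  clear_value U V
  rcases eq_or_lt_of_le hU0 with h0 | hpos
  · rw [← h0]
    have : 0 ≤ ∑ c ∈ S.image (primeVal p), V c ^ 2 := sum_nonneg fun c _ => by positivity
    rw [zero_pow two_ne_zero]
    positivity
  · have e : U ^ (2 * k) = U ^ 2 * U ^ (2 * k - 2) := by
      rw [← pow_add]; congr 1; omega
    rw [e] at hmain
    exact le_of_mul_le_mul_right hmain (pow_pos hpos _)

/-- Sets of small query complexity with respect to prime valuations have small additive energy. -/
theorem Query.expNorm_sq_le {k : ℕ} (hk : k ≠ 0) {q : ℕ} {S : Finset ℕ} (hS : ∀ x ∈ S, x ≠ 0)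
    (hq : Query primeVal q S) :
    expNorm (2 * k) S (fun _ => 1) (fun x => (x : ℤ)) ^ 2 ≤ (4 * k ^ 2 : ℝ) ^ q * S.card := by
  induction q generalizing S with
  | zero =>
    have hle : expNorm (2 * k) S (fun _ => 1) (fun x => (x : ℤ)) ≤ S.card := by
      have h1 : expNorm (2 * k) S (fun _ => 1) (fun x => (x : ℤ)) ^ (2 * k) ≤
          (S.card : ℝ) ^ (2 * k) := by
        rw [expNorm_pow (by omega), ← circleMean_const ((S.card : ℝ) ^ (2 * k))]
        refine circleMean_mono ((continuous_expSum _ _ _).norm.pow _) continuous_const fun t => ?_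
        refine pow_le_pow_left₀ (norm_nonneg _) ?_ _
        simpa using norm_expSum_le S (fun _ => 1) (by simp) (fun x => (x : ℤ)) t
      exact le_of_pow_le_pow_left₀ (by omega) (by positivity) h1
    have hc : (S.card : ℝ) ≤ 1 := by exact_mod_cast hq
    have h0 := expNorm_nonneg (2 * k) S (fun _ => 1) (fun x => (x : ℤ))
    have hc0 : (0 : ℝ) ≤ S.card := by positivity
    rw [pow_zero, one_mul]
    nlinarith
  | succ q ih =>
    obtain ⟨p, hp⟩ := hq
    refine (expNorm_fiber_le hk S hS p).trans ?_
    have h1 : ∑ c ∈ S.image (primeVal p), expNorm (2 * k) (S.filter fun x => primeVal p x = c)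
        (fun _ => 1) (fun x => (x : ℤ)) ^ 2 ≤
        ∑ c ∈ S.image (primeVal p), (4 * k ^ 2 : ℝ) ^ q *
          ((S.filter fun x => primeVal p x = c).card : ℝ) :=
      sum_le_sum fun c _ => ih (fun x hx => hS x (mem_filter.1 hx).1) (hp c)
    have h2 : S.card = ∑ c ∈ S.image (primeVal p), (S.filter fun x => primeVal p x = c).card :=
      card_eq_sum_card_fiberwise fun x hx => mem_image_of_mem _ hx
    rw [← mul_sum] at h1
    rw [h2, pow_succ]
    push_cast
    calc _ ≤ 4 * (k : ℝ) ^ 2 * _ := mul_le_mul_of_nonneg_left h1 (by positivity)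
      _ = _ := by ring

end Query

section YoungInequality

theorem sum_sum_ite_add_eq_le (Z : Finset ℤ) (a : ℤ → ℝ) (ha : ∀ k, 0 ≤ a k) (n : ℤ) :
    ∑ k ∈ Z, ∑ l ∈ Z, (if n = k + l then a k else 0) ≤ ∑ k ∈ Z, a k := by
  refine sum_le_sum fun k _ => ?_
  have h : ∀ l ∈ Z, (if n = k + l then a k else 0) = if n - k = l then a k else 0 := by
    intro l _
    congr 1
    exact propext ⟨fun h => by omega, fun h => by omega⟩
  rw [sum_congr rfl h, sum_ite_eq]
  split_ifs
  · exact le_rfl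
  · exact ha k

theorem sum_sum_ite_add_le (Z : Finset ℤ) (u a : ℤ → ℝ) (ha : ∀ k, 0 ≤ a k) (n : ℤ)
    (h : ∀ k l, n = k + l → u k ^ 2 * u l ^ 2 ≤ a k + a l) :
    ∑ k ∈ Z, ∑ l ∈ Z, (if n = k + l then u k ^ 2 * u l ^ 2 else 0) ≤ 2 * ∑ k ∈ Z, a k := by
  have h1 : ∑ k ∈ Z, ∑ l ∈ Z, (if n = k + l then u k ^ 2 * u l ^ 2 else 0) ≤
      ∑ k ∈ Z, ∑ l ∈ Z, (if n = k + l then a k else 0) +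
      ∑ k ∈ Z, ∑ l ∈ Z, (if n = k + l then a l else 0) := by
    rw [← sum_add_distrib]
    refine sum_le_sum fun k _ => ?_
    rw [← sum_add_distrib]
    refine sum_le_sum fun l _ => ?_
    split_ifs with hkl
    · exact h k l hkl
    · simp
  have h3 : ∑ k ∈ Z, ∑ l ∈ Z, (if n = k + l then a l else 0) ≤ ∑ k ∈ Z, a k := by
    rw [sum_comm]
    simpa only [add_comm] using sum_sum_ite_add_eq_le Z a ha n
  have h2 := sum_sum_ite_add_eq_le Z a ha n
  linarith

theorem quad_sum_le (Z : Finset ℤ) (u : ℤ → ℝ) :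
    ∑ i ∈ Z, ∑ j ∈ Z, ∑ k ∈ Z, ∑ l ∈ Z,
        (if i + j = k + l then u i ^ 3 * u j ^ 3 * (u k ^ 3 * u l ^ 3) else 0) ≤
      ∑ i ∈ Z, ∑ j ∈ Z, u i ^ 4 * u j ^ 4 *
        ∑ k ∈ Z, ∑ l ∈ Z, (if i + j = k + l then u k ^ 2 * u l ^ 2 else 0) := by
  set f : ℤ × ℤ → ℤ × ℤ → ℝ := fun x y =>
    if x.1 + x.2 = y.1 + y.2 then u x.1 ^ 4 * u x.2 ^ 4 * (u y.1 ^ 2 * u y.2 ^ 2) else 0 with hf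
  have e1 : ∑ i ∈ Z, ∑ j ∈ Z, u i ^ 4 * u j ^ 4 *
        ∑ k ∈ Z, ∑ l ∈ Z, (if i + j = k + l then u k ^ 2 * u l ^ 2 else 0) =
      ∑ x ∈ Z ×ˢ Z, ∑ y ∈ Z ×ˢ Z, f x y := by
    rw [sum_product]
    refine sum_congr rfl fun i _ => sum_congr rfl fun j _ => ?_
    rw [sum_product, mul_sum]
    refine sum_congr rfl fun k _ => ?_
    rw [mul_sum]
    refine sum_congr rfl fun l _ => ?_
    simp only [hf, mul_ite, mul_zero]
  have e2 : ∑ i ∈ Z, ∑ j ∈ Z, ∑ k ∈ Z, ∑ l ∈ Z,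
        (if i + j = k + l then u i ^ 3 * u j ^ 3 * (u k ^ 3 * u l ^ 3) else 0) =
      ∑ x ∈ Z ×ˢ Z, ∑ y ∈ Z ×ˢ Z,
        (if x.1 + x.2 = y.1 + y.2 then u x.1 ^ 3 * u x.2 ^ 3 * (u y.1 ^ 3 * u y.2 ^ 3) else 0) := by
    rw [sum_product]
    refine sum_congr rfl fun i _ => sum_congr rfl fun j _ => ?_
    rw [sum_product]
  have e3 : ∑ x ∈ Z ×ˢ Z, ∑ y ∈ Z ×ˢ Z, f x y = ∑ x ∈ Z ×ˢ Z, ∑ y ∈ Z ×ˢ Z, f y x := sum_comm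
  rw [e1, e2]
  have : ∑ x ∈ Z ×ˢ Z, ∑ y ∈ Z ×ˢ Z,
        (if x.1 + x.2 = y.1 + y.2 then u x.1 ^ 3 * u x.2 ^ 3 * (u y.1 ^ 3 * u y.2 ^ 3) else 0) ≤
      ∑ x ∈ Z ×ˢ Z, ∑ y ∈ Z ×ˢ Z, (f x y / 2 + f y x / 2) := by
    refine sum_le_sum fun x _ => sum_le_sum fun y _ => ?_
    simp only [hf, eq_comm (a := y.1 + y.2)]
    split_ifs
    · nlinarith [sq_nonneg (u x.1 ^ 2 * u x.2 ^ 2 * u y.1 * u y.2 -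
        u x.1 * u x.2 * u y.1 ^ 2 * u y.2 ^ 2)]
    · simp
  refine this.trans (le_of_eq ?_)
  simp only [sum_add_distrib, ← sum_div]
  rw [← e3]
  ring

/-- Young's inequality for the additive energy on `ℤ`. -/
theorem quad_sum_le_cube (Z : Finset ℤ) (u : ℤ → ℝ) :
    ∑ i ∈ Z, ∑ j ∈ Z, ∑ k ∈ Z, ∑ l ∈ Z,
        (if i + j = k + l then u i ^ 3 * u j ^ 3 * (u k ^ 3 * u l ^ 3) else 0) ≤
      (∑ i ∈ Z, u i ^ 4) ^ 3 := by
  refine (quad_sum_le Z u).trans ?_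
  have hR : ∀ n : ℤ, ∑ k ∈ Z, ∑ l ∈ Z, (if n = k + l then u k ^ 2 * u l ^ 2 else 0) ≤
      ∑ i ∈ Z, u i ^ 4 := by
    intro n
    refine (sum_sum_ite_add_le Z u (fun k => u k ^ 4 / 2) (fun k => by positivity) n
      fun k l _ => ?_).trans (le_of_eq ?_)
    · nlinarith [sq_nonneg (u k ^ 2 - u l ^ 2)]
    · rw [← sum_div]; ring
  calc _ ≤ ∑ i ∈ Z, ∑ j ∈ Z, u i ^ 4 * u j ^ 4 * ∑ i ∈ Z, u i ^ 4 :=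
        sum_le_sum fun i _ => sum_le_sum fun j _ =>
          mul_le_mul_of_nonneg_left (hR _) (by positivity)
    _ = (∑ i ∈ Z, u i ^ 4) ^ 3 := by
        simp only [← sum_mul, ← mul_sum]; ring

/-- Stability in Young's inequality: either there is a definite gain, or the mass is concentrated
at a single point. -/
theorem quad_sum_gain (Z : Finset ℤ) (u : ℤ → ℝ) {c : ℝ} (hc0 : 0 < c) (hc1 : c ≤ 1)
    (hW : 0 < ∑ i ∈ Z, u i ^ 4) :
    ∑ i ∈ Z, ∑ j ∈ Z, ∑ k ∈ Z, ∑ l ∈ Z,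
        (if i + j = k + l then u i ^ 3 * u j ^ 3 * (u k ^ 3 * u l ^ 3) else 0) ≤
      (1 - c ^ 3) * (∑ i ∈ Z, u i ^ 4) ^ 3 ∨
    ∃ j ∈ Z, (1 - 7 * c) * ∑ i ∈ Z, u i ^ 4 ≤ u j ^ 4 := by
  set W := ∑ i ∈ Z, u i ^ 4 with hWdef
  have hZ : Z.Nonempty := by
    by_contra h
    rw [not_nonempty_iff_eq_empty] at h
    simp [hWdef, h] at hW
  set J := Z.filter fun j => c * W ≤ ∑ i ∈ Z.filter (fun i => i ≤ j), u i ^ 4 with hJ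
  have hJne : J.Nonempty := by
    refine ⟨Z.max' hZ, mem_filter.2 ⟨max'_mem _ _, ?_⟩⟩
    rw [filter_true_of_mem fun i hi => le_max' _ _ hi]
    nlinarith
  obtain ⟨j₁, hj₁⟩ : ∃ j₁, j₁ = J.min' hJne := ⟨_, rfl⟩
  have hj₁J : j₁ ∈ J := hj₁ ▸ min'_mem _ _
  obtain ⟨hj₁Z, hle⟩ := mem_filter.1 hj₁J
  set Wl := ∑ i ∈ Z.filter (fun i => i < j₁), u i ^ 4 with hWl
  set Wg := ∑ i ∈ Z.filter (fun i => j₁ < i), u i ^ 4 with hWg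
  set We := ∑ i ∈ Z.filter (fun i => i ≤ j₁), u i ^ 4 with hWe
  have hWlc : Wl ≤ c * W := by
    rcases (Z.filter fun i => i < j₁).eq_empty_or_nonempty with he | hne
    · rw [hWl, he, sum_empty]; positivity
    · by_contra hcon
      push Not at hcon
      have hmem := max'_mem _ hne
      obtain ⟨hmZ, hmlt⟩ := mem_filter.1 hmem
      set j' := (Z.filter fun i => i < j₁).max' hne with hj'
      have : j' ∈ J := by
        refine mem_filter.2 ⟨hmZ, hcon.le.trans (le_of_eq ?_)⟩
        rw [hWl]
        congr 1
        ext i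
        simp only [mem_filter]
        refine ⟨fun h => ⟨h.1, ?_⟩, fun h => ⟨h.1, by omega⟩⟩
        exact le_max' _ _ (mem_filter.2 h)
      have := min'_le _ _ this
      rw [← hj₁] at this
      omega
  have hsplit : W = Wl + u j₁ ^ 4 + Wg := by
    have h1 := sum_filter_add_sum_filter_not Z (fun i => i ≤ j₁) fun i => u i ^ 4
    have h2 : ∑ i ∈ Z.filter (fun i => i ≤ j₁), u i ^ 4 = Wl + u j₁ ^ 4 := by
      have : Z.filter (fun i => i ≤ j₁) = insert j₁ (Z.filter fun i => i < j₁) := by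
        ext i
        simp only [mem_filter, mem_insert]
        constructor
        · rintro ⟨h, h'⟩
          rcases eq_or_lt_of_le h' with h'' | h''
          · exact Or.inl h''
          · exact Or.inr ⟨h, h''⟩
        · rintro (rfl | ⟨h, h'⟩)
          · exact ⟨hj₁Z, le_rfl⟩
          · exact ⟨h, h'.le⟩
      rw [this, sum_insert (by simp), add_comm]
    simp only [not_le] at h1
    rw [hWdef, ← h1, h2]
  by_cases hg : Wg < 6 * c * W
  · right
    exact ⟨j₁, hj₁Z, by linarith⟩
  · left
    push Not at hg
    set a : ℤ → ℝ := fun k =>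
      if k < j₁ then u k ^ 4 else if j₁ < k then u k ^ 4 / 4 else u k ^ 4 / 2 with ha
    have ha0 : ∀ k, 0 ≤ a k := by
      intro k; simp only [ha]; split_ifs <;> positivity
    have hasum : ∑ k ∈ Z, a k = Wl + Wg / 4 + u j₁ ^ 4 / 2 := by
      have h1 := sum_filter_add_sum_filter_not Z (fun i => i < j₁) a
      have h2 := sum_filter_add_sum_filter_not (Z.filter fun i => ¬ i < j₁) (fun i => j₁ < i) a
      have e1 : ∑ k ∈ Z.filter (fun i => i < j₁), a k = Wl :=
        sum_congr rfl fun k hk => by simp [ha, (mem_filter.1 hk).2]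
      have e2 : ∑ k ∈ (Z.filter fun i => ¬ i < j₁).filter (fun i => j₁ < i), a k = Wg / 4 := by
        have : (Z.filter fun i => ¬ i < j₁).filter (fun i => j₁ < i) =
            Z.filter fun i => j₁ < i := by
          ext i; simp only [mem_filter]
          exact ⟨fun h => ⟨h.1.1, h.2⟩, fun h => ⟨⟨h.1, by omega⟩, h.2⟩⟩
        rw [this, hWg, sum_div]
        refine sum_congr rfl fun k hk => ?_
        have := (mem_filter.1 hk).2
        simp [ha, this, not_lt.2 this.le]
      have e3 : ∑ k ∈ (Z.filter fun i => ¬ i < j₁).filter (fun i => ¬ j₁ < i), a k =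
          u j₁ ^ 4 / 2 := by
        have : (Z.filter fun i => ¬ i < j₁).filter (fun i => ¬ j₁ < i) = {j₁} := by
          ext i; simp only [mem_filter, mem_singleton]
          exact ⟨fun h => by omega, fun h => by subst h; exact ⟨⟨hj₁Z, by omega⟩, by omega⟩⟩
        rw [this, sum_singleton]
        simp [ha]
      linarith
    have hR : ∀ n : ℤ, ∑ k ∈ Z, ∑ l ∈ Z, (if n = k + l then u k ^ 2 * u l ^ 2 else 0) ≤ W := by
      intro n
      refine (sum_sum_ite_add_le Z u (fun k => u k ^ 4 / 2) (fun k => by positivity) n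
        fun k l _ => ?_).trans (le_of_eq ?_)
      · nlinarith [sq_nonneg (u k ^ 2 - u l ^ 2)]
      · rw [← sum_div]; ring
    have hR' : ∀ n : ℤ, n ≤ 2 * j₁ →
        ∑ k ∈ Z, ∑ l ∈ Z, (if n = k + l then u k ^ 2 * u l ^ 2 else 0) ≤ W - c * W := by
      intro n hn
      refine (sum_sum_ite_add_le Z u a ha0 n fun k l hkl => ?_).trans ?_
      · have hk4 : 0 ≤ u k ^ 4 := by positivity
        have hl4 : 0 ≤ u l ^ 4 := by positivity
        have s1 := sq_nonneg (u k ^ 2 - u l ^ 2)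
        have s2 := sq_nonneg (u k ^ 2 - 2 * u l ^ 2)
        have s3 := sq_nonneg (2 * u k ^ 2 - u l ^ 2)
        simp only [ha]
        split_ifs <;> first | omega | nlinarith
      · rw [hasum]; nlinarith
    refine (quad_sum_le Z u).trans ?_
    have hWe0 : 0 ≤ We := sum_nonneg fun i _ => by positivity
    calc _ ≤ ∑ i ∈ Z, ∑ j ∈ Z, (u i ^ 4 * u j ^ 4 * W -
          (if i ≤ j₁ then u i ^ 4 else 0) * (if j ≤ j₁ then u j ^ 4 else 0) * (c * W)) := by
          refine sum_le_sum fun i _ => sum_le_sum fun j _ => ?_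
          have hij : 0 ≤ u i ^ 4 * u j ^ 4 := by positivity
          by_cases h : i ≤ j₁ ∧ j ≤ j₁
          · rw [if_pos h.1, if_pos h.2, ← mul_sub]
            exact mul_le_mul_of_nonneg_left (hR' _ (by omega)) hij
          · have : (if i ≤ j₁ then u i ^ 4 else 0) * (if j ≤ j₁ then u j ^ 4 else 0) = 0 := by
              rcases not_and_or.1 h with h | h
              · rw [if_neg h, zero_mul]
              · rw [if_neg h, mul_zero]
            rw [this, zero_mul, sub_zero]
            exact mul_le_mul_of_nonneg_left (hR _) hij
      _ = W ^ 3 - We ^ 2 * (c * W) := by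
          simp only [sum_sub_distrib, ← sum_mul, ← mul_sum]
          rw [← sum_filter, ← hWe, ← hWdef]
          ring
      _ ≤ (1 - c ^ 3) * W ^ 3 := by
          have h1 : (c * W) ^ 2 ≤ We ^ 2 := by gcongr
          have h2 : (c * W) ^ 2 * (c * W) ≤ We ^ 2 * (c * W) := by gcongr
          nlinarith

end YoungInequality

section LabelledEnergy

theorem sum_piFinset_fin_two_bool {β M : Type*} [AddCommMonoid M] (Z : Finset β)
    (F : (Fin 2 × Bool → β) → M) :
    ∑ z ∈ Fintype.piFinset (fun _ : Fin 2 × Bool => Z), F z =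
      ∑ i ∈ Z, ∑ j ∈ Z, ∑ k ∈ Z, ∑ l ∈ Z,
        F fun p => if p.2 then ![i, j] p.1 else ![k, l] p.1 := by
  have h : ∑ x ∈ Z ×ˢ Z ×ˢ Z ×ˢ Z,
      F (fun p => if p.2 then ![x.1, x.2.1] p.1 else ![x.2.2.1, x.2.2.2] p.1) =
      ∑ i ∈ Z, ∑ j ∈ Z, ∑ k ∈ Z, ∑ l ∈ Z,
        F fun p => if p.2 then ![i, j] p.1 else ![k, l] p.1 := by
    rw [sum_product]
    refine sum_congr rfl fun i _ => ?_
    rw [sum_product]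
    refine sum_congr rfl fun j _ => ?_
    rw [sum_product]
  rw [← h]
  refine sum_nbij' (fun z => (z (0, true), z (1, true), z (0, false), z (1, false)))
    (fun x p => if p.2 then ![x.1, x.2.1] p.1 else ![x.2.2.1, x.2.2.2] p.1) ?_ ?_ ?_ ?_ ?_
  · intro z hz
    rw [Fintype.mem_piFinset] at hz
    simp only [mem_product]
    exact ⟨hz _, hz _, hz _, hz _⟩
  · rintro ⟨i, j, k, l⟩ hx
    simp only [mem_product] at hx
    rw [Fintype.mem_piFinset]
    rintro ⟨a, b⟩
    fin_cases a <;> cases b <;> simp [hx]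
  · intro z _
    ext ⟨a, b⟩
    fin_cases a <;> cases b <;> simp
  · rintro ⟨i, j, k, l⟩ _
    simp
  · intro z _
    congr 1
    ext ⟨a, b⟩
    fin_cases a <;> cases b <;> simp

/-- If solutions of `φ x + φ y = φ z + φ w` in `s` have labels satisfying `R`, then the energy of
`s` is controlled by the fourth-moment norms of the label classes. -/
theorem circleMean_four_le_label {α : Type*} (s : Finset α) (f : α → ℝ) (φ : α → ℤ)
    (l : α → ℤ) (Z : Finset ℤ) (hl : ∀ x ∈ s, l x ∈ Z) (R : ℤ → ℤ → ℤ → ℤ → Prop)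
    [∀ i j k m, Decidable (R i j k m)]
    (hR : ∀ x ∈ s, ∀ y ∈ s, ∀ z ∈ s, ∀ w ∈ s, φ x + φ y = φ z + φ w → R (l x) (l y) (l z) (l w)) :
    (circleMean fun t => ‖expSum s f φ t‖ ^ 4) ≤
      ∑ i ∈ Z, ∑ j ∈ Z, ∑ k ∈ Z, ∑ m ∈ Z, if R i j k m then
        expNorm 4 (s.filter fun x => l x = i) f φ * expNorm 4 (s.filter fun x => l x = j) f φ *
        (expNorm 4 (s.filter fun x => l x = k) f φ * expNorm 4 (s.filter fun x => l x = m) f φ)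
        else 0 := by
  classical
  have hcount := circleMean_pow_eq_count 2 s f φ
  norm_num only at hcount
  rw [hcount]
  set G : (Fin 2 × Bool → ℤ) → ℝ := fun ℓ =>
    if R (ℓ (0, true)) (ℓ (1, true)) (ℓ (0, false)) (ℓ (1, false)) then
      ∏ i, expNorm 4 (s.filter fun x => l x = ℓ i) f φ else 0 with hG
  have key : (∑ z ∈ Fintype.piFinset (fun _ : Fin 2 × Bool => s),
        if ∑ i, sideSign i.2 * φ (z i) = 0 then ∏ i, f (z i) else 0) ≤
      ∑ ℓ ∈ Fintype.piFinset (fun _ : Fin 2 × Bool => Z), G ℓ := by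
    rw [← sum_fiberwise_of_maps_to (g := fun z i => l (z i))
      (t := Fintype.piFinset (fun _ : Fin 2 × Bool => Z))]
    · refine sum_le_sum fun ℓ _ => ?_
      have hfib : (Fintype.piFinset (fun _ : Fin 2 × Bool => s)).filter
          (fun z => (fun i => l (z i)) = ℓ) =
          Fintype.piFinset fun i => s.filter fun x => l x = ℓ i := by
        ext z
        simp only [mem_filter, Fintype.mem_piFinset, funext_iff]
        exact ⟨fun h i => ⟨h.1 i, h.2 i⟩, fun h => ⟨fun i => (h i).1, fun i => (h i).2⟩⟩
      rw [hfib]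
      by_cases hRℓ : R (ℓ (0, true)) (ℓ (1, true)) (ℓ (0, false)) (ℓ (1, false))
      · simp only [hG, if_pos hRℓ]
        have := weighted_count_le (m := 4) (by norm_num) (by simp)
          (fun i : Fin 2 × Bool => s.filter fun x => l x = ℓ i) (fun _ => f)
          (fun i x => sideSign i.2 * φ x)
        simpa only [expNorm_sideSign] using this
      · simp only [hG, if_neg hRℓ]
        refine le_of_eq (sum_eq_zero fun z hz => if_neg fun h0 => hRℓ ?_)
        rw [Fintype.mem_piFinset] at hz
        simp only [mem_filter] at hz
        have := hR _ (hz (0, true)).1 _ (hz (1, true)).1 _ (hz (0, false)).1 _ (hz (1, false)).1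
          (by simp [Fintype.sum_prod_type, sideSign] at h0; linarith)
        simpa only [(hz _).2] using this
    · intro z hz
      rw [Fintype.mem_piFinset] at hz ⊢
      exact fun i => hl _ (hz i)
  refine key.trans (le_of_eq ?_)
  rw [sum_piFinset_fin_two_bool]
  refine sum_congr rfl fun i _ => sum_congr rfl fun j _ => sum_congr rfl fun k _ =>
    sum_congr rfl fun m _ => ?_
  simp only [hG, Fintype.prod_prod_type, Fin.prod_univ_two, Fintype.prod_bool]
  simp only [if_true, Bool.false_eq_true, if_false, Matrix.cons_val_zero, Matrix.cons_val_one]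
  split_ifs <;> ring

/-- Two label classes that never meet in a solution with exactly one element of the second. -/
theorem circleMean_four_le_two {α : Type*} [DecidableEq α] (s s₁ : Finset α) (f : α → ℝ)
    (φ : α → ℤ) (l : α → ℤ) (hl : ∀ x, l x = if x ∈ s₁ then 1 else 0)
    (hs₁ : s₁ ⊆ s)
    (hR : ∀ x ∈ s, ∀ y ∈ s, ∀ z ∈ s, ∀ w ∈ s, φ x + φ y = φ z + φ w →
      l x + l y + l z + l w ≠ 1) :
    (circleMean fun t => ‖expSum s f φ t‖ ^ 4) ≤
      expNorm 4 (s \ s₁) f φ ^ 4 + 6 * expNorm 4 (s \ s₁) f φ ^ 2 * expNorm 4 s₁ f φ ^ 2 +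
      4 * expNorm 4 (s \ s₁) f φ * expNorm 4 s₁ f φ ^ 3 + expNorm 4 s₁ f φ ^ 4 := by
  have h := circleMean_four_le_label s f φ l {0, 1}
    (fun x _ => by rw [hl]; split_ifs <;> simp) (fun i j k m => i + j + k + m ≠ 1) hR
  have e0 : (s.filter fun x => l x = 0) = s \ s₁ := by
    ext x; simp only [mem_filter, mem_sdiff, hl]; split_ifs <;> simp [*]
  have e1 : (s.filter fun x => l x = 1) = s₁ := by
    ext x; simp only [mem_filter, hl]
    constructor
    · rintro ⟨_, h⟩; by_contra hx; simp [hx] at h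
    · intro hx; exact ⟨hs₁ hx, by simp [hx]⟩
  refine h.trans (le_of_eq ?_)
  have hz : ((0 : ℤ) ∉ ({1} : Finset ℤ)) := by simp
  simp only [sum_insert hz, sum_singleton, e0, e1]
  norm_num
  ring

end LabelledEnergy

section Concentration

theorem rpow_third_eq {e n P : ℝ} (he : 0 ≤ e) (hn : 0 < n) (hP : 0 < P) :
    e ^ (1 / 3 : ℝ) = (e ^ P * n ^ (1 - 3 * P)) ^ (1 / (3 * P)) * n ^ (1 - 1 / (3 * P)) := by
  rw [Real.mul_rpow (by positivity) (by positivity), ← Real.rpow_mul he, ← Real.rpow_mul hn.le,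
    mul_assoc, ← Real.rpow_add hn]
  have h1 : P * (1 / (3 * P)) = 1 / 3 := by field_simp
  have h2 : (1 - 3 * P) * (1 / (3 * P)) + (1 - 1 / (3 * P)) = 0 := by field_simp; ring
  rw [h1, h2, Real.rpow_zero, mul_one]

theorem sum_rpow_third_le {Z : Finset ℤ} {e n : ℤ → ℝ} {P T : ℝ} (hP : 1 ≤ P) (hT : 0 < T)
    (he : ∀ i ∈ Z, 0 ≤ e i) (hn : ∀ i ∈ Z, 0 < n i) (hsum : ∑ i ∈ Z, n i = 1)
    (hx : ∀ i ∈ Z, e i ^ P * n i ^ (1 - 3 * P) ≤ 1)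
    (hlight : ∑ i ∈ Z with n i ≤ 1 / T, e i ^ P * n i ^ (1 - 3 * P) ≤ 1) :
    ∑ i ∈ Z, e i ^ (1 / 3 : ℝ) ≤ (1 + T) ^ (1 / (3 * P)) := by
  set x : ℤ → ℝ := fun i => e i ^ P * n i ^ (1 - 3 * P) with hxdef
  have hx0 : ∀ i ∈ Z, 0 ≤ x i := fun i hi =>
    mul_nonneg (Real.rpow_nonneg (he i hi) _) (Real.rpow_nonneg (hn i hi).le _)
  have hxsum : ∑ i ∈ Z, x i ≤ 1 + T := by
    rw [← sum_filter_add_sum_filter_not Z (fun i => n i ≤ 1 / T)]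
    have h2 : ∑ i ∈ Z with ¬ n i ≤ 1 / T, x i ≤ ∑ i ∈ Z, T * n i := by
      refine (sum_le_sum fun i hi => ?_).trans
        (sum_le_sum_of_subset_of_nonneg (filter_subset _ _)
          fun i hi _ => mul_nonneg hT.le (hn i hi).le)
      obtain ⟨hiZ, hi⟩ := mem_filter.1 hi
      push Not at hi
      rw [div_lt_iff₀ hT] at hi
      linarith [hx i hiZ]
    rw [← mul_sum, hsum, mul_one] at h2
    linarith
  set θ := 1 / (3 * P) with hθ
  have hθ0 : 0 ≤ θ := by positivity
  have hθ1 : θ ≤ 1 := by rw [hθ, div_le_one (by positivity)]; linarith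
  have hX : (0 : ℝ) < 1 + T := by positivity
  have hpt : ∀ i ∈ Z, e i ^ (1 / 3 : ℝ) ≤
      (1 + T) ^ θ * (θ * (x i / (1 + T)) + (1 - θ) * n i) := by
    intro i hi
    have h := Real.geom_mean_le_arith_mean2_weighted hθ0 (sub_nonneg.2 hθ1)
      (div_nonneg (hx0 i hi) hX.le) (hn i hi).le (by ring)
    rw [rpow_third_eq (he i hi) (hn i hi) (by linarith : 0 < P)]
    have : x i = (1 + T) * (x i / (1 + T)) := by field_simp
    change x i ^ θ * _ ≤ _
    rw [this, Real.mul_rpow hX.le (div_nonneg (hx0 i hi) hX.le), mul_assoc, ← this]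
    exact mul_le_mul_of_nonneg_left h (by positivity)
  refine (sum_le_sum hpt).trans ?_
  rw [← mul_sum, sum_add_distrib, ← mul_sum, ← mul_sum, ← sum_div, hsum]
  have h1 : (∑ i ∈ Z, x i) / (1 + T) ≤ 1 := by rwa [div_le_one hX]
  have h2 : θ * ((∑ i ∈ Z, x i) / (1 + T)) + (1 - θ) * 1 ≤ 1 := by nlinarith
  calc _ ≤ (1 + T) ^ θ * 1 := mul_le_mul_of_nonneg_left h2 (by positivity)
    _ = _ := mul_one _

theorem exists_rpow_third_ge {Z : Finset ℤ} {e n : ℤ → ℝ} {P T c : ℝ} (hP : 1 ≤ P) (hT : 0 < T)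
    (hc0 : 0 < c) (hc1 : c ≤ 1) (hTP : (1 + T) ^ (1 / P) ≤ 1 + c ^ 3)
    (he : ∀ i ∈ Z, 0 ≤ e i) (hn : ∀ i ∈ Z, 0 < n i) (hsum : ∑ i ∈ Z, n i = 1)
    (hx : ∀ i ∈ Z, e i ^ P * n i ^ (1 - 3 * P) ≤ 1)
    (hlight : ∑ i ∈ Z with n i ≤ 1 / T, e i ^ P * n i ^ (1 - 3 * P) ≤ 1)
    (hQ : 1 ≤ ∑ i ∈ Z, ∑ j ∈ Z, ∑ k ∈ Z, ∑ l ∈ Z, if i + j = k + l then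
      e i ^ (1 / 4 : ℝ) * e j ^ (1 / 4 : ℝ) * (e k ^ (1 / 4 : ℝ) * e l ^ (1 / 4 : ℝ)) else 0) :
    ∃ i ∈ Z, 1 - 7 * c ≤ e i ^ (1 / 3 : ℝ) := by
  set u : ℤ → ℝ := fun i => e i ^ (1 / 12 : ℝ) with hu
  have hu3 : ∀ i ∈ Z, e i ^ (1 / 4 : ℝ) = u i ^ 3 := by
    intro i hi
    rw [hu, ← Real.rpow_natCast, ← Real.rpow_mul (he i hi)]
    norm_num
  have hu4 : ∀ i ∈ Z, e i ^ (1 / 3 : ℝ) = u i ^ 4 := by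
    intro i hi
    rw [hu, ← Real.rpow_natCast, ← Real.rpow_mul (he i hi)]
    norm_num
  have hW := sum_rpow_third_le hP hT he hn hsum hx hlight
  rw [sum_congr rfl hu4] at hW
  have hQ' : 1 ≤ ∑ i ∈ Z, ∑ j ∈ Z, ∑ k ∈ Z, ∑ l ∈ Z,
      (if i + j = k + l then u i ^ 3 * u j ^ 3 * (u k ^ 3 * u l ^ 3) else 0) := by
    refine hQ.trans (le_of_eq ?_)
    refine sum_congr rfl fun i hi => sum_congr rfl fun j hj => sum_congr rfl fun k hk =>
      sum_congr rfl fun l hl => ?_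
    rw [hu3 i hi, hu3 j hj, hu3 k hk, hu3 l hl]
  set W := ∑ i ∈ Z, u i ^ 4 with hWdef
  have hW0 : 0 ≤ W := sum_nonneg fun i _ => by positivity
  have hW1 : 1 ≤ W := by
    have := hQ'.trans (quad_sum_le_cube Z u)
    by_contra h
    push Not at h
    have := pow_lt_one₀ hW0 h (by norm_num : 3 ≠ 0)
    linarith
  have hW3 : W ^ 3 ≤ 1 + c ^ 3 := by
    refine le_trans ?_ hTP
    calc W ^ 3 ≤ ((1 + T) ^ (1 / (3 * P))) ^ 3 := by gcongr
      _ = (1 + T) ^ (1 / P) := by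
        rw [← Real.rpow_natCast, ← Real.rpow_mul (by positivity)]
        congr 1
        field_simp
        norm_num
  rcases quad_sum_gain Z u hc0 hc1 (by linarith) with h | ⟨j, hj, h⟩
  · exfalso
    have h1 : (1 - c ^ 3) * W ^ 3 ≤ (1 - c ^ 3) * (1 + c ^ 3) := by
      have : c ^ 3 ≤ 1 := pow_le_one₀ hc0.le hc1
      exact mul_le_mul_of_nonneg_left hW3 (by linarith)
    have h2 : 0 < c ^ 3 := by positivity
    nlinarith
  · refine ⟨j, hj, ?_⟩
    rw [hu4 j hj]
    by_cases h7 : 0 ≤ 1 - 7 * c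
    · nlinarith
    · have : 0 ≤ u j ^ 4 := by positivity
      linarith

/-- A set with one dominant class cannot satisfy the two-class energy bound. -/
theorem false_of_dominant_class {e₀ e₁ n₀ n₁ g₀ g₁ : ℝ} (hg₀ : 0 ≤ g₀) (hg₁ : 0 ≤ g₁)
    (he₀ : g₀ ^ 4 = e₀) (he₁ : g₁ ^ 4 = e₁) (hn₀ : 0 < n₀) (hn₁ : 0 < n₁) (hn : n₀ + n₁ = 1)
    (h₀ : e₀ ≤ n₀ ^ (5 / 2 : ℝ)) (h₁ : e₁ ≤ n₁ ^ (5 / 2 : ℝ))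
    (hdom : 1 - 7 * (1 / 300000) ≤ e₀ ^ (1 / 3 : ℝ))
    (hQ : 1 ≤ g₀ ^ 4 + 6 * g₀ ^ 2 * g₁ ^ 2 + 4 * g₀ * g₁ ^ 3 + g₁ ^ 4) : False := by
  have he₀' : 0 ≤ e₀ := by rw [← he₀]; positivity
  have hn₀1 : n₀ ≤ 1 := by linarith
  have hn₁1 : n₁ ≤ 1 := by linarith
  have hsq : 1 - 7 * (1 / 300000) ≤ √n₀ := by
    refine hdom.trans ?_
    calc e₀ ^ (1 / 3 : ℝ) ≤ (n₀ ^ (5 / 2 : ℝ)) ^ (1 / 3 : ℝ) := by gcongr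
      _ = n₀ ^ (5 / 6 : ℝ) := by rw [← Real.rpow_mul hn₀.le]; norm_num
      _ ≤ n₀ ^ (1 / 2 : ℝ) := Real.rpow_le_rpow_of_exponent_ge hn₀ hn₀1 (by norm_num)
      _ = √n₀ := (Real.sqrt_eq_rpow _).symm
  have hn₀2 : 1 - 14 * (1 / 300000) ≤ n₀ := by
    have := Real.sq_sqrt hn₀.le
    nlinarith
  obtain ⟨y, hy0, hy⟩ : ∃ y : ℝ, 0 < y ∧ y ^ 4 = n₁ := by
    refine ⟨n₁ ^ (1 / 4 : ℝ), by positivity, ?_⟩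
    rw [← Real.rpow_natCast, ← Real.rpow_mul hn₁.le]; norm_num
  have hy11 : y < 1 / 11 := by
    by_contra hcon
    push Not at hcon
    have : (1 / 11 : ℝ) ^ 4 ≤ y ^ 4 := by gcongr
    rw [hy] at this
    norm_num at this
    linarith
  have he₁y : g₁ ^ 4 ≤ (y ^ 5) ^ 2 := by
    rw [he₁]
    refine h₁.trans (le_of_eq ?_)
    rw [← hy, ← pow_mul, ← Real.rpow_natCast, ← Real.rpow_natCast, ← Real.rpow_mul hy0.le]
    norm_num
  have hg₁2 : g₁ ^ 2 ≤ y ^ 5 := by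
    have : (g₁ ^ 2) ^ 2 ≤ (y ^ 5) ^ 2 := by rw [← pow_mul]; exact he₁y
    exact le_of_sq_le_sq this (by positivity)
  have hg₁1 : g₁ ≤ 1 := by
    have : y ^ 5 ≤ 1 := pow_le_one₀ hy0.le (by linarith)
    nlinarith
  have he₀n : g₀ ^ 4 ≤ n₀ := by
    rw [he₀]
    refine h₀.trans ?_
    conv_rhs => rw [← Real.rpow_one n₀]
    exact Real.rpow_le_rpow_of_exponent_ge hn₀ hn₀1 (by norm_num)
  have hg₀1 : g₀ ≤ 1 := by
    by_contra hcon
    push Not at hcon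
    have := one_lt_pow₀ hcon (by norm_num : 4 ≠ 0)
    linarith
  have t1 : g₀ ^ 2 * g₁ ^ 2 ≤ g₁ ^ 2 := by
    have : g₀ ^ 2 ≤ 1 := pow_le_one₀ hg₀ hg₀1
    nlinarith [sq_nonneg g₁]
  have t2 : g₁ ^ 3 ≤ g₁ ^ 2 := pow_le_pow_of_le_one hg₁ hg₁1 (by norm_num)
  have t3 : g₁ ^ 4 ≤ g₁ ^ 2 := pow_le_pow_of_le_one hg₁ hg₁1 (by norm_num)
  have t4 : g₀ * g₁ ^ 3 ≤ g₁ ^ 3 := by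
    have : 0 ≤ g₁ ^ 3 := by positivity
    nlinarith
  have t5 : y ^ 5 < y ^ 4 * (1 / 11) := by
    have : 0 < y ^ 4 := by positivity
    nlinarith
  nlinarith

end Concentration

section Structure

theorem le_rpow_of_mul_rpow_le_one {e n P : ℝ} (hP : 2 ≤ P) (he : 0 ≤ e) (hn : 0 < n)
    (hn1 : n ≤ 1) (h : e ^ P * n ^ (1 - 3 * P) ≤ 1) : e ≤ n ^ (5 / 2 : ℝ) := by
  have hP0 : 0 < P := by linarith
  have h1 : e ^ P ≤ n ^ (3 * P - 1) := by
    have hpos : 0 < n ^ (3 * P - 1) := by positivity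
    have : n ^ (1 - 3 * P) = (n ^ (3 * P - 1))⁻¹ := by rw [← Real.rpow_neg hn.le]; ring_nf
    rwa [this, ← div_eq_mul_inv, div_le_one hpos] at h
  calc e = (e ^ P) ^ (1 / P) := by
        rw [← Real.rpow_mul he, mul_one_div_cancel hP0.ne', Real.rpow_one]
    _ ≤ (n ^ (3 * P - 1)) ^ (1 / P) := by gcongr
    _ = n ^ (3 - 1 / P) := by
        rw [← Real.rpow_mul hn.le]; congr 1; field_simp
    _ ≤ n ^ (5 / 2 : ℝ) := by
        refine Real.rpow_le_rpow_of_exponent_ge hn hn1 ?_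
        have : 1 / P ≤ 1 / 2 := by gcongr
        linarith

theorem expNorm_singleton_pow {α : Type*} (x : α) {f : α → ℝ} (hf : 0 ≤ f x) (φ : α → ℤ) :
    (circleMean fun t => ‖expSum {x} f φ t‖ ^ 4) = f x ^ 4 := by
  have : ∀ t, ‖expSum {x} f φ t‖ = f x := by
    intro t
    rw [expSum, sum_singleton, norm_mul, Complex.norm_real, Real.norm_of_nonneg hf, fourier_apply,
      Circle.norm_coe, mul_one]
  simp only [this, circleMean_const]

/-- A weighted set with large energy has a large subset which is resolved by few queries. -/
theorem exists_query_subset {ι α : Type*} [Nonempty ι] {v : ι → α → ℤ} {φ : α → ℤ} {f : α → ℝ}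
    {X : Finset α} (hcompat : ∀ x ∈ X, ∀ y ∈ X, ∀ z ∈ X, ∀ w ∈ X, φ x + φ y = φ z + φ w →
      ∀ i, v i x + v i y = v i z + v i w)
    (hsep : ∀ x ∈ X, ∀ y ∈ X, (∀ i, v i x = v i y) → x = y) (hf : ∀ x ∈ X, 1 ≤ f x)
    {P T : ℝ} (hP : 2 ≤ P) (hT : 1 < T) (hTP : (1 + T) ^ (1 / P) ≤ 1 + (1 / 300000) ^ 3)
    (s : Finset α) (hsX : s ⊆ X) (hs : s.Nonempty) (q : ℕ)
    (hq : ∑ x ∈ s, f x ^ (4 / 3 : ℝ) < T ^ (q + 1)) :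
    ∃ S ⊆ s, Query v q S ∧
      (circleMean fun t => ‖expSum s f φ t‖ ^ 4) ^ P * (∑ x ∈ s, f x ^ (4 / 3 : ℝ)) ^ (1 - 3 * P) ≤
        ∑ x ∈ S, f x ^ (4 / 3 : ℝ) := by
  classical
  have hP0 : 0 < P := by linarith
  have hT0 : 0 < T := by linarith
  induction s using Finset.strongInduction generalizing q with
  | H s ih =>
  set E : Finset α → ℝ := fun s => circleMean fun t => ‖expSum s f φ t‖ ^ 4 with hE
  set N : Finset α → ℝ := fun s => ∑ x ∈ s, f x ^ (4 / 3 : ℝ) with hN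
  have hE0 : ∀ s, 0 ≤ E s := fun s => circleMean_nonneg fun t => by positivity
  have hgE : ∀ s, expNorm 4 s f φ ^ 4 = E s := fun s => expNorm_pow (by norm_num) s f φ
  have hfpos : ∀ x ∈ X, 1 ≤ f x ^ (4 / 3 : ℝ) := fun x hx =>
    Real.one_le_rpow (hf x hx) (by norm_num)
  have hNmono : ∀ s s' : Finset α, s ⊆ s' → s' ⊆ X → N s ≤ N s' := fun s s' h h' =>
    sum_le_sum_of_subset_of_nonneg h fun x hx _ => zero_le_one.trans (hfpos x (h' hx))
  have hN1 : ∀ s ⊆ X, s.Nonempty → 1 ≤ N s := by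
    rintro s hs ⟨x, hx⟩
    refine (hfpos x (hs hx)).trans ?_
    have := hNmono {x} s (by simpa using hx) hs
    simpa [hN] using this
  change ∃ S ⊆ s, Query v q S ∧ E s ^ P * N s ^ (1 - 3 * P) ≤ N S
  by_cases hcard : s.card ≤ 1
  · refine ⟨s, Subset.rfl, Query.of_card_le_one v hcard, ?_⟩
    obtain ⟨x, rfl⟩ := card_eq_one.1 (le_antisymm hcard hs.card_pos)
    have hfx : 0 < f x := zero_lt_one.trans_le (hf x (hsX (mem_singleton_self x)))
    simp only [hE, hN, sum_singleton, expNorm_singleton_pow x hfx.le φ]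
    rw [← Real.rpow_natCast, ← Real.rpow_mul hfx.le, ← Real.rpow_mul hfx.le, ← Real.rpow_add hfx]
    refine le_of_eq ?_
    congr 1
    push_cast
    ring
  rcases (hE0 s).eq_or_lt with hEs | hEs
  · refine ⟨∅, empty_subset _, Query.of_card_le_one v (by simp), ?_⟩
    rw [← hEs, Real.zero_rpow hP0.ne', zero_mul]
    simp [hN]
  by_contra hcon
  push Not at hcon
  have hNs : 0 < N s := zero_lt_one.trans_le (hN1 s hsX hs)
  have hD : 0 < E s ^ P * N s ^ (1 - 3 * P) := by positivity
  have hratio : ∀ s' : Finset α, s' ⊆ X → (E s' / E s) ^ P * (N s' / N s) ^ (1 - 3 * P) =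
      E s' ^ P * N s' ^ (1 - 3 * P) / (E s ^ P * N s ^ (1 - 3 * P)) := by
    intro s' hs'
    have : 0 ≤ N s' := sum_nonneg fun x hx => zero_le_one.trans (hfpos x (hs' hx))
    rw [Real.div_rpow (hE0 _) (hE0 _), Real.div_rpow this hNs.le, div_mul_div_comm]
  have hproper : ∀ s' : Finset α, s' ⊂ s → s'.Nonempty →
      (E s' / E s) ^ P * (N s' / N s) ^ (1 - 3 * P) ≤ 1 := by
    intro s' hs' hne
    obtain ⟨S, hS, hSq, hSN⟩ := ih s' hs' (hs'.1.trans hsX) hne q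
      ((hNmono s' s hs'.1 hsX).trans_lt hq)
    rw [hratio s' (hs'.1.trans hsX), div_le_one hD]
    exact hSN.trans (hcon S (hS.trans hs'.1) hSq).le
  -- a coordinate separating two points of `s`
  obtain ⟨i, x, hx, y, hy, hxy⟩ : ∃ i, ∃ x ∈ s, ∃ y ∈ s, v i x ≠ v i y := by
    rw [not_le, one_lt_card] at hcard
    obtain ⟨x, hx, y, hy, hxy⟩ := hcard
    by_contra hno
    push Not at hno
    exact hxy (hsep x (hsX hx) y (hsX hy) fun i => hno i x hx y hy)
  set Z := s.image (v i) with hZ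
  set F : ℤ → Finset α := fun c => s.filter fun x => v i x = c with hF
  have hFs : ∀ c, F c ⊆ s := fun c => filter_subset _ _
  have hFssub : ∀ c, F c ⊂ s := by
    intro c
    refine Finset.ssubset_iff_subset_ne.2 ⟨hFs c, fun h => hxy ?_⟩
    have h1 := (mem_filter.1 (h ▸ hx : x ∈ F c)).2
    have h2 := (mem_filter.1 (h ▸ hy : y ∈ F c)).2
    rw [h1, h2]
  have hFne : ∀ c ∈ Z, (F c).Nonempty := by
    intro c hc
    obtain ⟨x, hx, rfl⟩ := mem_image.1 hc
    exact ⟨x, mem_filter.2 ⟨hx, rfl⟩⟩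
  have hFN : ∀ c ∈ Z, 0 < N (F c) / N s := fun c hc =>
    div_pos (zero_lt_one.trans_le (hN1 _ ((hFs c).trans hsX) (hFne c hc))) hNs
  have hFsum : ∑ c ∈ Z, N (F c) / N s = 1 := by
    rw [← sum_div, div_eq_one_iff_eq hNs.ne']
    exact sum_fiberwise_of_maps_to (fun x hx => mem_image_of_mem _ hx) _
  have hlight : ∑ c ∈ Z with N (F c) / N s ≤ 1 / T,
      (E (F c) / E s) ^ P * (N (F c) / N s) ^ (1 - 3 * P) ≤ 1 := by
    have hlt : ∀ c, N (F c) / N s ≤ 1 / T → N (F c) < T ^ q := by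
      intro c hc
      rw [div_le_div_iff₀ hNs hT0, one_mul] at hc
      have : N (F c) * T < T ^ q * T := by
        rw [← pow_succ]
        exact hc.trans_lt hq
      exact lt_of_mul_lt_mul_right this hT0.le
    cases q with
    | zero =>
      rw [sum_eq_zero]
      · exact zero_le_one
      · intro c hc
        obtain ⟨hcZ, hc⟩ := mem_filter.1 hc
        have := hlt c hc
        have := hN1 _ ((hFs c).trans hsX) (hFne c hcZ)
        simp only [pow_zero] at *
        linarith
    | succ q =>
      have hex : ∀ c, ∃ S ⊆ F c, (c ∈ Z.filter (fun c => N (F c) / N s ≤ 1 / T) →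
          Query v q S ∧ E (F c) ^ P * N (F c) ^ (1 - 3 * P) ≤ N S) := by
        intro c
        by_cases hc : c ∈ Z.filter (fun c => N (F c) / N s ≤ 1 / T)
        · obtain ⟨hcZ, hc'⟩ := mem_filter.1 hc
          obtain ⟨S, hS, h⟩ := ih (F c) (hFssub c) ((hFs c).trans hsX) (hFne c hcZ) q (hlt c hc')
          exact ⟨S, hS, fun _ => h⟩
        · exact ⟨∅, empty_subset _, fun h => absurd h hc⟩
      choose S hSF hS using hex
      set L := Z.filter (fun c => N (F c) / N s ≤ 1 / T) with hL
      have hdisj : (L : Set ℤ).PairwiseDisjoint S := by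
        intro a _ b _ hab
        refine disjoint_left.2 fun x hxa hxb => hab ?_
        have h1 := (mem_filter.1 (hSF a hxa)).2
        have h2 := (mem_filter.1 (hSF b hxb)).2
        rw [← h1, ← h2]
      have hq' : Query v (q + 1) (L.biUnion S) := by
        refine ⟨i, fun c => ?_⟩
        by_cases hc : c ∈ L
        · refine (hS c hc).1.mono fun x hx => ?_
          obtain ⟨hx, hxc⟩ := mem_filter.1 hx
          obtain ⟨c', _, hx'⟩ := mem_biUnion.1 hx
          have := (mem_filter.1 (hSF c' hx')).2
          rwa [← hxc, this]
        · refine Query.of_card_le_one v ?_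
          rw [card_eq_zero.2]
          · exact zero_le_one
          · refine filter_eq_empty_iff.2 fun x hx hxc => hc ?_
            obtain ⟨c', hc', hx'⟩ := mem_biUnion.1 hx
            have := (mem_filter.1 (hSF c' hx')).2
            rwa [← hxc, this]
      have hlt' := hcon (L.biUnion S) (biUnion_subset.2 fun c _ => (hSF c).trans (hFs c)) hq'
      rw [sum_congr rfl fun c _ => hratio (F c) ((hFs c).trans hsX), ← sum_div, div_le_one hD]
      refine le_trans (sum_le_sum fun c hc => (hS c hc).2) (le_trans (le_of_eq ?_) hlt'.le)
      simp only [hN]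
      rw [sum_biUnion hdisj]
  set γ := expNorm 4 s f φ with hγ
  have hγE : γ ^ 4 = E s := hgE s
  have hγ0 : 0 < γ := by
    refine lt_of_le_of_ne (expNorm_nonneg _ _ _ _) fun h => hEs.ne' ?_
    rw [← hγE, ← h]; norm_num
  have hg4 : ∀ s', (expNorm 4 s' f φ / γ) ^ 4 = E s' / E s := by
    intro s'; rw [div_pow, hgE, hγE]
  have hroot : ∀ s', (E s' / E s) ^ (1 / 4 : ℝ) = expNorm 4 s' f φ / γ := by
    intro s'
    have h0 : 0 ≤ expNorm 4 s' f φ / γ := div_nonneg (expNorm_nonneg _ _ _ _) hγ0.le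
    rw [← hg4, ← Real.rpow_natCast, ← Real.rpow_mul h0]
    norm_num
  have hQ : 1 ≤ ∑ a ∈ Z, ∑ b ∈ Z, ∑ c ∈ Z, ∑ d ∈ Z, if a + b = c + d then
      (E (F a) / E s) ^ (1 / 4 : ℝ) * (E (F b) / E s) ^ (1 / 4 : ℝ) *
      ((E (F c) / E s) ^ (1 / 4 : ℝ) * (E (F d) / E s) ^ (1 / 4 : ℝ)) else 0 := by
    have h := circleMean_four_le_label s f φ (v i) Z (fun x hx => mem_image_of_mem _ hx)
      (fun a b c d => a + b = c + d) fun x hx y hy z hz w hw h =>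
        hcompat x (hsX hx) y (hsX hy) z (hsX hz) w (hsX hw) h i
    change E s ≤ _ at h
    refine ((one_le_div hEs).2 h).trans (le_of_eq ?_)
    simp only [sum_div]
    refine sum_congr rfl fun a _ => sum_congr rfl fun b _ => sum_congr rfl fun c _ =>
      sum_congr rfl fun d _ => ?_
    rw [ite_div, zero_div]
    split_ifs
    · rw [hroot, hroot, hroot, hroot, ← hγE]
      field_simp
      rfl
    · rfl
  obtain ⟨c₀, hc₀Z, hc₀⟩ := exists_rpow_third_ge (by linarith) hT0 (by norm_num) (by norm_num) hTP
    (fun c _ => div_nonneg (hE0 (F c)) (hE0 s)) hFN hFsum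
    (fun c hc => hproper (F c) (hFssub c) (hFne c hc)) hlight hQ
  set s₁ := s \ F c₀ with hs₁
  have hs₁s : s₁ ⊆ s := sdiff_subset
  have hs₁ne : s₁.Nonempty := sdiff_nonempty.2 (hFssub c₀).2
  have hs₁ss : s₁ ⊂ s := by
    refine Finset.ssubset_iff_subset_ne.2 ⟨hs₁s, fun h => ?_⟩
    obtain ⟨x, hx⟩ := hFne c₀ hc₀Z
    exact (mem_sdiff.1 (h ▸ hFs c₀ hx : x ∈ s₁)).2 hx
  have hss : s \ s₁ = F c₀ := Finset.sdiff_sdiff_eq_self (hFs c₀)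
  have hadd : N (F c₀) / N s + N s₁ / N s = 1 := by
    rw [← add_div, div_eq_one_iff_eq hNs.ne', add_comm]
    exact sum_sdiff (hFs c₀)
  have hn₁ : 0 < N s₁ / N s :=
    div_pos (zero_lt_one.trans_le (hN1 _ (hs₁s.trans hsX) hs₁ne)) hNs
  have hn₀ := hFN c₀ hc₀Z
  have h2 := circleMean_four_le_two s s₁ f φ (fun x => if x ∈ s₁ then 1 else 0) (fun _ => rfl) hs₁s
    (by
      intro x hx y hy z hz w hw h
      have hv := hcompat x (hsX hx) y (hsX hy) z (hsX hz) w (hsX hw) h i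
      have hmem : ∀ x ∈ s, x ∈ s₁ ↔ v i x ≠ c₀ := by
        intro x hx
        simp [hs₁, hF, hx]
      simp only [hmem x hx, hmem y hy, hmem z hz, hmem w hw]
      split_ifs <;> omega)
  rw [hss] at h2
  change E s ≤ _ at h2
  refine false_of_dominant_class (div_nonneg (expNorm_nonneg 4 (F c₀) f φ) hγ0.le)
    (div_nonneg (expNorm_nonneg 4 s₁ f φ) hγ0.le) (hg4 _) (hg4 _) hn₀ hn₁ hadd
    (le_rpow_of_mul_rpow_le_one hP (div_nonneg (hE0 _) (hE0 _)) hn₀ (by linarith)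
      (hproper _ (hFssub c₀) (hFne c₀ hc₀Z)))
    (le_rpow_of_mul_rpow_le_one hP (div_nonneg (hE0 _) (hE0 _)) hn₁ (by linarith)
      (hproper _ hs₁ss hs₁ne)) hc₀ ?_
  refine ((one_le_div hEs).2 h2).trans (le_of_eq ?_)
  rw [← hγE]
  field_simp

end Structure

section Logarithm

theorem eq_of_sum_mul_pow_eq {W : ℕ} (N : ℕ) (a b : ℕ → ℕ) (ha : ∀ i < N, a i < W)
    (hb : ∀ i < N, b i < W)
    (h : ∑ i ∈ range N, a i * W ^ i = ∑ i ∈ range N, b i * W ^ i) : ∀ i < N, a i = b i := by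
  induction N generalizing a b with
  | zero => intro i hi; omega
  | succ N ih =>
    have hsplit : ∀ a : ℕ → ℕ, ∑ i ∈ range (N + 1), a i * W ^ i =
        W * (∑ i ∈ range N, a (i + 1) * W ^ i) + a 0 := by
      intro a
      rw [sum_range_succ', mul_sum, pow_zero, mul_one]
      congr 1
      exact sum_congr rfl fun i _ => by ring
    rw [hsplit, hsplit] at h
    have hW : 0 < W := (Nat.zero_le _).trans_lt (ha 0 (by omega))
    have h0 : a 0 = b 0 := by
      have := congrArg (· % W) h
      simpa [Nat.mul_add_mod, Nat.mod_eq_of_lt (ha 0 (by omega)),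
        Nat.mod_eq_of_lt (hb 0 (by omega))] using this
    have h1 : ∑ i ∈ range N, a (i + 1) * W ^ i = ∑ i ∈ range N, b (i + 1) * W ^ i := by
      rw [h0, Nat.add_right_cancel_iff] at h
      exact Nat.eq_of_mul_eq_mul_left hW h
    intro i hi
    cases i with
    | zero => exact h0
    | succ i =>
      exact ih (fun i => a (i + 1)) (fun i => b (i + 1)) (fun j hj => ha _ (by omega))
        (fun j hj => hb _ (by omega)) h1 i (by omega)

/-- There is an integer-valued logarithm which is injective on a prescribed initial segment. -/
theorem exists_int_log (M : ℕ) : ∃ φ : ℕ → ℤ,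
    (∀ x y, x ≠ 0 → y ≠ 0 → φ (x * y) = φ x + φ y) ∧
    (∀ x y, x ≠ 0 → y ≠ 0 → x ≤ M → y ≤ M → φ x = φ y → x = y) := by
  refine ⟨fun n => ((∑ p ∈ range (M + 1), n.factorization p * (M + 1) ^ p : ℕ) : ℤ), ?_, ?_⟩
  · intro x y hx hy
    simp only
    rw [← Nat.cast_add, ← sum_add_distrib, Nat.cast_inj]
    refine sum_congr rfl fun p _ => ?_
    rw [Nat.factorization_mul hx hy, Finsupp.add_apply, add_mul]
  · intro x y hx hy hxM hyM h
    have hlt : ∀ z, z ≠ 0 → z ≤ M → ∀ i < M + 1, z.factorization i < M + 1 := by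
      intro z hz hzM i _
      have := Nat.factorization_lt i hz
      omega
    have h' := eq_of_sum_mul_pow_eq (M + 1) _ _ (hlt x hx hxM) (hlt y hy hyM) (Nat.cast_injective h)
    refine Nat.eq_of_factorization_eq hx hy fun p => ?_
    by_cases hp : p < M + 1
    · exact h' p hp
    · rw [Nat.factorization_eq_zero_of_lt (by omega), Nat.factorization_eq_zero_of_lt (by omega)]

theorem eq_of_primeVal_eq {x y : ℕ} (hx : x ≠ 0) (hy : y ≠ 0)
    (h : ∀ p, primeVal p x = primeVal p y) : x = y := by
  refine Nat.eq_of_factorization_eq hx hy fun p => ?_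
  by_cases hp : p.Prime
  · have := h ⟨p, hp⟩
    simp only [primeVal, Nat.cast_inj] at this
    rwa [Nat.factorization_def _ hp, Nat.factorization_def _ hp]
  · rw [Nat.factorization_eq_zero_of_not_prime _ hp, Nat.factorization_eq_zero_of_not_prime _ hp]

theorem intLog_prod {φ : ℕ → ℤ} (hφ : ∀ x y, x ≠ 0 → y ≠ 0 → φ (x * y) = φ x + φ y)
    (s : Multiset ℕ) (hs : ∀ x ∈ s, x ≠ 0) : φ s.prod = (s.map φ).sum := by
  have h1 : φ 1 = 0 := by
    have := hφ 1 1 one_ne_zero one_ne_zero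
    simp only [mul_one] at this
    linarith
  induction s using Multiset.induction with
  | empty => simpa using h1
  | cons a s ih =>
    have hs' : ∀ x ∈ s, x ≠ 0 := fun x hx => hs x (Multiset.mem_cons_of_mem hx)
    have hne : s.prod ≠ 0 := Multiset.prod_ne_zero fun h => hs' 0 h rfl
    rw [Multiset.prod_cons, hφ _ _ (hs a (Multiset.mem_cons_self a s)) hne, ih hs',
      Multiset.map_cons, Multiset.sum_cons]

end Logarithm

section WeightedStructure

theorem circleMean_sq_eq {α : Type*} (s : Finset α) (f : α → ℝ) (φ : α → ℤ)
    (hφ : ∀ x ∈ s, ∀ y ∈ s, φ x = φ y → x = y) :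
    (circleMean fun t => ‖expSum s f φ t‖ ^ 2) = ∑ x ∈ s, f x ^ 2 := by
  classical
  have h := circleMean_pow_eq_count 1 s f φ
  rw [mul_one] at h
  rw [h]
  have h2 : ∑ z ∈ Fintype.piFinset (fun _ : Fin 1 × Bool => s),
        (if ∑ i, sideSign i.2 * φ (z i) = 0 then ∏ i, f (z i) else 0) =
      ∑ x ∈ s ×ˢ s, if φ x.1 = φ x.2 then f x.1 * f x.2 else 0 := by
    refine sum_nbij' (fun z => (z (0, true), z (0, false))) (fun x p => if p.2 then x.1 else x.2)
      ?_ ?_ ?_ ?_ ?_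
    · intro z hz
      rw [Fintype.mem_piFinset] at hz
      exact mem_product.2 ⟨hz _, hz _⟩
    · intro x hx
      rw [mem_product] at hx
      rw [Fintype.mem_piFinset]
      rintro ⟨a, b⟩
      cases b <;> simp [hx]
    · intro z _
      ext ⟨a, b⟩
      fin_cases a
      cases b <;> simp
    · intro x _
      simp
    · intro z _
      simp only [Fintype.sum_prod_type, Fintype.prod_prod_type, Fintype.sum_bool,
        Fintype.prod_bool, univ_unique, sum_singleton, prod_singleton, sideSign]
      simp only [if_true, Bool.false_eq_true, if_false, one_mul, neg_one_mul]
      simp only [← sub_eq_add_neg, sub_eq_zero]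
      rfl
  rw [h2, sum_product]
  refine sum_congr rfl fun x hx => ?_
  rw [sum_eq_single x]
  · simp [sq]
  · intro y hy hyx
    exact if_neg fun h => hyx (hφ x hx y hy h).symm
  · exact fun h => absurd hx h

theorem sum_rpow_four_thirds_le {α : Type*} {s X : Finset α} (hs : s ⊆ X) {u : α → ℝ}
    (hu : ∀ x ∈ X, 0 ≤ u x) :
    ∑ x ∈ s, u x ^ (4 / 3 : ℝ) ≤
      (∑ x ∈ s, u x) ^ (2 / 3 : ℝ) * (∑ x ∈ X, u x ^ 2) ^ (1 / 3 : ℝ) := by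
  have hpq : (3 / 2 : ℝ).HolderConjugate 3 := by
    rw [Real.holderConjugate_iff]; norm_num
  have h := Real.inner_le_Lp_mul_Lq_of_nonneg s hpq (f := fun x => u x ^ (2 / 3 : ℝ))
    (g := fun x => u x ^ (2 / 3 : ℝ)) (fun x hx => Real.rpow_nonneg (hu x (hs hx)) _)
    (fun x hx => Real.rpow_nonneg (hu x (hs hx)) _)
  have e1 : ∀ x ∈ s, u x ^ (2 / 3 : ℝ) * u x ^ (2 / 3 : ℝ) = u x ^ (4 / 3 : ℝ) := by
    intro x hx
    rw [← Real.rpow_add_of_nonneg (hu x (hs hx)) (by norm_num) (by norm_num)]; norm_num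
  have e2 : ∀ x ∈ s, (u x ^ (2 / 3 : ℝ)) ^ (3 / 2 : ℝ) = u x := by
    intro x hx
    rw [← Real.rpow_mul (hu x (hs hx))]; norm_num
  have e3 : ∀ x ∈ s, (u x ^ (2 / 3 : ℝ)) ^ (3 : ℝ) = u x ^ 2 := by
    intro x hx
    rw [← Real.rpow_mul (hu x (hs hx)), ← Real.rpow_natCast]; norm_num
  rw [sum_congr rfl e1, sum_congr rfl e2, sum_congr rfl e3] at h
  refine h.trans ?_
  norm_num only [one_div_div]
  refine mul_le_mul_of_nonneg_left ?_ (Real.rpow_nonneg (sum_nonneg fun x hx => hu x (hs hx)) _)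
  refine Real.rpow_le_rpow (sum_nonneg fun x _ => sq_nonneg _) ?_ (by norm_num)
  exact sum_le_sum_of_subset_of_nonneg hs fun x _ _ => sq_nonneg _

theorem expSum_div {α : Type*} (s : Finset α) (f : α → ℝ) (c : ℝ) (φ : α → ℤ)
    (t : UnitAddCircle) : expSum s (fun x => f x / c) φ t = expSum s f φ t / c := by
  simp only [expSum, sum_div, Complex.ofReal_div]
  exact sum_congr rfl fun x _ => by ring

/-- Discarding the small weights of a probability measure keeps most of its energy. -/
theorem energy_truncate {α : Type*} {X : Finset α} {u : α → ℝ} {φ : α → ℤ} {δ : ℝ}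
    (hδ : 0 < δ) (hu : ∀ x ∈ X, 0 ≤ u x) (hu1 : ∑ x ∈ X, u x = 1)
    (hφ : ∀ x ∈ X, ∀ y ∈ X, φ x = φ y → x = y)
    (hE : δ ≤ circleMean fun t => ‖expSum X u φ t‖ ^ 4) :
    (circleMean fun t => ‖expSum X u φ t‖ ^ 4) ≤
      8 * circleMean fun t => ‖expSum (X.filter fun x => δ / 8 ≤ u x) u φ t‖ ^ 4 := by
  set F := expSum X u φ with hF
  set F' := expSum (X.filter fun x => δ / 8 ≤ u x) u φ with hF'
  set G := expSum (X.filter fun x => ¬ δ / 8 ≤ u x) u φ with hG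
  have cF : Continuous F := continuous_expSum _ _ _
  have cF' : Continuous F' := continuous_expSum _ _ _
  have cG : Continuous G := continuous_expSum _ _ _
  have hsplit : ∀ t, F t = F' t + G t := fun t => (sum_filter_add_sum_filter_not X _ _).symm
  have hF1 : ∀ t, ‖F t‖ ≤ 1 := fun t => hu1 ▸ norm_expSum_le X u hu φ t
  have hpt : ∀ t, ‖F t‖ ^ 4 ≤ 2⁻¹ * ‖F t‖ ^ 4 + (2 * ‖F' t‖ ^ 4 + 2 * ‖G t‖ ^ 2) := by
    intro t
    have h1 : ‖F t‖ ≤ ‖F' t‖ + ‖G t‖ := by rw [hsplit]; exact norm_add_le _ _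
    have h2 : ‖F t‖ ^ 2 ≤ (‖F' t‖ + ‖G t‖) ^ 2 := by gcongr
    have h3 : ‖F t‖ ^ 2 ≤ 2 * ‖F' t‖ ^ 2 + 2 * ‖G t‖ ^ 2 := by
      nlinarith [sq_nonneg (‖F' t‖ - ‖G t‖)]
    have h4 : ‖F t‖ ^ 2 ≤ 1 := pow_le_one₀ (norm_nonneg _) (hF1 t)
    have h5 : ‖F t‖ ^ 2 * ‖F t‖ ^ 2 ≤ ‖F t‖ ^ 2 * (2 * ‖F' t‖ ^ 2 + 2 * ‖G t‖ ^ 2) := by gcongr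
    have h6 : ‖F t‖ ^ 2 * ‖G t‖ ^ 2 ≤ ‖G t‖ ^ 2 := by nlinarith [sq_nonneg ‖G t‖]
    nlinarith [sq_nonneg (‖F t‖ ^ 2 - 2 * ‖F' t‖ ^ 2)]
  have hmean_eq : (circleMean fun t => 2⁻¹ * ‖F t‖ ^ 4 + (2 * ‖F' t‖ ^ 4 + 2 * ‖G t‖ ^ 2)) =
      2⁻¹ * (circleMean fun t => ‖F t‖ ^ 4) + (2 * (circleMean fun t => ‖F' t‖ ^ 4) +
        2 * circleMean fun t => ‖G t‖ ^ 2) := by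
    unfold circleMean
    rw [MeasureTheory.integral_add (integrable_circle (by fun_prop))
      (integrable_circle (by fun_prop)), MeasureTheory.integral_add
      (integrable_circle (by fun_prop)) (integrable_circle (by fun_prop)),
      MeasureTheory.integral_const_mul, MeasureTheory.integral_const_mul,
      MeasureTheory.integral_const_mul]
  have hmean := circleMean_mono (by fun_prop) (by fun_prop) hpt
  rw [hmean_eq] at hmean
  have hGle : (circleMean fun t => ‖G t‖ ^ 2) ≤ δ / 8 := by
    rw [hG, circleMean_sq_eq _ _ _ fun x hx y hy =>
      hφ x (mem_filter.1 hx).1 y (mem_filter.1 hy).1]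
    calc ∑ x ∈ X with ¬ δ / 8 ≤ u x, u x ^ 2 ≤ ∑ x ∈ X, δ / 8 * u x := by
          refine (sum_le_sum fun x hx => ?_).trans (sum_le_sum_of_subset_of_nonneg
            (filter_subset _ _) fun x hx _ => mul_nonneg (by positivity) (hu x hx))
          obtain ⟨hxX, hx⟩ := mem_filter.1 hx
          push Not at hx
          nlinarith [hu x hxX]
      _ = δ / 8 := by rw [← mul_sum, hu1, mul_one]
  linarith

theorem exists_query_subset_of_measure {ι α : Type*} [Nonempty ι] {v : ι → α → ℤ} {φ : α → ℤ}
    {u : α → ℝ} {X : Finset α}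
    (hcompat : ∀ x ∈ X, ∀ y ∈ X, ∀ z ∈ X, ∀ w ∈ X, φ x + φ y = φ z + φ w →
      ∀ i, v i x + v i y = v i z + v i w)
    (hsep : ∀ x ∈ X, ∀ y ∈ X, (∀ i, v i x = v i y) → x = y)
    (hφ : ∀ x ∈ X, ∀ y ∈ X, φ x = φ y → x = y)
    (hu : ∀ x ∈ X, 0 ≤ u x) (hu1 : ∑ x ∈ X, u x = 1)
    {P T K δ : ℝ} {q : ℕ} (hP : 2 ≤ P) (hT : 1 < T)
    (hTP : (1 + T) ^ (1 / P) ≤ 1 + (1 / 300000) ^ 3) (hδ : 0 < δ) (hK : 0 < K)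
    (hq : 64 / δ ^ 2 < T ^ (q + 1))
    (hE : δ ≤ circleMean fun t => ‖expSum X u φ t‖ ^ 4)
    (hEK : ∑ x ∈ X, u x ^ 2 ≤ K * circleMean fun t => ‖expSum X u φ t‖ ^ 4) :
    ∃ S ⊆ X, Query v q S ∧ (8 * K) ^ (-(3 * P / 2)) ≤ ∑ x ∈ S, u x := by
  set τ := δ / 8 with hτ
  have hτ0 : 0 < τ := by positivity
  set X' := X.filter fun x => τ ≤ u x with hX'
  have hX'X : X' ⊆ X := filter_subset _ _
  have htr := energy_truncate hδ hu hu1 hφ hE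
  change _ ≤ 8 * circleMean fun t => ‖expSum X' u φ t‖ ^ 4 at htr
  set E := circleMean fun t => ‖expSum X u φ t‖ ^ 4 with hEdef
  set E' := circleMean fun t => ‖expSum X' u φ t‖ ^ 4 with hE'def
  set D := ∑ x ∈ X, u x ^ 2 with hD
  have hE'0 : 0 < E' := by linarith
  have hX'ne : X'.Nonempty := by
    by_contra h
    rw [not_nonempty_iff_eq_empty] at h
    rw [hE'def, h] at hE'0
    simp [expSum, circleMean_const] at hE'0
  have hu' : ∀ x ∈ X', 0 < u x := fun x hx => hτ0.trans_le (mem_filter.1 hx).2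
  have hu1' : ∀ x ∈ X, u x ≤ 1 := fun x hx => by
    rw [← hu1]; exact single_le_sum hu hx
  obtain ⟨x₀, hx₀⟩ := hX'ne
  have hτ1 : τ ≤ 1 := (mem_filter.1 hx₀).2.trans (hu1' x₀ (hX'X hx₀))
  have hD0 : 0 < D := by
    refine sum_pos' (fun x _ => sq_nonneg _) ⟨x₀, hX'X hx₀, ?_⟩
    have := hu' x₀ hx₀
    positivity
  set σ := τ ^ (4 / 3 : ℝ) with hσ
  have hσ0 : 0 < σ := by positivity
  have hσ3 : σ ^ 3 = τ ^ 4 := by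
    rw [hσ, ← Real.rpow_natCast, ← Real.rpow_mul hτ0.le, ← Real.rpow_natCast]; norm_num
  set N' := ∑ x ∈ X', u x ^ (4 / 3 : ℝ) with hN'
  have hN'0 : 0 < N' := sum_pos (fun x hx => Real.rpow_pos_of_pos (hu' x hx) _) ⟨x₀, hx₀⟩
  have hNdiv : ∀ S ⊆ X', ∑ x ∈ S, (u x / τ) ^ (4 / 3 : ℝ) = (∑ x ∈ S, u x ^ (4 / 3 : ℝ)) / σ := by
    intro S hS
    rw [sum_div]
    exact sum_congr rfl fun x hx => Real.div_rpow (hu' x (hS hx)).le hτ0.le _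
  have hEdiv : (circleMean fun t => ‖expSum X' (fun x => u x / τ) φ t‖ ^ 4) = E' / σ ^ 3 := by
    rw [hσ3, hE'def]
    unfold circleMean
    rw [← MeasureTheory.integral_div]
    congr 1
    ext t
    change ‖expSum X' (fun x => u x / τ) φ t‖ ^ 4 = _
    rw [expSum_div, norm_div, div_pow, Complex.norm_real, Real.norm_of_nonneg hτ0.le]
  have hN'1 : N' ≤ 1 := by
    rw [← hu1]
    refine le_trans (sum_le_sum fun x hx => ?_)
      (sum_le_sum_of_subset_of_nonneg hX'X fun x hx _ => hu x hx)
    conv_rhs => rw [← Real.rpow_one (u x)]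
    exact Real.rpow_le_rpow_of_exponent_ge (hu' x hx) (hu1' x (hX'X hx)) (by norm_num)
  have hqlt : ∑ x ∈ X', (u x / τ) ^ (4 / 3 : ℝ) < T ^ (q + 1) := by
    rw [hNdiv X' Subset.rfl]
    refine lt_of_le_of_lt ?_ hq
    have h64 : 64 / δ ^ 2 = 1 / τ ^ 2 := by rw [hτ]; field_simp; norm_num
    rw [h64]
    have hστ : τ ^ 2 ≤ σ := by
      rw [hσ, ← Real.rpow_natCast]
      exact Real.rpow_le_rpow_of_exponent_ge hτ0 hτ1 (by norm_num)
    gcongr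
  obtain ⟨S, hS, hSq, hSN⟩ := exists_query_subset (v := v) (φ := φ) (f := fun x => u x / τ) (X := X')
    (fun x hx y hy z hz w hw => hcompat x (hX'X hx) y (hX'X hy) z (hX'X hz) w (hX'X hw))
    (fun x hx y hy => hsep x (hX'X hx) y (hX'X hy))
    (fun x hx => (one_le_div hτ0).2 (mem_filter.1 hx).2) hP hT hTP X' Subset.rfl ⟨x₀, hx₀⟩ q hqlt
  refine ⟨S, hS.trans hX'X, hSq, ?_⟩
  rw [hEdiv, hNdiv X' Subset.rfl, hNdiv S hS, ← hN'] at hSN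
  have hscale : (E' / σ ^ 3) ^ P * (N' / σ) ^ (1 - 3 * P) = E' ^ P * N' ^ (1 - 3 * P) / σ := by
    rw [Real.div_rpow hE'0.le (by positivity), Real.div_rpow hN'0.le hσ0.le, div_mul_div_comm]
    congr 1
    rw [← Real.rpow_natCast, ← Real.rpow_mul hσ0.le, ← Real.rpow_add hσ0]
    conv_rhs => rw [← Real.rpow_one σ]
    congr 1
    push_cast
    ring
  rw [hscale, div_le_div_iff_of_pos_right hσ0] at hSN
  have hN'D : N' ≤ D ^ (1 / 3 : ℝ) := by
    refine (sum_rpow_four_thirds_le hX'X hu).trans ?_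
    have h1 : ∑ x ∈ X', u x ≤ 1 := by
      rw [← hu1]; exact sum_le_sum_of_subset_of_nonneg hX'X fun x hx _ => hu x hx
    have h2 : (∑ x ∈ X', u x) ^ (2 / 3 : ℝ) ≤ 1 :=
      Real.rpow_le_one (sum_nonneg fun x hx => (hu' x hx).le) h1 (by norm_num)
    have h3 : 0 ≤ D ^ (1 / 3 : ℝ) := by positivity
    nlinarith
  have hE'D : D / (8 * K) ≤ E' := by
    rw [div_le_iff₀ (by positivity)]
    nlinarith
  have hlow : D ^ (1 / 3 : ℝ) * (8 * K) ^ (-P) ≤ E' ^ P * N' ^ (1 - 3 * P) := by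
    have h1 : (D / (8 * K)) ^ P ≤ E' ^ P :=
      Real.rpow_le_rpow (by positivity) hE'D (by linarith)
    have h2 : (D ^ (1 / 3 : ℝ)) ^ (1 - 3 * P) ≤ N' ^ (1 - 3 * P) :=
      Real.rpow_le_rpow_of_nonpos hN'0 hN'D (by linarith)
    calc D ^ (1 / 3 : ℝ) * (8 * K) ^ (-P) = (D / (8 * K)) ^ P * (D ^ (1 / 3 : ℝ)) ^ (1 - 3 * P) := by
          rw [Real.div_rpow hD0.le (by positivity), ← Real.rpow_mul hD0.le,
            Real.rpow_neg (by positivity), div_mul_eq_mul_div, ← Real.rpow_add hD0, div_eq_mul_inv]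
          congr 2
          ring
      _ ≤ _ := by gcongr
  have hup := sum_rpow_four_thirds_le (hS.trans hX'X) hu
  have hSu : 0 ≤ ∑ x ∈ S, u x := sum_nonneg fun x hx => (hu' x (hS hx)).le
  have hfin : (8 * K) ^ (-P) ≤ (∑ x ∈ S, u x) ^ (2 / 3 : ℝ) := by
    have h3 : 0 < D ^ (1 / 3 : ℝ) := by positivity
    have := hlow.trans (hSN.trans hup)
    rw [mul_comm (_ ^ (2 / 3 : ℝ))] at this
    exact le_of_mul_le_mul_left this h3
  calc (8 * K) ^ (-(3 * P / 2)) = ((8 * K) ^ (-P)) ^ (3 / 2 : ℝ) := by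
        rw [← Real.rpow_mul (by positivity)]; congr 1; ring
    _ ≤ ((∑ x ∈ S, u x) ^ (2 / 3 : ℝ)) ^ (3 / 2 : ℝ) := by gcongr
    _ = ∑ x ∈ S, u x := by rw [← Real.rpow_mul hSu]; norm_num

end WeightedStructure

section ProductSets

/-- The `j`-fold power of the exponential sum over `A` along an integer logarithm is the
exponential sum over the `j`-fold product set, weighted by representation numbers. -/
theorem expSum_pow_eq {A : Finset ℕ} (hA : ∀ a ∈ A, a ≠ 0) {φ : ℕ → ℤ}
    (hφ : ∀ x y, x ≠ 0 → y ≠ 0 → φ (x * y) = φ x + φ y) (j : ℕ) (t : UnitAddCircle) :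
    expSum A (fun _ => 1) φ t ^ j =
      expSum ((Fintype.piFinset fun _ : Fin j => A).image fun z => ∏ i, z i)
        (fun x => (((Fintype.piFinset fun _ : Fin j => A).filter
          fun z => ∏ i, z i = x).card : ℝ)) φ t := by
  have h1 : expSum A (fun _ => 1) φ t ^ j =
      ∏ _i : Fin j, ∑ a ∈ A, (fourier (φ a) t : ℂ) := by
    simp [expSum]
  rw [h1, prod_univ_sum]
  have hprod : ∀ z ∈ Fintype.piFinset (fun _ : Fin j => A),
      ∏ i, (fourier (φ (z i)) t : ℂ) = fourier (φ (∏ i, z i)) t := by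
    intro z hz
    rw [Fintype.mem_piFinset] at hz
    have hlog := intLog_prod hφ (univ.val.map z) (by
      intro x hx
      obtain ⟨i, _, rfl⟩ := Multiset.mem_map.1 hx
      exact hA _ (hz i))
    rw [Multiset.map_map] at hlog
    change φ (∏ i, z i) = ∑ i, φ (z i) at hlog
    rw [hlog]
    have : ∀ u : Finset (Fin j), ∏ i ∈ u, (fourier (φ (z i)) t : ℂ) =
        fourier (∑ i ∈ u, φ (z i)) t := by
      intro u
      induction u using Finset.induction_on with
      | empty => simp
      | insert i u hi ih => rw [prod_insert hi, sum_insert hi, ih, fourier_add]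
    exact this univ
  rw [sum_congr rfl hprod, expSum, ← sum_fiberwise_of_maps_to (g := fun z => ∏ i, z i)
    (t := (Fintype.piFinset fun _ : Fin j => A).image fun z => ∏ i, z i)
    (fun z hz => mem_image_of_mem _ hz)]
  refine sum_congr rfl fun x _ => ?_
  rw [sum_congr rfl fun z hz => by rw [(mem_filter.1 hz).2], sum_const, nsmul_eq_mul,
    Complex.ofReal_natCast]

theorem exists_dilate_card_ge {A : Finset ℕ} (hA : ∀ a ∈ A, a ≠ 0) {j : ℕ} (hj : j ≠ 0)
    (S : Finset ℕ) {η : ℝ} (h : η * (A.card : ℝ) ^ j ≤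
      ((Fintype.piFinset fun _ : Fin j => A).filter fun z => ∏ i, z i ∈ S).card)
    (hne : A.Nonempty) :
    ∃ t : ℕ, t ≠ 0 ∧ η * A.card ≤ (A.filter fun a => t * a ∈ S).card := by
  obtain ⟨j, rfl⟩ := Nat.exists_eq_succ_of_ne_zero hj
  by_contra hcon
  push Not at hcon
  have hcard : (((Fintype.piFinset fun _ : Fin (j + 1) => A).filter
      fun z => ∏ i, z i ∈ S).card : ℝ) =
      ∑ y ∈ Fintype.piFinset fun _ : Fin j => A, ((A.filter fun a => (∏ i, y i) * a ∈ S).card : ℝ) := by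
    rw [← Nat.cast_sum, ← card_sigma]
    congr 1
    refine card_nbij' (fun z => ⟨fun i => z i.succ, z 0⟩) (fun y => Fin.cons y.2 y.1) ?_ ?_ ?_ ?_
    · intro z hz
      obtain ⟨hz, hzS⟩ := mem_filter.1 hz
      rw [Fintype.mem_piFinset] at hz
      refine mem_sigma.2 ⟨Fintype.mem_piFinset.2 fun i => hz _, mem_filter.2 ⟨hz _, ?_⟩⟩
      rw [Fin.prod_univ_succ, mul_comm] at hzS
      exact hzS
    · rintro ⟨y, a⟩ hy
      obtain ⟨hy, ha⟩ := mem_sigma.1 hy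
      obtain ⟨ha, haS⟩ := mem_filter.1 ha
      rw [Fintype.mem_piFinset] at hy
      refine mem_filter.2 ⟨Fintype.mem_piFinset.2 fun i => ?_, ?_⟩
      · refine Fin.cases ?_ (fun i => ?_) i
        · simpa using ha
        · simpa using hy i
      · rw [Fin.prod_univ_succ, mul_comm]
        simpa using haS
    · intro z _
      exact Fin.cons_self_tail z
    · rintro ⟨y, a⟩ _
      simp
  rw [hcard] at h
  have hpi : (Fintype.piFinset fun _ : Fin j => A).Nonempty := by
    rw [Fintype.piFinset_nonempty]; exact fun _ => hne
  have hlt : ∑ y ∈ Fintype.piFinset fun _ : Fin j => A,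
      ((A.filter fun a => (∏ i, y i) * a ∈ S).card : ℝ) <
      ∑ y ∈ Fintype.piFinset fun _ : Fin j => A, η * A.card := by
    refine sum_lt_sum_of_nonempty hpi fun y hy => hcon _ ?_
    rw [Fintype.mem_piFinset] at hy
    exact prod_ne_zero_iff.2 fun i _ => hA _ (hy i)
  rw [sum_const, Fintype.card_piFinset, prod_const, card_univ, Fintype.card_fin, nsmul_eq_mul] at hlt
  push_cast at hlt
  rw [pow_succ] at h
  linarith

/-- If the moments of the exponential sum of `A` along an integer logarithm nearly stabilise, then
`A` has a large subset which is resolved by few valuation queries. -/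
theorem exists_query_of_moments {A : Finset ℕ} (hA : ∀ a ∈ A, a ≠ 0) (hne : A.Nonempty)
    {φ : ℕ → ℤ} (hφ : ∀ x y, x ≠ 0 → y ≠ 0 → φ (x * y) = φ x + φ y) {M B j : ℕ}
    (hinj : ∀ x y, x ≠ 0 → y ≠ 0 → x ≤ B → y ≤ B → φ x = φ y → x = y) (hM : ∀ a ∈ A, a ≤ M)
    (hMB : M ^ (2 * j) ≤ B) (hj : j ≠ 0)
    {P T K δ : ℝ} {q : ℕ} (hP : 2 ≤ P) (hT : 1 < T)
    (hTP : (1 + T) ^ (1 / P) ≤ 1 + (1 / 300000) ^ 3) (hδ : 0 < δ) (hK : 0 < K)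
    (hq : 64 / δ ^ 2 < T ^ (q + 1))
    (hE : δ ≤ circleMean fun t => (‖expSum A (fun _ => 1) φ t‖ / A.card) ^ (2 * (2 * j)))
    (hEK : (circleMean fun t => (‖expSum A (fun _ => 1) φ t‖ / A.card) ^ (2 * j)) ≤
      K * circleMean fun t => (‖expSum A (fun _ => 1) φ t‖ / A.card) ^ (2 * (2 * j))) :
    ∃ A' ⊆ A, Query primeVal q A' ∧ (8 * K) ^ (-(3 * P / 2)) * A.card ≤ A'.card := by
  set n := (A.card : ℝ) with hn
  have hn0 : 0 < n := by rw [hn]; exact_mod_cast hne.card_pos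
  set Pi := Fintype.piFinset fun _ : Fin j => A with hPi
  set X := Pi.image fun z => ∏ i, z i with hX
  set r : ℕ → ℝ := fun x => ((Pi.filter fun z => ∏ i, z i = x).card : ℝ) with hr
  set u : ℕ → ℝ := fun x => r x / n ^ j with hu
  have hPicard : (Pi.card : ℝ) = n ^ j := by
    rw [hPi, Fintype.card_piFinset, prod_const, card_univ, Fintype.card_fin]
    push_cast; rfl
  have hsumr : ∀ S ⊆ X, ∑ x ∈ S, r x = ((Pi.filter fun z => ∏ i, z i ∈ S).card : ℝ) := by
    intro S _
    have hmaps : Set.MapsTo (fun z : Fin j → ℕ => ∏ i, z i)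
        (Pi.filter fun z => ∏ i, z i ∈ S) S := fun z hz => (mem_filter.1 hz).2
    rw [← Nat.cast_sum, card_eq_sum_card_fiberwise hmaps, Nat.cast_inj]
    refine sum_congr rfl fun x hx => ?_
    congr 1
    ext z
    simp only [mem_filter]
    exact ⟨fun h => ⟨⟨h.1, h.2 ▸ hx⟩, h.2⟩, fun h => ⟨h.1.1, h.2⟩⟩
  have hu1 : ∑ x ∈ X, u x = 1 := by
    rw [← sum_div, hsumr X Subset.rfl, filter_true_of_mem fun z hz => mem_image_of_mem _ hz,
      hPicard, div_self (by positivity)]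
  have hnorm : ∀ t, ‖expSum X u φ t‖ = (‖expSum A (fun _ => 1) φ t‖ / n) ^ j := by
    intro t
    rw [div_pow, ← norm_pow, expSum_pow_eq hA hφ, hu, expSum_div, norm_div, Complex.norm_real,
      Real.norm_of_nonneg (by positivity)]
  have hXpos : ∀ x ∈ X, x ≠ 0 ∧ x ≤ M ^ j := by
    intro x hx
    obtain ⟨z, hz, rfl⟩ := mem_image.1 hx
    rw [Fintype.mem_piFinset] at hz
    refine ⟨prod_ne_zero_iff.2 fun i _ => hA _ (hz i), ?_⟩
    calc ∏ i, z i ≤ ∏ _i : Fin j, M := prod_le_prod' fun i _ => hM _ (hz i)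
      _ = M ^ j := by simp
  have hXX : ∀ x ∈ X, ∀ y ∈ X, x * y ≠ 0 ∧ x * y ≤ B := by
    intro x hx y hy
    refine ⟨mul_ne_zero (hXpos x hx).1 (hXpos y hy).1, le_trans ?_ hMB⟩
    rw [two_mul, pow_add]
    exact Nat.mul_le_mul (hXpos x hx).2 (hXpos y hy).2
  have hXB : ∀ x ∈ X, x ≤ B := fun x hx =>
    (Nat.le_mul_self x).trans (hXX x hx x hx).2
  have hφX : ∀ x ∈ X, ∀ y ∈ X, φ x = φ y → x = y := fun x hx y hy h =>
    hinj x y (hXpos x hx).1 (hXpos y hy).1 (hXB x hx) (hXB y hy) h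
  have hcompat : ∀ x ∈ X, ∀ y ∈ X, ∀ z ∈ X, ∀ w ∈ X, φ x + φ y = φ z + φ w →
      ∀ p, primeVal p x + primeVal p y = primeVal p z + primeVal p w := by
    intro x hx y hy z hz w hw h p
    rw [← hφ x y (hXpos x hx).1 (hXpos y hy).1, ← hφ z w (hXpos z hz).1 (hXpos w hw).1] at h
    have hxy := hXX x hx y hy
    have hzw := hXX z hz w hw
    have := hinj _ _ hxy.1 hzw.1 hxy.2 hzw.2 h
    rw [← primeVal_mul p (hXpos x hx).1 (hXpos y hy).1,
      ← primeVal_mul p (hXpos z hz).1 (hXpos w hw).1, this]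
  have h4 : (circleMean fun t => ‖expSum X u φ t‖ ^ 4) =
      circleMean fun t => (‖expSum A (fun _ => 1) φ t‖ / n) ^ (2 * (2 * j)) := by
    simp only [hnorm, ← pow_mul]
    congr 1; ext t; congr 1; ring
  have h2 : ∑ x ∈ X, u x ^ 2 =
      circleMean fun t => (‖expSum A (fun _ => 1) φ t‖ / n) ^ (2 * j) := by
    rw [← circleMean_sq_eq X u φ hφX]
    simp only [hnorm, ← pow_mul]
    congr 1; ext t; congr 1; ring
  have : Nonempty Nat.Primes := ⟨⟨2, Nat.prime_two⟩⟩
  obtain ⟨S, hSX, hSq, hS⟩ := exists_query_subset_of_measure (v := primeVal) hcompat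
    (fun x hx y hy h => eq_of_primeVal_eq (hXpos x hx).1 (hXpos y hy).1 h) hφX
    (fun x _ => by positivity) hu1 hP hT hTP hδ hK hq (by rw [h4]; exact hE)
    (by rw [h4, h2]; exact hEK)
  rw [← sum_div, hsumr S hSX, le_div_iff₀ (pow_pos hn0 j)] at hS
  obtain ⟨t, ht, htc⟩ := exists_dilate_card_ge hA hj S hS hne
  exact ⟨A.filter fun a => t * a ∈ S, filter_subset _ _,
    hSq.of_mul ht (fun a ha => hA a (mem_filter.1 ha).1) fun a ha => (mem_filter.1 ha).2, htc⟩

end ProductSets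

section Dichotomy

theorem norm_expSum_one_div_le {α : Type*} (A : Finset α) (φ : α → ℤ) (t : UnitAddCircle) :
    ‖expSum A (fun _ => 1) φ t‖ / A.card ≤ 1 := by
  refine div_le_one_of_le₀ ?_ (Nat.cast_nonneg _)
  simpa using norm_expSum_le A (fun _ => (1 : ℝ)) (fun _ _ => zero_le_one) φ t

theorem circleMean_normalized_anti {α : Type*} (A : Finset α) (φ : α → ℤ) {i j : ℕ} (hij : i ≤ j) :
    (circleMean fun t => (‖expSum A (fun _ => 1) φ t‖ / A.card) ^ j) ≤
      circleMean fun t => (‖expSum A (fun _ => 1) φ t‖ / A.card) ^ i := by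
  have hc := continuous_expSum A (fun _ => 1) φ
  refine circleMean_mono (by fun_prop) (by fun_prop) fun t => ?_
  exact pow_le_pow_of_le_one (by positivity) (norm_expSum_one_div_le A φ t) hij

theorem circleMean_normalized {α : Type*} (A : Finset α) (φ : α → ℤ) (j : ℕ) :
    (circleMean fun t => (‖expSum A (fun _ => 1) φ t‖ / A.card) ^ j) =
      (circleMean fun t => ‖expSum A (fun _ => 1) φ t‖ ^ j) / (A.card : ℝ) ^ j := by
  simp only [circleMean, div_pow]
  rw [MeasureTheory.integral_div]

/-- A small normalized moment gives a large `B_h` subset of the set of frequencies. -/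
theorem exists_isBhPlus_of_moment {α : Type*} {h M i : ℕ} (hh : h ≠ 0) (hi : i ≤ 2 * h)
    {A : Finset α} (hA : A.Nonempty) {φ : α → ℤ}
    (hφ : ∀ x ∈ A, ∀ y ∈ A, φ x = φ y → x = y) {Y : ℝ} (hY : 0 < Y)
    (hE : (circleMean fun t => (‖expSum A (fun _ => 1) φ t‖ / A.card) ^ i) * Y ^ (2 * h) ≤ 1)
    (hM : 4 * h * M ≤ Y) :
    ∃ B ⊆ A, IsBhPlus h (B.image φ) ∧ B.card = M := by
  classical
  set D := A.image φ with hD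
  have hcard : D.card = A.card := card_image_of_injOn fun x hx y hy => hφ x hx y hy
  have hn0 : (0 : ℝ) < A.card := by exact_mod_cast hA.card_pos
  have hexp : ∀ t, expSum D (fun _ => 1) id t = expSum A (fun _ => 1) φ t := by
    intro t
    rw [expSum, expSum, hD, sum_image fun x hx y hy => hφ x hx y hy]
    rfl
  have hpow : expNorm (2 * h) D (fun _ => 1) id ^ (2 * h) * Y ^ (2 * h) ≤
      (A.card : ℝ) ^ (2 * h) := by
    rw [expNorm_pow (by omega)]
    simp only [hexp]
    have h1 := circleMean_normalized_anti A φ hi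
    rw [circleMean_normalized A φ (2 * h)] at h1
    have h2 : (circleMean fun t => ‖expSum A (fun _ => 1) φ t‖ ^ (2 * h)) /
        (A.card : ℝ) ^ (2 * h) * Y ^ (2 * h) ≤ 1 :=
      (mul_le_mul_of_nonneg_right h1 (by positivity)).trans hE
    rwa [div_mul_eq_mul_div, div_le_one (by positivity)] at h2
  have hle : expNorm (2 * h) D (fun _ => 1) id * Y ≤ D.card := by
    rw [← mul_pow] at hpow
    rw [hcard]
    exact le_of_pow_le_pow_left₀ (by omega) (by positivity) hpow
  obtain ⟨B', hB', hBh, hBM⟩ := exists_isBhPlus hh (hA.image φ) hY hle hM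
  have him : (A.filter fun a => φ a ∈ B').image φ = B' := by
    ext x
    simp only [mem_image, mem_filter]
    constructor
    · rintro ⟨a, ⟨_, ha⟩, rfl⟩; exact ha
    · intro hx
      obtain ⟨a, ha, rfl⟩ := mem_image.1 (hB' hx)
      exact ⟨a, ⟨ha, hx⟩, rfl⟩
  refine ⟨A.filter fun a => φ a ∈ B', filter_subset _ _, by rwa [him], ?_⟩
  rw [← hBM, ← him, card_image_of_injOn]
  · rw [him]
  · intro x hx y hy
    exact hφ x (mem_filter.1 hx).1 y (mem_filter.1 hy).1

theorem isBhMul_of_isBhPlus_log {h : ℕ} {C : Finset ℕ} (hC : ∀ x ∈ C, x ≠ 0) {φ : ℕ → ℤ}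
    (hφ : ∀ x y, x ≠ 0 → y ≠ 0 → φ (x * y) = φ x + φ y)
    (hinj : ∀ x ∈ C, ∀ y ∈ C, φ x = φ y → x = y) (h' : IsBhPlus h (C.image φ)) :
    IsBhMul h (C.image fun x : ℕ => (x : ℤ)) := by
  intro s t hs ht hsC htC hst
  have key : ∀ s : Multiset ℤ, (∀ x ∈ s, x ∈ C.image fun x : ℕ => (x : ℤ)) →
      ∃ s' : Multiset ℕ, (∀ x ∈ s', x ∈ C) ∧ s = s'.map fun x : ℕ => (x : ℤ) := by
    intro s hs
    refine ⟨s.map Int.toNat, ?_, ?_⟩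
    · intro x hx
      obtain ⟨y, hy, rfl⟩ := Multiset.mem_map.1 hx
      obtain ⟨z, hz, rfl⟩ := mem_image.1 (hs y hy)
      simpa using hz
    · rw [Multiset.map_map]
      conv_lhs => rw [← Multiset.map_id s]
      refine Multiset.map_congr rfl fun y hy => ?_
      obtain ⟨z, hz, rfl⟩ := mem_image.1 (hs y hy)
      simp
  obtain ⟨s', hs', rfl⟩ := key s hsC
  obtain ⟨t', ht', rfl⟩ := key t htC
  rw [Multiset.card_map] at hs ht
  have hprod : s'.prod = t'.prod := by
    have e : ∀ u : Multiset ℕ, (u.map fun x : ℕ => (x : ℤ)).prod = (u.prod : ℤ) := fun u =>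
      (Nat.cast_multiset_prod u).symm
    rw [e, e] at hst
    exact_mod_cast hst
  have hmem : ∀ u : Multiset ℕ, (∀ x ∈ u, x ∈ C) → ∀ x ∈ u.map φ, x ∈ C.image φ := by
    intro u hu x hx
    obtain ⟨y, hy, rfl⟩ := Multiset.mem_map.1 hx
    exact mem_image_of_mem _ (hu y hy)
  have hmap : s'.map φ = t'.map φ := by
    refine h' _ _ (by simpa using hs) (by simpa using ht) (hmem s' hs') (hmem t' ht') ?_
    rw [← intLog_prod hφ s' fun x hx => hC x (hs' x hx),
      ← intLog_prod hφ t' fun x hx => hC x (ht' x hx), hprod]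
  have hst' : s' = t' := by
    classical
    have hinv : ∀ u : Multiset ℕ, (∀ x ∈ u, x ∈ C) →
        (u.map φ).map (Function.invFunOn φ (C : Set ℕ)) = u := by
      intro u hu
      rw [Multiset.map_map]
      conv_rhs => rw [← Multiset.map_id u]
      refine Multiset.map_congr rfl fun x hx => ?_
      have hex : ∃ a ∈ (C : Set ℕ), φ a = φ x := ⟨x, hu x hx, rfl⟩
      exact hinj _ (Function.invFunOn_mem hex) x (hu x hx) (Function.invFunOn_eq hex)
    rw [← hinv s' hs', hmap, hinv t' ht']
  rw [hst']

/-- Sets resolved by few queries contain large `B_h` sets. -/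
theorem Query.exists_isBhPlus {h k M q : ℕ} (hk : k ≠ 0) (hkh : k ≤ h) {A : Finset ℕ}
    (hA : ∀ x ∈ A, x ≠ 0) (hne : A.Nonempty) (hq : Query primeVal q A)
    (hM : 4 * h * M ≤ ((A.card : ℝ) / (4 * k ^ 2) ^ q) ^ ((k : ℝ) / (2 * h))) :
    ∃ B ⊆ A, IsBhPlus h (B.image fun x : ℕ => (x : ℤ)) ∧ B.card = M := by
  have hh : h ≠ 0 := by omega
  have hn0 : (0 : ℝ) < A.card := by exact_mod_cast hne.card_pos
  have hk0 : (0 : ℝ) < k := by positivity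
  have hb := hq.expNorm_sq_le hk hA
  refine exists_isBhPlus_of_moment (i := 2 * k) hh (by omega) hne
    (fun x _ y _ hxy => by exact_mod_cast hxy) (by positivity) ?_ hM
  rw [circleMean_normalized, ← expNorm_pow (by omega), pow_mul]
  have hYp : (((A.card : ℝ) / (4 * k ^ 2) ^ q) ^ ((k : ℝ) / (2 * h))) ^ (2 * h) =
      ((A.card : ℝ) / (4 * k ^ 2) ^ q) ^ k := by
    have hh' : (h : ℝ) ≠ 0 := by exact_mod_cast hh
    rw [← Real.rpow_natCast _ (2 * h), ← Real.rpow_mul (by positivity),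
      show (k : ℝ) / (2 * h) * ((2 * h : ℕ) : ℝ) = k by push_cast; field_simp, Real.rpow_natCast]
  rw [hYp]
  calc _ ≤ ((4 * k ^ 2 : ℝ) ^ q * A.card) ^ k / (A.card : ℝ) ^ (2 * k) *
        ((A.card : ℝ) / (4 * k ^ 2) ^ q) ^ k := by gcongr
    _ = 1 := by
        rw [div_pow, mul_pow, pow_mul]
        field_simp
        ring

end Dichotomy

section Growth

/-- If `a 0 < K ^ m * a m`, some consecutive ratio `a i / a (i + 1)` with `i < m` is at most `K`. -/
theorem exists_consecutive_ratio_le {a : ℕ → ℝ} {m : ℕ} {K : ℝ} (hK : 0 < K)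
    (h0 : a 0 < K ^ m * a m) : ∃ i < m, a i ≤ K * a (i + 1) := by
  by_contra! hcon
  have : ∀ i ≤ m, K ^ i * a i ≤ a 0 := by
    intro i
    induction i with
    | zero => simp
    | succ i ih =>
      intro hi
      refine le_trans ?_ (ih (by omega))
      rw [pow_succ, mul_assoc]
      exact mul_le_mul_of_nonneg_left (hcon i (by omega)).le (by positivity)
  exact absurd (this m le_rfl) (not_le.2 h0)

set_option maxHeartbeats 1000000 in
theorem exists_isBhPlus_or_isBhMul {h m k R : ℕ} {b P : ℝ} (hm : m ≠ 0) (hmh : 2 ^ m ≤ h)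
    (hb : 0 < b) (hbk : 4 * b ≤ k) (hkh : k ≤ h) (hbR : 16 * b ≤ R) (hP : 2 ≤ P)
    (hTP : (1 + (4 * (k : ℝ) ^ 2) ^ R) ^ (1 / P) ≤ 1 + (1 / 300000) ^ 3)
    (hbP : 12 * b * P ≤ m) :
    ∃ c : ℝ, 0 < c ∧ ∀ A : Finset ℕ, (∀ x ∈ A, x ≠ 0) → A.Nonempty → ∀ M : ℕ,
      M ≤ c * (A.card : ℝ) ^ (b / h) →
      (∃ B ⊆ A, IsBhPlus h (B.image fun x : ℕ => (x : ℤ)) ∧ B.card = M) ∨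
      (∃ C ⊆ A, IsBhMul h (C.image fun x : ℕ => (x : ℤ)) ∧ C.card = M) := by
  have hh : h ≠ 0 := by have := Nat.one_le_two_pow (n := m); omega
  have hh' : (0 : ℝ) < h := by positivity
  have hk' : (0 : ℝ) < k := by linarith
  have hk0 : k ≠ 0 := by exact_mod_cast hk'.ne'
  have hk1 : (1 : ℝ) ≤ k := by exact_mod_cast Nat.one_le_iff_ne_zero.2 hk0
  have hR' : (0 : ℝ) < R := by linarith
  have hR0 : R ≠ 0 := by exact_mod_cast hR'.ne'
  have hm' : (0 : ℝ) < m := by positivity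
  set c₁ : ℝ := (8 : ℝ) ^ (-(3 * P / 2)) / 64 with hc₁
  have hc₁0 : 0 < c₁ := by positivity
  have hc₁1 : c₁ ≤ 1 := by
    have : (8 : ℝ) ^ (-(3 * P / 2)) ≤ 1 :=
      Real.rpow_le_one_of_one_le_of_nonpos (by norm_num) (by linarith)
    rw [hc₁]; linarith
  have hcp1 : c₁ ^ ((k : ℝ) / (2 * h)) ≤ 1 := Real.rpow_le_one hc₁0.le hc₁1 (by positivity)
  refine ⟨c₁ ^ ((k : ℝ) / (2 * h)) / (4 * h), by positivity, fun A hA hne M hM => ?_⟩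
  have hn0 : (0 : ℝ) < A.card := by exact_mod_cast hne.card_pos
  have hn1 : (1 : ℝ) ≤ A.card := by exact_mod_cast hne.card_pos
  set n : ℝ := (A.card : ℝ) with hn
  have hM' : 4 * h * (M : ℝ) ≤ c₁ ^ ((k : ℝ) / (2 * h)) * n ^ (b / h) := by
    calc 4 * h * (M : ℝ) ≤ 4 * h * (c₁ ^ ((k : ℝ) / (2 * h)) / (4 * h) * n ^ (b / h)) := by gcongr
      _ = _ := by field_simp
  obtain ⟨X, hX⟩ : ∃ X, ∀ a ∈ A, a ≤ X := ⟨A.sup id, fun a ha => le_sup (f := id) ha⟩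
  obtain ⟨φ, hφ, hinj⟩ := exists_int_log (X ^ (2 * 2 ^ m) + X)
  have hinjA : ∀ x ∈ A, ∀ y ∈ A, φ x = φ y → x = y := fun x hx y hy =>
    hinj x y (hA x hx) (hA y hy) ((hX x hx).trans (Nat.le_add_left _ _))
      ((hX y hy).trans (Nat.le_add_left _ _))
  set a : ℕ → ℝ := fun i =>
    circleMean fun t => (‖expSum A (fun _ => 1) φ t‖ / n) ^ (2 * 2 ^ i) with ha
  have ha_anti : ∀ i j, i ≤ j → a j ≤ a i := fun i j hij =>
    circleMean_normalized_anti A φ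
      (Nat.mul_le_mul_left 2 (Nat.pow_le_pow_right (by norm_num) hij))
  have ha0 : a 0 ≤ 1 := by
    have := circleMean_normalized_anti A φ (Nat.zero_le (2 * 2 ^ 0))
    refine this.trans ?_
    simp [circleMean_const]
  by_cases hcase : a m ≤ n ^ (-(2 * b))
  · right
    obtain ⟨C, hCA, hC, hCM⟩ := exists_isBhPlus_of_moment (h := h) (M := M) (i := 2 * 2 ^ m)
      hh (by omega) hne hinjA (Y := n ^ (b / h)) (by positivity) (by
        have e : (n ^ (b / h)) ^ (2 * h) = n ^ (2 * b) := by
          rw [← Real.rpow_natCast _ (2 * h), ← Real.rpow_mul hn0.le]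
          congr 1
          push_cast
          field_simp
        rw [e]
        calc _ ≤ n ^ (-(2 * b)) * n ^ (2 * b) := by
              exact mul_le_mul_of_nonneg_right hcase (by positivity)
          _ = 1 := by rw [← Real.rpow_add hn0]; simp)
      (hM'.trans (mul_le_of_le_one_left (by positivity) hcp1))
    exact ⟨C, hCA, isBhMul_of_isBhPlus_log (fun x hx => hA x (hCA hx)) hφ
      (fun x hx y hy => hinjA x (hCA hx) y (hCA hy)) hC, hCM⟩
  · left
    push Not at hcase
    set δ : ℝ := n ^ (-(2 * b)) with hδ
    have hδ0 : 0 < δ := by positivity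
    set K : ℝ := n ^ (2 * b / m) with hK
    have hK0 : 0 < K := by positivity
    obtain ⟨i, him, hi⟩ := exists_consecutive_ratio_le (a := a) (m := m) hK0 (by
      have e : K ^ m * δ = 1 := by
        rw [hK, hδ, ← Real.rpow_natCast _ m, ← Real.rpow_mul hn0.le, ← Real.rpow_add hn0]
        rw [div_mul_cancel₀ _ hm'.ne', add_neg_cancel, Real.rpow_zero]
      calc a 0 ≤ 1 := ha0
        _ = K ^ m * δ := e.symm
        _ < _ := by gcongr)
    set T : ℝ := (4 * (k : ℝ) ^ 2) ^ R with hT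
    have hk2 : 4 ≤ 4 * (k : ℝ) ^ 2 := by nlinarith
    have hT1 : 1 < T := one_lt_pow₀ (by linarith) hR0
    have hδ2 : 64 / δ ^ 2 = 64 * n ^ (4 * b) := by
      rw [hδ, ← Real.rpow_natCast _ 2, ← Real.rpow_mul hn0.le, div_eq_mul_inv,
        ← Real.rpow_neg hn0.le]
      congr 2
      push_cast
      ring
    have hn4 : 1 ≤ n ^ (4 * b) := Real.one_le_rpow hn1 (by positivity)
    obtain ⟨q, hq1, hq2⟩ := exists_nat_pow_near (x := 64 / δ ^ 2) (by rw [hδ2]; linarith) hT1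
    have hpow2 : 2 * 2 ^ (i + 1) = 2 * (2 * 2 ^ i) := by ring
    have hE : δ ≤ circleMean fun t => (‖expSum A (fun _ => 1) φ t‖ / A.card) ^ (2 * (2 * 2 ^ i)) := by
      rw [← hpow2]
      exact hcase.le.trans (ha_anti _ _ (by omega))
    have hXB : X ^ (2 * 2 ^ i) ≤ X ^ (2 * 2 ^ m) + X := by
      obtain ⟨x, hx⟩ := hne
      have hX0 : 0 < X := (Nat.pos_of_ne_zero (hA x hx)).trans_le (hX x hx)
      exact (Nat.pow_le_pow_right hX0
        (Nat.mul_le_mul_left 2 (Nat.pow_le_pow_right (by norm_num) him.le))).trans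
        (Nat.le_add_right _ _)
    obtain ⟨A', hA'A, hQ, hA'c⟩ := exists_query_of_moments hA hne hφ hinj hX hXB
      (by positivity) hP hT1 hTP hδ0 hK0 hq2 hE (by rw [← hpow2]; exact hi)
    have hA'low : 8 ^ (-(3 * P / 2)) * n ^ (3 / 4 : ℝ) ≤ A'.card := by
      refine le_trans ?_ hA'c
      rw [Real.mul_rpow (by norm_num) hK0.le, mul_assoc]
      gcongr
      rw [hK, ← Real.rpow_mul hn0.le, ← hn, ← Real.rpow_add_one hn0.ne']
      apply Real.rpow_le_rpow_of_exponent_le hn1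
      have : 2 * b / m * (3 * P / 2) ≤ 1 / 4 := by
        rw [div_mul_eq_mul_div, div_le_iff₀ hm']
        linarith
      linarith
    have hA'0 : (0 : ℝ) < A'.card := lt_of_lt_of_le (by positivity) hA'low
    have hqup : (4 * (k : ℝ) ^ 2) ^ q ≤ 64 * n ^ (1 / 4 : ℝ) := by
      have h1 : ((4 * (k : ℝ) ^ 2) ^ q) ^ R ≤ (64 * n ^ (1 / 4 : ℝ)) ^ R := by
        rw [← pow_mul, mul_comm q R, pow_mul, ← hT, mul_pow]
        refine hq1.trans ?_
        rw [hδ2, ← Real.rpow_natCast _ R, ← Real.rpow_natCast (n ^ _) R, ← Real.rpow_mul hn0.le]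
        refine mul_le_mul ?_ (Real.rpow_le_rpow_of_exponent_le hn1 (by linarith))
          (by positivity) (by positivity)
        rw [Real.rpow_natCast]
        exact le_self_pow₀ (by norm_num) hR0
      exact le_of_pow_le_pow_left₀ hR0 (by positivity) h1
    have hratio : c₁ * n ^ (1 / 2 : ℝ) ≤ (A'.card : ℝ) / (4 * k ^ 2) ^ q := by
      rw [le_div_iff₀ (by positivity)]
      calc c₁ * n ^ (1 / 2 : ℝ) * (4 * (k : ℝ) ^ 2) ^ q
          ≤ c₁ * n ^ (1 / 2 : ℝ) * (64 * n ^ (1 / 4 : ℝ)) := by gcongr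
        _ = 8 ^ (-(3 * P / 2)) * (n ^ (1 / 2 : ℝ) * n ^ (1 / 4 : ℝ)) := by rw [hc₁]; ring
        _ = 8 ^ (-(3 * P / 2)) * n ^ (3 / 4 : ℝ) := by rw [← Real.rpow_add hn0]; norm_num
        _ ≤ _ := hA'low
    obtain ⟨B, hB, hBh, hBM⟩ := Query.exists_isBhPlus (M := M) hk0 hkh
      (fun x hx => hA x (hA'A hx)) (card_pos.1 (by exact_mod_cast hA'0)) hQ (by
        refine hM'.trans ?_
        calc _ ≤ c₁ ^ ((k : ℝ) / (2 * h)) * (n ^ (1 / 2 : ℝ)) ^ ((k : ℝ) / (2 * h)) := by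
              rw [← Real.rpow_mul hn0.le]
              gcongr
              · rw [div_mul_div_comm, div_le_div_iff₀ (by positivity) (by positivity)]
                calc b * (2 * (2 * h)) = 4 * b * h := by ring
                  _ ≤ k * h := by gcongr
                  _ = _ := by ring
          _ = (c₁ * n ^ (1 / 2 : ℝ)) ^ ((k : ℝ) / (2 * h)) :=
              (Real.mul_rpow hc₁0.le (by positivity)).symm
          _ ≤ _ := by gcongr)
    exact ⟨B, hB.trans hA'A, hBh, hBM⟩

end Growth

section Parameters

open Filter in
/-- For large `h` the hypotheses of `exists_isBhPlus_or_isBhMul` can be met with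
`b = (log h) ^ (1 / 2 - ε)`. -/
theorem exists_parameters {ε : ℝ} (hε : 0 < ε) (hε' : ε < 1 / 2) :
    ∃ h₀ : ℕ, ∀ h ≥ h₀, ∃ m k R : ℕ, ∃ P : ℝ, m ≠ 0 ∧ 2 ^ m ≤ h ∧
      0 < (Real.logb 2 h) ^ ((1 : ℝ) / 2 - ε) ∧
      4 * (Real.logb 2 h) ^ ((1 : ℝ) / 2 - ε) ≤ k ∧ k ≤ h ∧
      16 * (Real.logb 2 h) ^ ((1 : ℝ) / 2 - ε) ≤ R ∧ 2 ≤ P ∧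
      (1 + (4 * (k : ℝ) ^ 2) ^ R) ^ (1 / P) ≤ 1 + (1 / 300000) ^ 3 ∧
      12 * (Real.logb 2 h) ^ ((1 : ℝ) / 2 - ε) * P ≤ m := by
  set κ : ℝ := Real.log (1 + (1 / 300000) ^ 3) with hκ
  have hκ0 : 0 < κ := Real.log_pos (by norm_num)
  have hκ1 : κ ≤ 1 := by
    have := Real.log_le_sub_one_of_pos (x := 1 + (1 / 300000) ^ 3) (by norm_num)
    refine this.trans (by norm_num)
  set C : ℝ := 12 * (2 * (1800 / ε) / κ) with hC
  have hC0 : 0 < C := by positivity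
  have hlim : Tendsto (fun h : ℕ => Real.logb 2 (h : ℝ)) atTop atTop :=
    (Real.tendsto_logb_atTop (by norm_num)).comp tendsto_natCast_atTop_atTop
  have hlim' : Tendsto (fun h : ℕ => Real.logb 2 (h : ℝ) ^ ε) atTop atTop :=
    (tendsto_rpow_atTop hε).comp hlim
  obtain ⟨h₀, hh₀⟩ := eventually_atTop.1 ((hlim.eventually_ge_atTop 2).and
    ((hlim'.eventually_ge_atTop (2 * C)).and (eventually_ge_atTop 1)))
  refine ⟨h₀, fun h hh => ?_⟩
  obtain ⟨hL2, hLε, hh1⟩ := hh₀ h hh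
  set L := Real.logb 2 (h : ℝ) with hL
  set b := L ^ ((1 : ℝ) / 2 - ε) with hb
  have hL0 : 0 < L := by linarith
  have hb1 : 1 ≤ b := Real.one_le_rpow (by linarith) (by linarith)
  have hb0 : 0 < b := by linarith
  have hmL : L - 1 ≤ Nat.log 2 h := by
    have h1 : (h : ℝ) < 2 ^ ((Nat.log 2 h : ℝ) + 1) := by
      exact_mod_cast Nat.lt_pow_succ_log_self (b := 2) (by norm_num) h
    have h2 := (Real.logb_lt_iff_lt_rpow (b := 2) (by norm_num) (by exact_mod_cast hh1)).2 h1
    linarith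
  have hmh : 2 ^ Nat.log 2 h ≤ h := Nat.pow_log_le_self 2 (by omega)
  set k := ⌈4 * b⌉₊ with hk
  set R := ⌈16 * b⌉₊ with hR
  have hk4 : 4 * b ≤ k := Nat.le_ceil _
  have hR16 : 16 * b ≤ R := Nat.le_ceil _
  have hk5 : (k : ℝ) ≤ 5 * b := by
    have := Nat.ceil_lt_add_one (a := 4 * b) (by positivity)
    linarith
  have hR17 : (R : ℝ) ≤ 17 * b := by
    have := Nat.ceil_lt_add_one (a := 16 * b) (by positivity)
    linarith
  set T : ℝ := (4 * (k : ℝ) ^ 2) ^ R with hT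
  have hk0 : (4 : ℝ) ≤ k := by linarith
  have hT4 : 4 ≤ T := by
    have hR0 : R ≠ 0 := by
      have : (0 : ℝ) < R := by linarith
      exact_mod_cast this.ne'
    refine le_trans ?_ (le_self_pow₀ (by nlinarith) hR0)
    nlinarith
  have hlogT1 : 1 ≤ Real.log (1 + T) := by
    rw [Real.le_log_iff_exp_le (by linarith)]
    have := Real.exp_one_lt_d9
    linarith
  have hlogb : 1 ≤ Real.log (100 * b ^ 2) := by
    rw [Real.le_log_iff_exp_le (by positivity)]
    have := Real.exp_one_lt_d9
    nlinarith
  have hlogT : Real.log (1 + T) ≤ 1800 / ε * b ^ (1 + 2 * ε) := by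
    have h1 : Real.log (1 + T) ≤ Real.log (2 * (100 * b ^ 2) ^ R) := by
      apply Real.log_le_log (by linarith)
      have : T ≤ (100 * b ^ 2) ^ R := by
        refine pow_le_pow_left₀ (by positivity) ?_ R
        nlinarith
      linarith
    rw [Real.log_mul (by norm_num) (by positivity), Real.log_pow] at h1
    have h2 : Real.log 2 ≤ b * Real.log (100 * b ^ 2) := by
      have := Real.log_two_lt_d9
      nlinarith
    have h3 : Real.log (100 * b ^ 2) ≤ 100 / ε * b ^ (2 * ε) := by
      refine (Real.log_le_rpow_div (by positivity) hε).trans ?_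
      rw [Real.mul_rpow (by norm_num) (by positivity), ← Real.rpow_natCast b 2,
        ← Real.rpow_mul hb0.le, div_mul_eq_mul_div]
      push_cast
      gcongr
      calc (100 : ℝ) ^ ε ≤ 100 ^ (1 : ℝ) := by gcongr <;> linarith
        _ = 100 := Real.rpow_one _
    calc Real.log (1 + T) ≤ 18 * b * Real.log (100 * b ^ 2) := by nlinarith
      _ ≤ 18 * b * (100 / ε * b ^ (2 * ε)) := by gcongr
      _ = 1800 / ε * (b ^ (1 : ℝ) * b ^ (2 * ε)) := by rw [Real.rpow_one]; ring
      _ = _ := by rw [← Real.rpow_add hb0]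
  set P : ℝ := 2 * Real.log (1 + T) / κ with hP
  have hP2 : 2 ≤ P := by
    rw [hP, le_div_iff₀ hκ0]
    nlinarith
  have hbP : 12 * b * P ≤ Nat.log 2 h := by
    have hbL : b * b ^ (1 + 2 * ε) ≤ L ^ (1 - ε) := by
      nth_rewrite 1 [← Real.rpow_one b]
      rw [← Real.rpow_add hb0, hb, ← Real.rpow_mul hL0.le]
      apply Real.rpow_le_rpow_of_exponent_le (by linarith)
      nlinarith
    calc 12 * b * P ≤ 12 * b * (2 * (1800 / ε * b ^ (1 + 2 * ε)) / κ) := by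
          rw [hP]; gcongr
      _ = C * (b * b ^ (1 + 2 * ε)) := by rw [hC]; ring
      _ ≤ C * L ^ (1 - ε) := by gcongr
      _ ≤ L ^ ε / 2 * L ^ (1 - ε) := by gcongr; linarith
      _ = L / 2 := by
          rw [div_mul_eq_mul_div, ← Real.rpow_add hL0, add_sub_cancel, Real.rpow_one]
      _ ≤ L - 1 := by linarith
      _ ≤ _ := hmL
  refine ⟨Nat.log 2 h, k, R, P, ?_, hmh, hb0, hk4, ?_, hR16, hP2, ?_, hbP⟩
  · have : (0 : ℝ) < Nat.log 2 h := by linarith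
    exact_mod_cast this.ne'
  · have h1 : (k : ℝ) ≤ Nat.log 2 h := by
      have : b * 2 ≤ b * P := by gcongr
      linarith
    have h2 : k ≤ Nat.log 2 h := by exact_mod_cast h1
    exact h2.trans (Nat.lt_two_pow_self.le.trans hmh)
  · rw [← Real.log_le_log_iff (by positivity) (by positivity), Real.log_rpow (by positivity),
      ← hκ, hP, one_div_div, div_mul_eq_mul_div, div_le_iff₀ (by linarith)]
    linarith [mul_pos hκ0 (zero_lt_one.trans_le hlogT1)]

end Parameters

section Integers

theorem IsBhPlus.image_sign {h : ℕ} {s : ℤ} (hs : s * s = 1) {B : Finset ℤ} (hB : IsBhPlus h B) :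
    IsBhPlus h (B.image (s * ·)) := by
  have hinv : ∀ u : Multiset ℤ, (u.map (s * ·)).map (s * ·) = u := fun u => by
    simp [Multiset.map_map, ← mul_assoc, hs]
  have hmem : ∀ u : Multiset ℤ, (∀ x ∈ u, x ∈ B.image (s * ·)) →
      ∀ x ∈ u.map (s * ·), x ∈ B := by
    intro u hu x hx
    obtain ⟨y, hy, rfl⟩ := Multiset.mem_map.1 hx
    obtain ⟨z, hz, rfl⟩ := mem_image.1 (hu y hy)
    simpa [← mul_assoc, hs] using hz
  intro u v hu hv huB hvB huv
  rw [← hinv u, ← hinv v, hB (u.map (s * ·)) (v.map (s * ·)) (by simpa using hu)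
    (by simpa using hv) (hmem u huB) (hmem v hvB)
    (by rw [Multiset.sum_map_mul_left, Multiset.sum_map_mul_left]; simp [huv])]

theorem IsBhMul.image_sign {h : ℕ} {s : ℤ} (hs : s * s = 1) {B : Finset ℤ} (hB : IsBhMul h B) :
    IsBhMul h (B.image (s * ·)) := by
  have hinv : ∀ u : Multiset ℤ, (u.map (s * ·)).map (s * ·) = u := fun u => by
    simp [Multiset.map_map, ← mul_assoc, hs]
  have hmem : ∀ u : Multiset ℤ, (∀ x ∈ u, x ∈ B.image (s * ·)) →
      ∀ x ∈ u.map (s * ·), x ∈ B := by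
    intro u hu x hx
    obtain ⟨y, hy, rfl⟩ := Multiset.mem_map.1 hx
    obtain ⟨z, hz, rfl⟩ := mem_image.1 (hu y hy)
    simpa [← mul_assoc, hs] using hz
  intro u v hu hv huB hvB huv
  rw [← hinv u, ← hinv v, hB (u.map (s * ·)) (v.map (s * ·)) (by simpa using hu)
    (by simpa using hv) (hmem u huB) (hmem v hvB)
    (by rw [Multiset.prod_map_mul, Multiset.prod_map_mul]; simp [huv, hu, hv])]

theorem exists_nat_subset_of_int {A : Finset ℤ} (hA : 2 ≤ A.card) :
    ∃ s : ℤ, s * s = 1 ∧ ∃ D : Finset ℕ, (∀ x ∈ D, x ≠ 0) ∧ D.Nonempty ∧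
      A.card ≤ 4 * D.card ∧ ∀ x ∈ D, s * (x : ℤ) ∈ A := by
  have hpart : A.card ≤ (A.filter (0 < ·)).card + (A.filter (· < 0)).card + 1 := by
    calc A.card ≤ (A.filter (0 < ·) ∪ A.filter (· < 0) ∪ {0}).card := by
          refine card_le_card fun x hx => ?_
          simp only [mem_union, mem_filter, mem_singleton]
          rcases lt_trichotomy x 0 with h | h | h <;> simp [*]
      _ ≤ _ := (card_union_le _ _).trans (by
          simpa using card_union_le (A.filter (0 < ·)) (A.filter (· < 0)))
  have key : ∀ s : ℤ, s * s = 1 → ∀ E ⊆ A, (∀ x ∈ E, 0 < s * x) → A.card ≤ 2 * E.card + 1 →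
      ∃ s : ℤ, s * s = 1 ∧ ∃ D : Finset ℕ, (∀ x ∈ D, x ≠ 0) ∧ D.Nonempty ∧
      A.card ≤ 4 * D.card ∧ ∀ x ∈ D, s * (x : ℤ) ∈ A := by
    intro s hs E hE hpos hcard
    have hback : ∀ x ∈ E, s * ((s * x).toNat : ℤ) = x := fun x hx => by
      rw [Int.toNat_of_nonneg (hpos x hx).le, ← mul_assoc, hs, one_mul]
    have hD : (E.image fun x => (s * x).toNat).card = E.card := by
      refine card_image_of_injOn fun x hx y hy hxy => ?_
      rw [← hback x hx, ← hback y hy]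
      exact congrArg (fun z : ℕ => s * (z : ℤ)) hxy
    refine ⟨s, hs, E.image fun x => (s * x).toNat, ?_, card_pos.1 (by omega), by omega, ?_⟩
    · intro x hx
      obtain ⟨y, hy, rfl⟩ := mem_image.1 hx
      have := hpos y hy
      omega
    · intro x hx
      obtain ⟨y, hy, rfl⟩ := mem_image.1 hx
      rw [hback y hy]
      exact hE hy
  rcases le_total (A.filter (0 < ·)).card (A.filter (· < 0)).card with hle | hle
  · exact key (-1) (by norm_num) (A.filter (· < 0)) (filter_subset _ _)
      (fun x hx => by have := (mem_filter.1 hx).2; linarith) (by omega)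
  · exact key 1 (by norm_num) (A.filter (0 < ·)) (filter_subset _ _)
      (fun x hx => by have := (mem_filter.1 hx).2; linarith) (by omega)

theorem isBhPlus_singleton (h : ℕ) (x : ℤ) : IsBhPlus h {x} := by
  intro s t hs ht hsx htx _
  rw [Multiset.eq_replicate.2 ⟨hs, fun y hy => mem_singleton.1 (hsx y hy)⟩,
    Multiset.eq_replicate.2 ⟨ht, fun y hy => mem_singleton.1 (htx y hy)⟩]

theorem sum_mem_nFold {A : Finset ℤ} (s : Multiset ℤ) (hs : ∀ x ∈ s, x ∈ A) :
    s.sum ∈ nFold A (Multiset.card s) := by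
  induction s using Multiset.induction_on with
  | empty => simp [nFold]
  | cons a s ih =>
    rw [Multiset.sum_cons, Multiset.card_cons, nFold, add_comm a]
    exact add_mem_add (ih fun x hx => hs x (Multiset.mem_cons_of_mem hx))
      (hs a (Multiset.mem_cons_self a s))

theorem prod_mem_nFoldMul {A : Finset ℤ} (s : Multiset ℤ) (hs : ∀ x ∈ s, x ∈ A) :
    s.prod ∈ nFoldMul A (Multiset.card s) := by
  induction s using Multiset.induction_on with
  | empty => simp [nFoldMul]
  | cons a s ih =>
    rw [Multiset.prod_cons, Multiset.card_cons, nFoldMul, mul_comm a]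
    exact mul_mem_mul (ih fun x hx => hs x (Multiset.mem_cons_of_mem hx))
      (hs a (Multiset.mem_cons_self a s))

theorem pow_card_le_factorial_mul_card_sym (B : Finset ℤ) (h : ℕ) :
    (B.card : ℝ) ^ h ≤ h.factorial * (B.sym h).card := by
  have hcard : (B.card + h - 1).choose h ≤ (B.sym h).card := by
    rw [← Nat.multichoose_eq, ← Fintype.card_coe B, ← Sym.card_sym_eq_multichoose, ← card_univ]
    refine card_le_card_of_injOn (Sym.map Subtype.val) (fun s _ => ?_)
      (Sym.map_injective Subtype.val_injective h).injOn
    rw [mem_coe, mem_sym_iff]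
    intro a ha
    obtain ⟨x, _, rfl⟩ := Sym.mem_map.1 ha
    exact x.2
  refine le_trans ?_ (mul_le_mul_of_nonneg_left (Nat.cast_le.2 hcard) (Nat.cast_nonneg _))
  rcases Nat.eq_zero_or_pos h with rfl | hh
  · simp
  have := Nat.pow_le_choose (α := ℝ) h (B.card + h - 1)
  rw [show B.card + h - 1 + 1 - h = B.card by omega] at this
  rwa [div_le_iff₀' (by positivity)] at this

theorem IsBhPlus.pow_card_le {h : ℕ} {A B : Finset ℤ} (hB : IsBhPlus h B) (hBA : B ⊆ A) :
    (B.card : ℝ) ^ h ≤ h.factorial * (nFold A h).card := by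
  refine (pow_card_le_factorial_mul_card_sym B h).trans ?_
  gcongr
  refine card_le_card_of_injOn (fun s : Sym ℤ h => (s : Multiset ℤ).sum) ?_ ?_
  · intro s hs
    have := sum_mem_nFold (A := A) (s : Multiset ℤ) fun x hx => hBA (mem_sym_iff.1 hs x hx)
    rwa [Sym.card_coe] at this
  · intro s hs t ht hst
    exact Subtype.ext (hB s t s.2 t.2 (fun x hx => mem_sym_iff.1 hs x hx)
      (fun x hx => mem_sym_iff.1 ht x hx) hst)

theorem IsBhMul.pow_card_le {h : ℕ} {A B : Finset ℤ} (hB : IsBhMul h B) (hBA : B ⊆ A) :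
    (B.card : ℝ) ^ h ≤ h.factorial * (nFoldMul A h).card := by
  refine (pow_card_le_factorial_mul_card_sym B h).trans ?_
  gcongr
  refine card_le_card_of_injOn (fun s : Sym ℤ h => (s : Multiset ℤ).prod) ?_ ?_
  · intro s hs
    have := prod_mem_nFoldMul (A := A) (s : Multiset ℤ) fun x hx => hBA (mem_sym_iff.1 hs x hx)
    rwa [Sym.card_coe] at this
  · intro s hs t ht hst
    exact Subtype.ext (hB s t s.2 t.2 (fun x hx => mem_sym_iff.1 hs x hx)
      (fun x hx => mem_sym_iff.1 ht x hx) hst)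

/-- Every finite set of integers contains a large `B_h` set, additive or multiplicative. -/
theorem exists_large_isBhPlus_or_isBhMul {h m k R : ℕ} {b P : ℝ} (hm : m ≠ 0) (hmh : 2 ^ m ≤ h)
    (hb : 0 < b) (hbk : 4 * b ≤ k) (hkh : k ≤ h) (hbR : 16 * b ≤ R) (hP : 2 ≤ P)
    (hTP : (1 + (4 * (k : ℝ) ^ 2) ^ R) ^ (1 / P) ≤ 1 + (1 / 300000) ^ 3)
    (hbP : 12 * b * P ≤ m) :
    ∃ c : ℝ, 0 < c ∧ ∀ A : Finset ℤ, 2 ≤ A.card →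
      (∃ B ⊆ A, IsBhPlus h B ∧ c * (A.card : ℝ) ^ (b / h) ≤ B.card) ∨
      (∃ C ⊆ A, IsBhMul h C ∧ c * (A.card : ℝ) ^ (b / h) ≤ C.card) := by
  obtain ⟨c, hc, hmain⟩ := exists_isBhPlus_or_isBhMul hm hmh hb hbk hkh hbR hP hTP hbP
  refine ⟨c / 2 * (1 / 4 : ℝ) ^ (b / h), by positivity, fun A hA => ?_⟩
  obtain ⟨s, hs, D, hD0, hDne, hAD, hDA⟩ := exists_nat_subset_of_int hA
  have hlow : c / 2 * (1 / 4 : ℝ) ^ (b / h) * (A.card : ℝ) ^ (b / h) ≤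
      c * (D.card : ℝ) ^ (b / h) / 2 := by
    have hAD' : (A.card : ℝ) ≤ 4 * D.card := by exact_mod_cast hAD
    calc _ = c / 2 * (1 / 4 * (A.card : ℝ)) ^ (b / h) := by
          rw [Real.mul_rpow (by norm_num) (by positivity), mul_assoc]
      _ ≤ c / 2 * (D.card : ℝ) ^ (b / h) := by gcongr; linarith
      _ = _ := by ring
  have hs0 : s ≠ 0 := by rintro rfl; simp at hs
  have hcard : ∀ E : Finset ℕ, ((E.image fun x : ℕ => (x : ℤ)).image (s * ·)).card = E.card := by
    intro E
    rw [card_image_of_injective _ (mul_right_injective₀ hs0),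
      card_image_of_injective _ Nat.cast_injective]
  have hsub : ∀ E ⊆ D, (E.image fun x : ℕ => (x : ℤ)).image (s * ·) ⊆ A := by
    intro E hE x hx
    simp only [mem_image, exists_exists_and_eq_and] at hx
    obtain ⟨y, hy, rfl⟩ := hx
    exact hDA y (hE hy)
  rcases lt_or_ge (c * (D.card : ℝ) ^ (b / h)) 1 with hlt | hge
  · left
    obtain ⟨x, hx⟩ : A.Nonempty := card_pos.1 (by omega)
    refine ⟨{x}, by simpa using hx, isBhPlus_singleton h x, ?_⟩
    rw [card_singleton, Nat.cast_one]
    linarith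
  · have hfloor : c * (D.card : ℝ) ^ (b / h) / 2 ≤ (⌊c * (D.card : ℝ) ^ (b / h)⌋₊ : ℝ) := by
      have h1 := Nat.lt_floor_add_one (c * (D.card : ℝ) ^ (b / h))
      have h2 : (1 : ℝ) ≤ ⌊c * (D.card : ℝ) ^ (b / h)⌋₊ := by
        exact_mod_cast Nat.le_floor (by simpa using hge)
      linarith
    rcases hmain D hD0 hDne _ (Nat.floor_le (by positivity)) with
      ⟨B, hB, hBh, hBM⟩ | ⟨C, hC, hCh, hCM⟩
    · refine Or.inl ⟨_, hsub B hB, hBh.image_sign hs, ?_⟩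
      rw [hcard, hBM]
      exact hlow.trans hfloor
    · refine Or.inr ⟨_, hsub C hC, hCh.image_sign hs, ?_⟩
      rw [hcard, hCM]
      exact hlow.trans hfloor

end Integers

theorem stmt14 :
    ∀ ε : ℝ, 0 < ε → ε < 1 / 2 →
      ∃ h₀ : ℕ, ∀ h : ℕ, h₀ ≤ h →
        ∃ c c' : ℝ, 0 < c ∧ 0 < c' ∧
          ∀ A : Finset ℤ, 2 ≤ A.card →
            (∀ B C : Finset ℤ,
              B ⊆ A → IsBhPlus h B →
              (∀ B' : Finset ℤ, B' ⊆ A → IsBhPlus h B' → B'.card ≤ B.card) →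
              C ⊆ A → IsBhMul h C →
              (∀ C' : Finset ℤ, C' ⊆ A → IsBhMul h C' → C'.card ≤ C.card) →
              c' * (A.card : ℝ) ^ ((Real.logb 2 h) ^ ((1 : ℝ) / 2 - ε) / h) ≤
                (max B.card C.card : ℝ)) ∧
            c * (A.card : ℝ) ^ ((Real.logb 2 h) ^ ((1 : ℝ) / 2 - ε)) ≤
              ((nFold A h).card : ℝ) + ((nFoldMul A h).card : ℝ) := by
  intro ε hε hε'
  obtain ⟨h₀, hh₀⟩ := exists_parameters hε hε'
  refine ⟨h₀, fun h hh => ?_⟩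
  obtain ⟨m, k, R, P, hm, hmh, hb, hbk, hkh, hbR, hP, hTP, hbP⟩ := hh₀ h hh
  set b := (Real.logb 2 h) ^ ((1 : ℝ) / 2 - ε) with hbdef
  have hh0 : (0 : ℝ) < h := by
    have := (Nat.one_le_two_pow (n := m)).trans hmh
    exact_mod_cast this
  obtain ⟨c, hc, hmain⟩ := exists_large_isBhPlus_or_isBhMul hm hmh hb hbk hkh hbR hP hTP hbP
  refine ⟨c ^ h / h.factorial, c, by positivity, hc, fun A hA => ⟨?_, ?_⟩⟩
  · intro B C _ _ hBmax _ _ hCmax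
    rcases hmain A hA with ⟨B', hB', hBh, hle⟩ | ⟨C', hC', hCh, hle⟩
    · exact hle.trans (le_max_of_le_left (by exact_mod_cast hBmax B' hB' hBh))
    · exact hle.trans (le_max_of_le_right (by exact_mod_cast hCmax C' hC' hCh))
  · have hpow : ∀ N X : ℕ, c * (A.card : ℝ) ^ (b / h) ≤ N → (N : ℝ) ^ h ≤ h.factorial * X →
        c ^ h / h.factorial * (A.card : ℝ) ^ b ≤ X := by
      intro N X hN hX
      rw [div_mul_eq_mul_div, div_le_iff₀' (by positivity)]
      refine le_trans ?_ hX
      calc c ^ h * (A.card : ℝ) ^ b = (c * (A.card : ℝ) ^ (b / h)) ^ h := by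
            rw [mul_pow, ← Real.rpow_natCast (_ ^ (b / h)) h, ← Real.rpow_mul (by positivity),
              div_mul_cancel₀ _ hh0.ne']
        _ ≤ _ := by gcongr
    rcases hmain A hA with ⟨B, hBA, hBh, hle⟩ | ⟨C, hCA, hCh, hle⟩
    · exact (hpow _ _ hle (hBh.pow_card_le hBA)).trans (le_add_of_nonneg_right (by positivity))
    · exact (hpow _ _ hle (hCh.pow_card_le hCA)).trans (le_add_of_nonneg_left (by positivity))
end

section
/- There is an absolute constant c > 0 with the following property. Let p ≥ 3 be a prime and Γ ≤ F_p^* a multiplicative subgroup with t = |Γ|. Then dim(Γ) ≥ c · min{ log p / log log p, log p / log t, φ(t) }, where dim(Γ) is the additive dimension of Γ viewed as a subset of the additive group of F_p and φ is Euler's totient function. -/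
open Finset Pointwise

universe u

/-- The shift operator on rational sequences. -/
def seqShift : Module.End ℚ (ℕ → ℚ) := LinearMap.funLeft ℚ ℚ Nat.succ

theorem seqShift_pow_apply (k : ℕ) (a : ℕ → ℚ) (n : ℕ) : (seqShift ^ k) a n = a (n + k) := by
  induction k generalizing n with
  | zero => simp
  | succ k ih =>
    rw [pow_succ', Module.End.mul_apply]
    change (seqShift ^ k) a (n + 1) = _
    rw [ih]
    congr 1
    ring

/-- If every shift of a nonzero sequence of period `t`, all of whose sums over cosets of the
prime-order subgroups vanish, lies in the span of `d` sequences, then `φ(t) ≤ d`. -/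
theorem totient_le_card_of_shifts_mem_span {ι : Type*} [Fintype ι] {t : ℕ} (ht : 0 < t)
    (a : ℕ → ℚ) (ha : a ≠ 0) (hper : ∀ n, a (n + t) = a n)
    (hsum : ∀ q, q.Prime → q ∣ t → ∀ n, ∑ j ∈ range q, a (n + t / q * j) = 0)
    (w : ι → ℕ → ℚ) (hw : ∀ k, (seqShift ^ k) a ∈ Submodule.span ℚ (Set.range w)) :
    t.totient ≤ Fintype.card ι := by
  set U : Submodule ℚ (ℕ → ℚ) := Submodule.span ℚ (Set.range fun k => (seqShift ^ k) a) with hU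
  have hUle : U ≤ Submodule.span ℚ (Set.range w) := by
    rw [hU, Submodule.span_le]
    rintro _ ⟨k, rfl⟩
    exact hw k
  have : FiniteDimensional ℚ (Submodule.span ℚ (Set.range w)) :=
    FiniteDimensional.span_of_finite ℚ (Set.finite_range w)
  have : FiniteDimensional ℚ U := Submodule.finiteDimensional_of_le hUle
  have hdim : Module.finrank ℚ U ≤ Fintype.card ι :=
    (Submodule.finrank_mono hUle).trans (finrank_range_le_card w)
  have hinv : ∀ x ∈ U, seqShift x ∈ U := by
    intro x hx
    have : U ≤ U.comap seqShift := by
      conv_lhs => rw [hU]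
      rw [Submodule.span_le]
      rintro _ ⟨k, rfl⟩
      refine Submodule.subset_span ⟨k + 1, ?_⟩
      simp [pow_succ']
    exact this hx
  have haU : a ∈ U := Submodule.subset_span ⟨0, by simp⟩
  have : Nontrivial U := ⟨⟨a, haU⟩, 0, fun h => ha (congrArg Subtype.val h)⟩
  set T : Module.End ℚ U := seqShift.restrict hinv with hT
  have hTpow : ∀ (k : ℕ) (x : U), ((T ^ k) x : ℕ → ℚ) = (seqShift ^ k) x := by
    intro k x
    rw [hT, Module.End.pow_restrict]
    rfl
  -- a combination of shifts which kills every shift of `a` kills `U`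
  have hkill : ∀ (s : Finset ℕ) (e : ℕ → ℕ) (c : ℕ → ℚ),
      (∀ n, ∑ j ∈ s, c j * a (n + e j) = 0) → ∑ j ∈ s, c j • T ^ e j = 0 := by
    intro s e c h
    have hle : U ≤ LinearMap.ker (∑ j ∈ s, c j • seqShift ^ e j) := by
      rw [hU, Submodule.span_le]
      rintro _ ⟨k, rfl⟩
      rw [SetLike.mem_coe, LinearMap.mem_ker]
      funext n
      simp only [LinearMap.sum_apply, LinearMap.smul_apply, Finset.sum_apply, Pi.smul_apply,
        smul_eq_mul, seqShift_pow_apply, Pi.zero_apply]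
      rw [← h (n + k)]
      refine Finset.sum_congr rfl fun j _ => ?_
      congr 2
      ring
    ext x : 2
    have := hle x.2
    rw [LinearMap.mem_ker] at this
    simpa [LinearMap.sum_apply, hTpow] using this
  have hint : IsIntegral ℚ T := Algebra.IsIntegral.isIntegral T
  have hdeg : (minpoly ℚ T).degree ≠ 0 := (minpoly.degree_pos hint).ne'
  obtain ⟨ζ, hζ⟩ := IsAlgClosed.exists_aeval_eq_zero ℂ (minpoly ℚ T) hdeg
  have hroot : ∀ P : Polynomial ℚ, Polynomial.aeval T P = 0 → Polynomial.aeval ζ P = 0 := by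
    intro P hP
    obtain ⟨Q, rfl⟩ := minpoly.dvd ℚ T hP
    rw [map_mul, hζ, zero_mul]
  have hζt : ζ ^ t = 1 := by
    have h1 := hkill {0, 1} (fun j => if j = 0 then t else 0) (fun j => if j = 0 then 1 else -1)
      (by intro n; simp [hper])
    have h2 := hroot (Polynomial.X ^ t - 1) (by
      rw [map_sub, map_pow, Polynomial.aeval_X, map_one, ← h1, Finset.sum_pair zero_ne_one,
        if_pos rfl, if_pos rfl, if_neg one_ne_zero, if_neg one_ne_zero, one_smul, pow_zero,
        sub_eq_add_neg]
      exact congrArg (T ^ t + ·) (neg_one_smul ℚ (1 : Module.End ℚ U)).symm)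
    rw [map_sub, map_pow, Polynomial.aeval_X, map_one] at h2
    exact sub_eq_zero.mp h2
  have hζq : ∀ q, q.Prime → q ∣ t → ζ ^ (t / q) ≠ 1 := by
    intro q hq hqt h
    have h1 := hkill (range q) (fun j => t / q * j) (fun _ => 1)
      (by intro n; simpa using hsum q hq hqt n)
    have h2 := hroot (∑ j ∈ range q, Polynomial.X ^ (t / q * j)) (by simpa using h1)
    simp only [map_sum, map_pow, Polynomial.aeval_X, pow_mul, h, one_pow, Finset.sum_const,
      Finset.card_range, nsmul_eq_mul, mul_one] at h2
    exact hq.ne_zero (Nat.cast_eq_zero.mp h2)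
  have hord : orderOf ζ = t := orderOf_eq_of_pow_and_pow_div_prime ht hζt hζq
  have hprim : IsPrimitiveRoot ζ t := hord ▸ IsPrimitiveRoot.orderOf ζ
  have hdvd : Polynomial.cyclotomic t ℚ ∣ LinearMap.charpoly T := by
    rw [Polynomial.cyclotomic_eq_minpoly_rat hprim ht]
    exact (minpoly.dvd ℚ ζ hζ).trans (LinearMap.minpoly_dvd_charpoly T)
  have := Polynomial.natDegree_le_of_dvd hdvd (LinearMap.charpoly_monic T).ne_zero
  rw [Polynomial.natDegree_cyclotomic, LinearMap.charpoly_natDegree] at this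
  exact this.trans hdim

/-- The small integer vectors orthogonal modulo `p` to a fixed nonzero vector are all annihilated
by a nonzero rational functional, unless `p` is bounded by a determinant of such vectors. -/
theorem exists_functional_or_prime_le {p : ℕ} [Fact p.Prime] {ι : Type*} [Fintype ι]
    [DecidableEq ι] (l : ι → ZMod p) (hl : l ≠ 0) (B : ℕ) :
    (∃ f : (ι → ℚ) →ₗ[ℚ] ℚ, f ≠ 0 ∧ ∀ x : ι → ℤ, (∀ i, |x i| ≤ B) →
      ∑ i, (x i : ZMod p) * l i = 0 → f (fun i => (x i : ℚ)) = 0) ∨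
    p ≤ (Fintype.card ι * B) ^ Fintype.card ι := by
  set X : Set (ι → ℚ) := {y | ∃ x : ι → ℤ, (∀ i, |x i| ≤ B) ∧
    ∑ i, (x i : ZMod p) * l i = 0 ∧ y = fun i => (x i : ℚ)} with hX
  by_cases htop : Submodule.span ℚ X = ⊤
  · right
    obtain ⟨b, hbX, hspan, hli⟩ := exists_linearIndependent ℚ X
    rw [htop] at hspan
    let bas : Module.Basis b ℚ (ι → ℚ) := Module.Basis.mk hli (by simp [hspan])
    have e : ι ≃ b := (Pi.basisFun ℚ ι).indexEquiv bas
    have hmem : ∀ i, (e i : ι → ℚ) ∈ X := fun i => hbX (e i).2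
    choose x hxB hxl hxe using hmem
    let M : Matrix ι ι ℤ := Matrix.of x
    have hdet : M.det ≠ 0 := by
      have h1 : LinearIndependent ℚ (M.map (Int.cast : ℤ → ℚ)).row := by
        have h2 : (M.map (Int.cast : ℤ → ℚ)).row = (fun y : b => (y : ι → ℚ)) ∘ e := by
          funext i
          exact (hxe i).symm
        rw [h2]
        exact hli.comp e e.injective
      rw [Matrix.linearIndependent_rows_iff_isUnit, Matrix.isUnit_iff_isUnit_det] at h1
      intro h0
      have h3 : (M.map (Int.cast : ℤ → ℚ)).det = 0 := by
        have := Int.cast_det (R := ℚ) M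
        rw [h0] at this
        simpa using this.symm
      rw [h3] at h1
      simp at h1
    have hdvd : (p : ℤ) ∣ M.det := by
      rw [← ZMod.intCast_zmod_eq_zero_iff_dvd, Int.cast_det]
      exact Matrix.exists_mulVec_eq_zero_iff.mp ⟨l, hl, funext hxl⟩
    have h1 : (p : ℤ) ≤ |M.det| := Int.le_of_dvd (abs_pos.mpr hdet) ((dvd_abs _ _).mpr hdvd)
    have h2 := Matrix.det_le (A := M) (abv := AbsoluteValue.abs) (x := (B : ℤ))
      (fun i j => hxB i j)
    have h3 : (p : ℤ) ≤ (Fintype.card ι).factorial * (B : ℤ) ^ Fintype.card ι := by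
      refine h1.trans ?_
      simpa using h2
    have h4 : p ≤ (Fintype.card ι).factorial * B ^ Fintype.card ι := by exact_mod_cast h3
    rw [mul_pow]
    exact h4.trans (Nat.mul_le_mul_right _ (Nat.factorial_le_pow _))
  · left
    obtain ⟨f, hf, hle⟩ := Submodule.exists_le_ker_of_lt_top _ (lt_top_iff_ne_top.mpr htop)
    exact ⟨f, hf, fun x hxB hxl => hle (Submodule.subset_span ⟨x, hxB, hxl, rfl⟩)⟩

/-- A nonempty multiplicatively closed set of nonzero residues consists of the powers of an
element whose order is the size of the set. -/
theorem exists_generator_of_mul_closed {p : ℕ} [Fact p.Prime] (hp : 3 ≤ p) (Γ : Finset (ZMod p))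
    (hne : Γ.Nonempty) (h0 : (0 : ZMod p) ∉ Γ) (hmul : ∀ x ∈ Γ, ∀ y ∈ Γ, x * y ∈ Γ) :
    ∃ g : ZMod p, orderOf g = Γ.card ∧ ∀ x, x ∈ Γ ↔ ∃ n : ℕ, g ^ n = x := by
  have hpow : ∀ x ∈ Γ, ∀ n : ℕ, x ^ (n + 1) ∈ Γ := by
    intro x hx n
    induction n with
    | zero => simpa using hx
    | succ n ih => rw [pow_succ]; exact hmul _ ih _ hx
  let H : Subgroup (ZMod p)ˣ :=
    { carrier := {u | (u : ZMod p) ∈ Γ}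
      mul_mem' := by
        intro a b ha hb
        simpa using hmul _ ha _ hb
      one_mem' := by
        obtain ⟨x, hx⟩ := hne
        have hx0 : x ≠ 0 := fun h => h0 (h ▸ hx)
        have h1 := hpow x hx (p - 2)
        rw [show p - 2 + 1 = p - 1 by omega, ZMod.pow_card_sub_one_eq_one hx0] at h1
        simpa using h1
      inv_mem' := by
        intro u hu
        have h1 := hpow _ hu (p - 3)
        have h2 : u⁻¹ = u ^ (p - 3 + 1) := by
          rw [inv_eq_iff_mul_eq_one, ← pow_succ', show p - 3 + 1 + 1 = p - 1 by omega]
          exact ZMod.units_pow_card_sub_one_eq_one p u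
        change ((u⁻¹ : (ZMod p)ˣ) : ZMod p) ∈ Γ
        rw [h2]
        simpa using h1 }
  obtain ⟨g, hg⟩ := IsCyclic.exists_generator (α := H)
  have hiff : ∀ x, x ∈ Γ ↔ ∃ u : H, ((u : (ZMod p)ˣ) : ZMod p) = x := by
    intro x
    constructor
    · intro hx
      have hx0 : x ≠ 0 := fun h => h0 (h ▸ hx)
      exact ⟨⟨Units.mk0 x hx0, by simpa [H] using hx⟩, rfl⟩
    · rintro ⟨u, rfl⟩
      exact u.2
  have hinj : Function.Injective fun u : H => ((u : (ZMod p)ˣ) : ZMod p) :=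
    Units.val_injective.comp Subtype.val_injective
  refine ⟨((g : (ZMod p)ˣ) : ZMod p), ?_, ?_⟩
  · rw [orderOf_units, Subgroup.orderOf_coe, orderOf_eq_card_of_forall_mem_zpowers hg]
    have h1 : (Γ : Set (ZMod p)) = Set.range fun u : H => ((u : (ZMod p)ˣ) : ZMod p) := by
      ext x
      simpa using hiff x
    rw [← Set.ncard_coe_finset, h1, ← Set.image_univ, Set.ncard_image_of_injective _ hinj,
      Set.ncard_univ]
  · intro x
    rw [hiff]
    constructor
    · rintro ⟨u, rfl⟩
      obtain ⟨n, hn⟩ := (mem_powers_iff_mem_zpowers).mpr (hg u)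
      exact ⟨n, by simp only at hn; rw [← hn]; simp⟩
    · rintro ⟨n, rfl⟩
      exact ⟨g ^ n, by simp⟩

/-- Some dissociated subset of `A` of size `addDim 1 A` represents each element of `A` as a
combination with coefficients in `{-1, 0, 1}`. -/
theorem exists_dissociated_spanning {G : Type*} [AddCommGroup G] [DecidableEq G] (A : Finset G) :
    ∃ Λ ⊆ A, Λ.card = addDim 1 A ∧ ∀ x ∈ A, ∃ e : Λ → ℤ, (∀ i, |e i| ≤ 1) ∧
      ∑ i, e i • (i : G) = x ∧ ∀ h : x ∈ Λ, e = Pi.single ⟨x, h⟩ 1 := by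
  have hbdd : BddAbove {n : ℕ | ∃ Λ : Finset G, Λ ⊆ A ∧ Λ.card = n ∧ IsKDissociated 1 Λ} := by
    refine ⟨A.card, ?_⟩
    rintro _ ⟨Λ, h, rfl, -⟩
    exact Finset.card_le_card h
  obtain ⟨Λ, hΛA, hcard, hdis⟩ := Nat.sSup_mem
    (s := {n : ℕ | ∃ Λ : Finset G, Λ ⊆ A ∧ Λ.card = n ∧ IsKDissociated 1 Λ})
    ⟨0, ∅, by simp, by simp, fun _ _ _ => by simp⟩ hbdd
  refine ⟨Λ, hΛA, hcard, fun x hx => ?_⟩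
  by_cases hxΛ : x ∈ Λ
  · refine ⟨Pi.single ⟨x, hxΛ⟩ 1, fun i => ?_, ?_, fun _ => rfl⟩
    · by_cases h : i = ⟨x, hxΛ⟩
      · simp [h]
      · simp [h]
    · rw [Finset.sum_eq_single ⟨x, hxΛ⟩]
      · simp
      · intro b _ hb
        simp [hb]
      · simp
  · have hnot : ¬ IsKDissociated 1 (insert x Λ) := by
      intro hd
      have h1 := le_csSup hbdd ⟨insert x Λ, Finset.insert_subset hx hΛA, rfl, hd⟩
      rw [← hcard, Finset.card_insert_of_notMem hxΛ] at h1
      omega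
    simp only [IsKDissociated, not_forall] at hnot
    obtain ⟨ε, hε, hsum, y, hy, hy0⟩ := hnot
    rw [Finset.sum_insert hxΛ] at hsum
    have hεx : ε x ≠ 0 := by
      intro h
      rw [h, zero_smul, zero_add] at hsum
      rcases Finset.mem_insert.mp hy with rfl | hy
      · exact hy0 h
      · exact hy0 (hdis ε (fun z hz => hε z (Finset.mem_insert_of_mem hz)) hsum y hy)
    have hx1 := hε x (Finset.mem_insert_self _ _)
    have hsq : ε x * ε x = 1 := by
      rw [Nat.cast_one, abs_le] at hx1
      have : ε x = 1 ∨ ε x = -1 := by omega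
      rcases this with h | h <;> rw [h] <;> rfl
    refine ⟨fun i => -(ε x) * ε i, fun i => ?_, ?_, fun h => absurd h hxΛ⟩
    · rw [abs_mul, abs_neg]
      exact mul_le_one₀ (by simpa using hx1) (abs_nonneg _)
        (by simpa using hε i (Finset.mem_insert_of_mem i.2))
    · rw [Finset.sum_coe_sort Λ (fun i => (-(ε x) * ε i) • i)]
      simp_rw [mul_smul]
      rw [← Finset.smul_sum, ← neg_eq_of_add_eq_zero_right hsum, smul_neg, neg_smul, neg_neg,
        smul_smul, hsq, one_smul]

/-- Either `φ(|Γ|)` is at most the additive dimension `d` of `Γ`, or `p ≤ (2|Γ|²) ^ d`. -/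
theorem totient_le_addDim_or_prime_le {p : ℕ} [Fact p.Prime] (hp : 3 ≤ p) (Γ : Finset (ZMod p))
    (hne : Γ.Nonempty) (h0 : (0 : ZMod p) ∉ Γ) (hmul : ∀ x ∈ Γ, ∀ y ∈ Γ, x * y ∈ Γ) :
    Γ.card.totient ≤ addDim 1 Γ ∨ p ≤ (Γ.card * (2 * Γ.card)) ^ addDim 1 Γ := by
  obtain ⟨g, hord, hgen⟩ := exists_generator_of_mul_closed hp Γ hne h0 hmul
  obtain ⟨Λ, hΛ, hcard, hrep⟩ := exists_dissociated_spanning Γ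
  have hgΓ : ∀ n, g ^ n ∈ Γ := fun n => (hgen _).mpr ⟨n, rfl⟩
  have htpos : 0 < Γ.card := hne.card_pos
  set t := Γ.card with ht
  have hΛt : Λ.card ≤ t := Finset.card_le_card hΛ
  choose! ε hε1 hεsum hεself using hrep
  have hE1 : ∀ n i, |ε (g ^ n) i| ≤ 1 := fun n => hε1 _ (hgΓ n)
  have hEsum : ∀ n, ∑ i : Λ, (ε (g ^ n) i : ZMod p) * (i : ZMod p) = g ^ n := by
    intro n
    simpa [zsmul_eq_mul] using hεsum _ (hgΓ n)
  have hν : ∀ i : Λ, ∃ n : ℕ, g ^ n = (i : ZMod p) := fun i => (hgen _).mp (hΛ i.2)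
  choose ν hν using hν
  have hl : (fun i : Λ => (i : ZMod p)) ≠ 0 := by
    intro h
    have h1 := hEsum 0
    simp only [congrFun h, Pi.zero_apply, mul_zero, Finset.sum_const_zero, pow_zero] at h1
    exact zero_ne_one h1
  have hcardι : Fintype.card Λ = addDim 1 Γ := by rw [Fintype.card_coe, hcard]
  rcases exists_functional_or_prime_le (fun i : Λ => (i : ZMod p)) hl (2 * t) with
    ⟨f, hf0, hf⟩ | hle
  · left
    rw [← hcardι]
    set a : ℕ → ℚ := fun n => f (fun i => (ε (g ^ n) i : ℚ)) with ha
    refine totient_le_card_of_shifts_mem_span htpos a ?_ ?_ ?_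
      (fun i => (seqShift ^ ν i) a) ?_
    · intro ha0
      apply hf0
      refine LinearMap.pi_ext' fun i => LinearMap.ext_ring ?_
      have h1 := congrFun ha0 (ν i)
      simp only [ha, hν, Pi.zero_apply] at h1
      rw [hεself _ (hΛ i.2) i.2] at h1
      simp only [LinearMap.comp_apply, LinearMap.single_apply, LinearMap.zero_apply]
      rw [← h1]
      congr 1
      funext j
      by_cases hji : j = i
      · subst hji; simp
      · simp [hji]
    · intro n
      simp only [ha]
      rw [pow_add, ← hord, pow_orderOf_eq_one, mul_one]
    · intro q hq hqt n
      have h1 := hf (fun i => ∑ j ∈ range q, ε (g ^ (n + t / q * j)) i) ?_ ?_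
      · simp only [ha]
        rw [← map_sum, ← h1]
        congr 1
        funext i
        simp
      · intro i
        have hqle : q ≤ t := Nat.le_of_dvd htpos hqt
        calc |∑ j ∈ range q, ε (g ^ (n + t / q * j)) i|
            ≤ ∑ j ∈ range q, |ε (g ^ (n + t / q * j)) i| := Finset.abs_sum_le_sum_abs _ _
          _ ≤ ∑ j ∈ range q, 1 := Finset.sum_le_sum fun j _ => hE1 _ i
          _ ≤ _ := by simp; omega
      · simp only [Int.cast_sum, Finset.sum_mul]
        rw [Finset.sum_comm]
        simp only [hEsum]
        simp_rw [pow_add, pow_mul]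
        rw [← Finset.mul_sum]
        have hω : g ^ (t / q) ≠ 1 := by
          apply pow_ne_one_of_lt_orderOf
          · exact (Nat.div_pos (Nat.le_of_dvd htpos hqt) hq.pos).ne'
          · rw [hord]
            exact Nat.div_lt_self htpos hq.one_lt
        have hgeom := geom_sum_mul (g ^ (t / q)) q
        rw [← pow_mul, Nat.div_mul_cancel hqt, ← hord, pow_orderOf_eq_one, sub_self, hord] at hgeom
        rw [(mul_eq_zero.mp hgeom).resolve_right (sub_ne_zero.mpr hω), mul_zero]
    · intro k
      have hcomb : (seqShift ^ k) a = ∑ i : Λ, (ε (g ^ k) i : ℚ) • (seqShift ^ ν i) a := by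
        funext m
        simp only [Finset.sum_apply, Pi.smul_apply, seqShift_pow_apply, smul_eq_mul]
        have h1 := hf (fun j => ε (g ^ (m + k)) j -
          ∑ i : Λ, ε (g ^ k) i * ε (g ^ (m + ν i)) j) ?_ ?_
        · rw [← sub_eq_zero, ← h1]
          simp only [ha, ← smul_eq_mul, ← map_smul]
          rw [← map_sum, ← map_sub]
          congr 1
          funext j
          simp
        · intro j
          have h2 : |∑ i : Λ, ε (g ^ k) i * ε (g ^ (m + ν i)) j| ≤ Λ.card := by
            calc |∑ i : Λ, ε (g ^ k) i * ε (g ^ (m + ν i)) j|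
                ≤ ∑ i : Λ, |ε (g ^ k) i * ε (g ^ (m + ν i)) j| :=
                  Finset.abs_sum_le_sum_abs _ _
              _ ≤ ∑ i : Λ, 1 := Finset.sum_le_sum fun i _ => by
                  rw [abs_mul]
                  exact mul_le_one₀ (hE1 _ _) (abs_nonneg _) (hE1 _ _)
              _ = _ := by simp
          have h3 := abs_sub (ε (g ^ (m + k)) j) (∑ i : Λ, ε (g ^ k) i * ε (g ^ (m + ν i)) j)
          have h4 := hE1 (m + k) j
          push_cast
          omega
        · simp only [Int.cast_sub, Int.cast_sum, Int.cast_mul, sub_mul, Finset.sum_sub_distrib,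
            Finset.sum_mul, hEsum]
          rw [Finset.sum_comm]
          simp only [mul_assoc, ← Finset.mul_sum, hEsum]
          rw [sub_eq_zero, pow_add, mul_comm]
          conv_lhs => rw [← hEsum k]
          rw [Finset.sum_mul]
          refine Finset.sum_congr rfl fun i _ => ?_
          rw [pow_add, hν]
          ring
      rw [hcomb]
      exact Submodule.sum_mem _ fun i _ =>
        Submodule.smul_mem _ _ (Submodule.subset_span ⟨i, rfl⟩)
  · right
    rw [hcardι] at hle
    refine hle.trans (Nat.pow_le_pow_left (Nat.mul_le_mul_right _ ?_) _)
    rwa [← hcard]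

theorem stmt15 :
    ∃ c : ℝ, 0 < c ∧
      ∀ (p : ℕ), p.Prime → 3 ≤ p →
        ∀ Γ : Finset (ZMod p),
          Γ.Nonempty → (0 : ZMod p) ∉ Γ →
          (∀ x ∈ Γ, ∀ y ∈ Γ, x * y ∈ Γ) →
          c * min (min (Real.logb 2 p / Real.logb 2 (Real.logb 2 p))
                (Real.logb 2 p / Real.logb 2 Γ.card))
              (Nat.totient Γ.card : ℝ) ≤
            (addDim 1 Γ : ℝ) := by
  refine ⟨1 / 3, by norm_num, fun p hpp hp Γ hne h0 hmul => ?_⟩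
  have : Fact p.Prime := ⟨hpp⟩
  have hd0 : (0 : ℝ) ≤ addDim 1 Γ := Nat.cast_nonneg _
  rcases totient_le_addDim_or_prime_le hp Γ hne h0 hmul with h | h
  · have h1 : (Γ.card.totient : ℝ) ≤ addDim 1 Γ := by exact_mod_cast h
    have h2 := min_le_right (min (Real.logb 2 p / Real.logb 2 (Real.logb 2 p))
      (Real.logb 2 p / Real.logb 2 Γ.card)) (Γ.card.totient : ℝ)
    linarith
  · have h2 := (min_le_left (min (Real.logb 2 p / Real.logb 2 (Real.logb 2 p))
      (Real.logb 2 p / Real.logb 2 Γ.card)) (Γ.card.totient : ℝ)).trans (min_le_right _ _)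
    suffices hs : Real.logb 2 p / Real.logb 2 Γ.card ≤ 3 * addDim 1 Γ by linarith
    rcases (Nat.succ_le_of_lt hne.card_pos).eq_or_lt with h1 | ht
    · rw [← h1]
      simp
    · have ht2 : 2 ≤ Γ.card := ht
      have htR : (1 : ℝ) < Γ.card := by exact_mod_cast ht
      rw [div_le_iff₀ (Real.logb_pos (by norm_num) htR)]
      have h3 : p ≤ Γ.card ^ (3 * addDim 1 Γ) := by
        rw [pow_mul]
        refine h.trans (Nat.pow_le_pow_left ?_ _)
        calc Γ.card * (2 * Γ.card) ≤ Γ.card * (Γ.card * Γ.card) := by gcongr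
          _ = Γ.card ^ 3 := by ring
      have h4 : (p : ℝ) ≤ (Γ.card : ℝ) ^ (3 * addDim 1 Γ) := by exact_mod_cast h3
      have h5 := Real.logb_le_logb_of_le (b := 2) (by norm_num)
        (by exact_mod_cast hpp.pos) h4
      rw [Real.logb_pow] at h5
      simpa using h5
end
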